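/- Let ε > 0 and Δ ∈ ℕ; then for d sufficiently large the following holds. Let T be a tree with d edges and Δ(T) ≤ Δ. For any graph G on n vertices with e(G) ≥ ε·d·n that contains no copy of T, one can delete at most ε·e(G) edges from G so that every connected component of the resulting graph has a vertex cover of size at most 3d. -/

import Mathlib

namespace HS

/-- The Friedman–Pippenger goodness condition. -/
def Good {V : Type} [DecidableEq V] (N : V → Finset V) (S : Finset V) (m : ℕ) (b : V → ℕ)
    (U : Finset V) : Prop :=
  ∀ X ⊆ S, X.card ≤ 2 * m → ∑ x ∈ X, b x ≤ (X.biUnion N \ U).card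

theorem fp_step {V : Type} [DecidableEq V] (N : V → Finset V) (S : Finset V) (m cap Δ : ℕ)
    (b : V → ℕ) (U : Finset V) (hm : 1 ≤ m) (hb : ∀ v, b v ≤ Δ)
    (hexp : ∀ X ⊆ S, m < X.card → X.card ≤ 2 * m → Δ * X.card + cap ≤ (X.biUnion N).card)
    (hU : U.card < cap) (hgood : Good N S m b U) (y : V) (hy : y ∈ S) (hby : 1 ≤ b y) :
    ∃ z ∈ N y \ U, Good N S m (fun v => if v = y then b v - 1 else b v) (insert z U) := by
  classical
  by_contra hcon
  push Not at hcon
  let Crit : Finset V → Prop := fun X =>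
    X ⊆ S ∧ X.card ≤ m ∧ y ∉ X ∧ (X.biUnion N \ U).card ≤ ∑ x ∈ X, b x
  have small : ∀ X ⊆ S, X.card ≤ 2 * m → (X.biUnion N \ U).card ≤ ∑ x ∈ X, b x → X.card ≤ m := by
    intro X hXS hX hc
    by_contra hlt
    push Not at hlt
    have h1 := hexp X hXS hlt hX
    have h2 : ∑ x ∈ X, b x ≤ X.card * Δ := Finset.sum_le_card_nsmul X b Δ (fun x _ => hb x)
    have h3 : (X.biUnion N).card ≤ (X.biUnion N \ U).card + U.card := by
      have := Finset.le_card_sdiff U (X.biUnion N)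
      omega
    have h4 : X.card * Δ = Δ * X.card := mul_comm _ _
    omega
  have h0 : ∀ z ∈ N y \ U, ∃ X, Crit X ∧ z ∈ X.biUnion N := by
    intro z hz
    have h := hcon z hz
    unfold Good at h
    push Not at h
    obtain ⟨X, hXS, hX, hlt⟩ := h
    have hg := hgood X hXS hX
    have hle : ∑ x ∈ X, (if x = y then b x - 1 else b x) ≤ ∑ x ∈ X, b x := by
      apply Finset.sum_le_sum
      intro i _
      split_ifs <;> omega
    have hins : X.biUnion N \ insert z U = (X.biUnion N \ U).erase z := by
      ext a; simp only [Finset.mem_sdiff, Finset.mem_insert, Finset.mem_erase]; tauto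
    have hce : (X.biUnion N \ U).card ≤ ((X.biUnion N \ U).erase z).card + 1 := by
      have := Finset.pred_card_le_card_erase (s := X.biUnion N \ U) (a := z)
      omega
    rw [hins] at hlt
    have hyX : y ∉ X := by
      intro hyX
      have : ∑ x ∈ X, (if x = y then b x - 1 else b x) < ∑ x ∈ X, b x := by
        apply Finset.sum_lt_sum
        · intro i _
          split_ifs <;> omega
        · exact ⟨y, hyX, by simp; omega⟩
      omega
    have hzN : z ∈ X.biUnion N := by
      by_contra hzN
      have : (X.biUnion N \ U).erase z = X.biUnion N \ U := by
        apply Finset.erase_eq_of_notMem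
        simp only [Finset.mem_sdiff]; tauto
      rw [this] at hlt
      omega
    have hc : (X.biUnion N \ U).card ≤ ∑ x ∈ X, b x := by omega
    exact ⟨X, ⟨hXS, small X hXS hX hc, hyX, hc⟩, hzN⟩
  have hun : ∀ X Y, Crit X → Crit Y → Crit (X ∪ Y) := by
    rintro X Y ⟨hX1, hX2, hX3, hX4⟩ ⟨hY1, hY2, hY3, hY4⟩
    have hS : X ∪ Y ⊆ S := Finset.union_subset hX1 hY1
    have hc : (X ∪ Y).card ≤ 2 * m := by
      have := Finset.card_union_le X Y
      omega
    have hi := hgood (X ∩ Y) (Finset.inter_subset_left.trans hX1) (by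
      have := Finset.card_le_card (Finset.inter_subset_left (s₁ := X) (s₂ := Y))
      omega)
    have e1 : (X ∪ Y).biUnion N \ U = (X.biUnion N \ U) ∪ (Y.biUnion N \ U) := by
      rw [Finset.union_biUnion, Finset.union_sdiff_distrib]
    have e2 : (X ∩ Y).biUnion N \ U ⊆ (X.biUnion N \ U) ∩ (Y.biUnion N \ U) := by
      intro a
      simp only [Finset.mem_sdiff, Finset.mem_inter, Finset.mem_biUnion]
      rintro ⟨⟨x, hx, hx'⟩, hu⟩
      exact ⟨⟨⟨x, hx.1, hx'⟩, hu⟩, ⟨⟨x, hx.2, hx'⟩, hu⟩⟩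
    have e3 := Finset.card_le_card e2
    have e4 := Finset.card_union_add_card_inter (X.biUnion N \ U) (Y.biUnion N \ U)
    have e5 := Finset.sum_union_inter (s₁ := X) (s₂ := Y) (f := b)
    have e6 : ((X ∪ Y).biUnion N \ U).card ≤ ∑ x ∈ X ∪ Y, b x := by
      rw [e1]; omega
    exact ⟨hS, small _ hS hc e6, by simp [hX3, hY3], e6⟩
  have hall : ∀ Z : Finset V, Z ⊆ N y \ U → ∃ X, Crit X ∧ Z ⊆ X.biUnion N := by
    intro Z
    induction Z using Finset.induction_on with
    | empty => intro _; exact ⟨∅, ⟨by simp, by simp, by simp, by simp⟩, by simp⟩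
    | insert a Z ha ih =>
      intro hZ
      obtain ⟨X, hX, hXZ⟩ := ih ((Finset.subset_insert _ _).trans hZ)
      obtain ⟨Y, hY, hYa⟩ := h0 a (hZ (Finset.mem_insert_self _ _))
      refine ⟨X ∪ Y, hun X Y hX hY, ?_⟩
      rw [Finset.union_biUnion]
      intro w hw
      rcases Finset.mem_insert.1 hw with rfl | hw
      · exact Finset.mem_union_right _ hYa
      · exact Finset.mem_union_left _ (hXZ hw)
  obtain ⟨X, ⟨hX1, hX2, hX3, hX4⟩, hXZ⟩ := hall _ (Finset.Subset.refl _)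
  have hg := hgood (insert y X) (Finset.insert_subset hy hX1) (by
    rw [Finset.card_insert_of_notMem hX3]; omega)
  rw [Finset.sum_insert hX3] at hg
  have : (insert y X).biUnion N \ U ⊆ X.biUnion N \ U := by
    intro a
    simp only [Finset.biUnion_insert, Finset.mem_sdiff, Finset.mem_union]
    rintro ⟨h | h, hu⟩
    · exact ⟨hXZ (by simp [h, hu]), hu⟩
    · exact ⟨h, hu⟩
  have := Finset.card_le_card this
  omega

end HS


namespace HS
open scoped Classical

/-- The neighbours of `v` inside `A`. -/
noncomputable def nbr {V : Type} (G : SimpleGraph V) (A : Finset V) (v : V) : Finset V :=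
  A.filter (fun z => G.Adj v z)

theorem mem_nbr {V : Type} {G : SimpleGraph V} {A : Finset V} {v z : V} :
    z ∈ nbr G A v ↔ z ∈ A ∧ G.Adj v z := by simp [nbr]

/-- Residual demand. -/
noncomputable def bI {V : Type} (p : ℕ → ℕ) (Δ : ℕ) (f : ℕ → V) (k : ℕ) (A : Finset V) (v : V) :
    ℕ :=
  Δ - ((Finset.range k).filter (fun j => 0 < j ∧ f (p j) = v ∧ f j ∈ A)).card

/-- Used vertices of `A`. -/
noncomputable def UI {V : Type} (f : ℕ → V) (k : ℕ) (A : Finset V) : Finset V :=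
  ((Finset.range k).image f).filter (fun z => z ∈ A)

theorem UI_succ_notMem {V : Type} (f f' : ℕ → V) (k : ℕ) (A : Finset V)
    (hff : ∀ j < k, f' j = f j) (hz : f' k ∉ A) : UI f' (k + 1) A = UI f k A := by
  ext a
  simp only [UI, Finset.mem_filter, Finset.mem_image, Finset.mem_range]
  constructor
  · rintro ⟨⟨j, hj, rfl⟩, ha⟩
    have : j ≠ k := by rintro rfl; exact hz ha
    have hj' : j < k := by omega
    exact ⟨⟨j, hj', (hff j hj').symm⟩, ha⟩
  · rintro ⟨⟨j, hj, rfl⟩, ha⟩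
    exact ⟨⟨j, by omega, hff j hj⟩, ha⟩

theorem UI_succ_mem {V : Type} (f f' : ℕ → V) (k : ℕ) (A : Finset V)
    (hff : ∀ j < k, f' j = f j) (hz : f' k ∈ A) : UI f' (k + 1) A = insert (f' k) (UI f k A) := by
  ext a
  simp only [UI, Finset.mem_filter, Finset.mem_image, Finset.mem_range, Finset.mem_insert]
  constructor
  · rintro ⟨⟨j, hj, rfl⟩, ha⟩
    by_cases h : j = k
    · left; rw [h]
    · have hj' : j < k := by omega
      exact Or.inr ⟨⟨j, hj', (hff j hj').symm⟩, ha⟩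
  · rintro (rfl | ⟨⟨j, hj, rfl⟩, ha⟩)
    · exact ⟨⟨k, by omega, rfl⟩, hz⟩
    · exact ⟨⟨j, by omega, hff j hj⟩, ha⟩

theorem bI_succ_notMem {V : Type} (p : ℕ → ℕ) (Δ : ℕ) (f f' : ℕ → V) (k : ℕ) (A : Finset V)
    (hp : ∀ j, 0 < j → j ≤ k → p j < j)
    (hff : ∀ j < k, f' j = f j) (hz : f' k ∉ A) : bI p Δ f' (k + 1) A = bI p Δ f k A := by
  ext v
  unfold bI
  congr 2
  ext j
  simp only [Finset.mem_filter, Finset.mem_range]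
  constructor
  · rintro ⟨hj, h0, h1, h2⟩
    have : j ≠ k := by rintro rfl; exact hz h2
    have hj' : j < k := by omega
    have := hp j h0 hj'.le
    rw [hff _ (by omega)] at h1
    rw [hff _ hj'] at h2
    exact ⟨hj', h0, h1, h2⟩
  · rintro ⟨hj, h0, h1, h2⟩
    have := hp j h0 hj.le
    rw [hff _ (by omega), hff _ hj]
    exact ⟨by omega, h0, h1, h2⟩

theorem bI_succ_mem {V : Type} (p : ℕ → ℕ) (Δ : ℕ) (f f' : ℕ → V) (k : ℕ) (A : Finset V)
    (hk : 0 < k) (hp : ∀ j, 0 < j → j ≤ k → p j < j)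
    (hff : ∀ j < k, f' j = f j) (hz : f' k ∈ A) :
    bI p Δ f' (k + 1) A =
      fun v => if v = f (p k) then bI p Δ f k A v - 1 else bI p Δ f k A v := by
  ext v
  have key : (Finset.range (k + 1)).filter (fun j => 0 < j ∧ f' (p j) = v ∧ f' j ∈ A) =
      if v = f (p k) then
        insert k ((Finset.range k).filter (fun j => 0 < j ∧ f (p j) = v ∧ f j ∈ A))
      else ((Finset.range k).filter (fun j => 0 < j ∧ f (p j) = v ∧ f j ∈ A)) := by
    ext j
    have hpk := hp k hk le_rfl
    by_cases hjk : j = k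
    · subst hjk
      rw [Finset.mem_filter, hff _ hpk]
      by_cases hv : v = f (p j)
      · simp [hv, hk, hz]
      · simp [hv, Ne.symm hv]
    · have : j ∈ (if v = f (p k) then
        insert k ((Finset.range k).filter (fun j => 0 < j ∧ f (p j) = v ∧ f j ∈ A))
      else ((Finset.range k).filter (fun j => 0 < j ∧ f (p j) = v ∧ f j ∈ A))) ↔
        j ∈ ((Finset.range k).filter (fun j => 0 < j ∧ f (p j) = v ∧ f j ∈ A)) := by
        split_ifs <;> simp [hjk]
      rw [this]
      simp only [Finset.mem_filter, Finset.mem_range]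
      constructor
      · rintro ⟨hj, h0, h1, h2⟩
        have hj' : j < k := by omega
        have := hp j h0 hj'.le
        rw [hff _ (by omega)] at h1
        rw [hff _ hj'] at h2
        exact ⟨hj', h0, h1, h2⟩
      · rintro ⟨hj, h0, h1, h2⟩
        have := hp j h0 hj.le
        rw [hff _ (by omega), hff _ hj]
        exact ⟨by omega, h0, h1, h2⟩
  unfold bI
  rw [key]
  split_ifs
  · rw [Finset.card_insert_of_notMem (by simp)]
    omega
  · rfl

/-- A valid partial run of the embedding procedure. -/
structure ValidRun {V Q : Type} (G : SimpleGraph V) (p : ℕ → ℕ) (π : Q → V)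
    (Move : ℕ → Q → Q → Prop) (s0 : Q) (k : ℕ) (st : ℕ → Q) : Prop where
  root : st 0 = s0
  move : ∀ j, 0 < j → j < k → Move j (st (p j)) (st j)
  adj : ∀ j, 0 < j → j < k → G.Adj (π (st (p j))) (π (st j))
  inj : ∀ i < k, ∀ j < k, π (st i) = π (st j) → i = j

theorem engine {V I Q : Type} (G : SimpleGraph V) (N : ℕ) (p : ℕ → ℕ)
    (hp : ∀ k, 0 < k → k < N → p k < k) (Δ : ℕ)
    (hΔ : ∀ j, ((Finset.range N).filter (fun k => 0 < k ∧ p k = j)).card ≤ Δ)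
    (tgt src : I → Finset V) (m cap : I → ℕ) (Rs : Finset V)
    (hdisj : ∀ i j, i ≠ j → Disjoint (tgt i) (tgt j))
    (hdisjR : ∀ i, Disjoint (tgt i) Rs)
    (hm : ∀ i, 1 ≤ m i)
    (hexpa : ∀ i, ∀ X ⊆ src i, X.card ≤ m i → Δ * X.card ≤ (X.biUnion (nbr G (tgt i))).card)
    (hexpb : ∀ i, ∀ X ⊆ src i, m i < X.card → X.card ≤ 2 * m i →
      Δ * X.card + cap i ≤ (X.biUnion (nbr G (tgt i))).card)
    (π : Q → V) (Move : ℕ → Q → Q → Prop) (s0 : Q) (hs0 : π s0 ∈ Rs)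
    (hstep : ∀ k, 0 < k → k < N → ∀ st : ℕ → Q, ValidRun G p π Move s0 k st →
      (∃ L : Finset V, (∀ z ∈ L, z ∈ Rs ∧ G.Adj (π (st (p k))) z ∧
          ∃ s', π s' = z ∧ Move k (st (p k)) s') ∧
        ((Finset.range k).filter (fun j => π (st j) ∈ Rs)).card < L.card) ∨
      (∃ i, π (st (p k)) ∈ src i ∧
        (∀ z ∈ tgt i, G.Adj (π (st (p k))) z → ∃ s', π s' = z ∧ Move k (st (p k)) s') ∧
        ((Finset.range k).filter (fun j => π (st j) ∈ tgt i)).card < cap i)) :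
    ∃ f : ℕ → V, (∀ i < N, ∀ j < N, f i = f j → i = j) ∧
      ∀ k, 0 < k → k < N → G.Adj (f (p k)) (f k) := by
  have main : ∀ k, k < N → ∃ st : ℕ → Q, ValidRun G p π Move s0 (k + 1) st ∧
      ∀ i, Good (nbr G (tgt i)) (src i) (m i) (bI p Δ (fun j => π (st j)) (k + 1) (tgt i))
        (UI (fun j => π (st j)) (k + 1) (tgt i)) := by
    intro k
    induction k with
    | zero =>
      intro _
      refine ⟨fun _ => s0, ⟨rfl, fun j h1 h2 => by omega, fun j h1 h2 => by omega,
        fun i hi j hj _ => by omega⟩, ?_⟩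
      intro i X hX hXm
      have hU : UI (fun _ => π s0) (0 + 1) (tgt i) = ∅ := by
        apply Finset.eq_empty_of_forall_notMem
        intro a ha
        simp only [UI, Finset.mem_filter, Finset.mem_image] at ha
        obtain ⟨⟨_, _, rfl⟩, ha⟩ := ha
        exact Finset.disjoint_left.1 (hdisjR i) ha hs0
      rw [hU, Finset.sdiff_empty]
      have hb : ∑ x ∈ X, bI p Δ (fun _ => π s0) (0 + 1) (tgt i) x ≤ X.card * Δ :=
        Finset.sum_le_card_nsmul X _ Δ (fun x _ => by unfold bI; omega)
      refine hb.trans ?_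
      rw [mul_comm]
      by_cases h : X.card ≤ m i
      · exact hexpa i X hX h
      · have := hexpb i X hX (by omega) hXm
        omega
    | succ k ih =>
      intro hkN
      obtain ⟨st, hv, hg⟩ := ih (by omega)
      have hp' : ∀ j, 0 < j → j ≤ k + 1 → p j < j := fun j h1 h2 => hp j h1 (by omega)
      have hpk := hp' (k + 1) (by omega) le_rfl
      have build : ∀ s', Move (k + 1) (st (p (k + 1))) s' →
          G.Adj (π (st (p (k + 1)))) (π s') → (∀ j < k + 1, π (st j) ≠ π s') →
          ValidRun G p π Move s0 (k + 1 + 1) (Function.update st (k + 1) s') := by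
        intro s' hmv hadj hne
        have hup : ∀ j, j < k + 1 → Function.update st (k + 1) s' j = st j := by
          intro j hj
          exact Function.update_of_ne (by omega) _ _
        have hupk : Function.update st (k + 1) s' (k + 1) = s' := Function.update_self _ _ _
        refine ⟨?_, ?_, ?_, ?_⟩
        · rw [hup 0 (by omega)]; exact hv.root
        · intro j h0 hj
          by_cases hjk : j = k + 1
          · subst hjk
            rw [hupk, hup _ hpk]; exact hmv
          · have := hp' j h0 (by omega)
            rw [hup _ (by omega), hup _ (by omega)]
            exact hv.move j h0 (by omega)
        · intro j h0 hj
          by_cases hjk : j = k + 1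
          · subst hjk
            rw [hupk, hup _ hpk]; exact hadj
          · have := hp' j h0 (by omega)
            rw [hup _ (by omega), hup _ (by omega)]
            exact hv.adj j h0 (by omega)
        · intro i hi j hj hij
          by_cases hik : i = k + 1
          · by_cases hjk : j = k + 1
            · omega
            · rw [hik, hupk, hup j (by omega)] at hij
              exact absurd hij.symm (hne j (by omega))
          · by_cases hjk : j = k + 1
            · rw [hjk, hupk, hup i (by omega)] at hij
              exact absurd hij (hne i (by omega))
            · rw [hup i (by omega), hup j (by omega)] at hij
              exact hv.inj i (by omega) j (by omega) hij
      have hup2 : ∀ s', ∀ j, j < k + 1 →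
          (fun j => π (Function.update st (k + 1) s' j)) j = (fun j => π (st j)) j := by
        intro s' j hj
        simp only
        rw [Function.update_of_ne (by omega)]
      have hupk2 : ∀ s', (fun j => π (Function.update st (k + 1) s' j)) (k + 1) = π s' := by
        intro s'
        simp only
        rw [Function.update_self]
      rcases hstep (k + 1) (by omega) hkN st hv with ⟨L, hL, hLc⟩ | ⟨i, hsrc, hmv, hcap⟩
      · have : ∃ z ∈ L, ∀ j < k + 1, π (st j) ≠ z := by
          by_contra hcon
          push Not at hcon
          have hsub : L ⊆ ((Finset.range (k + 1)).filter (fun j => π (st j) ∈ Rs)).image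
              (fun j => π (st j)) := by
            intro z hz
            obtain ⟨j, hj, hjz⟩ := hcon z hz
            rw [Finset.mem_image]
            refine ⟨j, ?_, hjz⟩
            rw [Finset.mem_filter, hjz]
            exact ⟨Finset.mem_range.2 hj, (hL z hz).1⟩
          have h1 := Finset.card_le_card hsub
          have h2 := Finset.card_image_le (s := ((Finset.range (k + 1)).filter
            (fun j => π (st j) ∈ Rs))) (f := fun j => π (st j))
          omega
        obtain ⟨z, hzL, hz⟩ := this
        obtain ⟨hzR, hadj, s', rfl, hmv⟩ := hL z hzL
        refine ⟨Function.update st (k + 1) s', build s' hmv hadj hz, ?_⟩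
        intro i
        have hnot : (fun j => π (Function.update st (k + 1) s' j)) (k + 1) ∉ tgt i := by
          rw [hupk2]
          intro h
          exact Finset.disjoint_left.1 (hdisjR i) h hzR
        rw [bI_succ_notMem p Δ _ _ (k + 1) (tgt i) hp' (hup2 s') hnot,
          UI_succ_notMem _ _ (k + 1) (tgt i) (hup2 s') hnot]
        exact hg i
      · have hb1 : 1 ≤ bI p Δ (fun j => π (st j)) (k + 1) (tgt i) (π (st (p (k + 1)))) := by
          unfold bI
          have hsub : insert (k + 1) ((Finset.range (k + 1)).filter
              (fun j => 0 < j ∧ π (st (p j)) = π (st (p (k + 1))) ∧ π (st j) ∈ tgt i)) ⊆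
              (Finset.range N).filter (fun k' => 0 < k' ∧ p k' = p (k + 1)) := by
            intro j hj
            rw [Finset.mem_insert] at hj
            rcases hj with rfl | hj
            · simp [hkN]
            · simp only [Finset.mem_filter, Finset.mem_range] at hj ⊢
              obtain ⟨h1, h2, h3, _⟩ := hj
              have := hp' j h2 (by omega)
              exact ⟨by omega, h2, hv.inj _ (by omega) _ (by omega) h3⟩
          have h1 := Finset.card_le_card hsub
          rw [Finset.card_insert_of_notMem (by simp)] at h1
          have h2 := hΔ (p (k + 1))
          simp only at h1 h2 ⊢
          omega
        have hUc : (UI (fun j => π (st j)) (k + 1) (tgt i)).card < cap i := by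
          refine lt_of_le_of_lt ?_ hcap
          have : UI (fun j => π (st j)) (k + 1) (tgt i) ⊆
              ((Finset.range (k + 1)).filter (fun j => π (st j) ∈ tgt i)).image
              (fun j => π (st j)) := by
            intro a ha
            simp only [UI, Finset.mem_filter, Finset.mem_image] at ha ⊢
            obtain ⟨⟨j, hj, rfl⟩, ha⟩ := ha
            exact ⟨j, ⟨hj, ha⟩, rfl⟩
          exact (Finset.card_le_card this).trans Finset.card_image_le
        obtain ⟨z, hz, hgz⟩ := fp_step (nbr G (tgt i)) (src i) (m i) (cap i) Δ _ _ (hm i)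
          (fun v => by unfold bI; omega) (hexpb i) hUc (hg i) _ hsrc hb1
        rw [Finset.mem_sdiff, mem_nbr] at hz
        obtain ⟨⟨hzt, hadj⟩, hzU⟩ := hz
        obtain ⟨s', rfl, hmove⟩ := hmv z hzt hadj
        have hne : ∀ j < k + 1, π (st j) ≠ π s' := by
          intro j hj h
          apply hzU
          simp only [UI, Finset.mem_filter, Finset.mem_image, Finset.mem_range]
          exact ⟨⟨j, hj, h⟩, hzt⟩
        refine ⟨Function.update st (k + 1) s', build s' hmove hadj hne, ?_⟩
        intro i'
        by_cases hii : i' = i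
        · subst hii
          have hmem : (fun j => π (Function.update st (k + 1) s' j)) (k + 1) ∈ tgt i' := by
            rw [hupk2]; exact hzt
          rw [bI_succ_mem p Δ _ _ (k + 1) (tgt i') (by omega) hp' (hup2 s') hmem,
            UI_succ_mem _ _ (k + 1) (tgt i') (hup2 s') hmem, Function.update_self]
          exact hgz
        · have hnot : (fun j => π (Function.update st (k + 1) s' j)) (k + 1) ∉ tgt i' := by
            rw [hupk2]
            intro h
            exact Finset.disjoint_left.1 (hdisj i' i hii) h hzt
          rw [bI_succ_notMem p Δ _ _ (k + 1) (tgt i') hp' (hup2 s') hnot,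
            UI_succ_notMem _ _ (k + 1) (tgt i') (hup2 s') hnot]
          exact hg i'
  rcases Nat.eq_zero_or_pos N with h0 | h0
  · subst h0
    exact ⟨fun _ => π s0, fun i hi => by omega, fun k _ hk => by omega⟩
  · obtain ⟨st, hv, _⟩ := main (N - 1) (by omega)
    have hN : N - 1 + 1 = N := by omega
    rw [hN] at hv
    exact ⟨fun j => π (st j), hv.inj, hv.adj⟩

end HS


namespace HS
open scoped Classical

theorem tree_enum {W : Type} [Fintype W] (T : SimpleGraph W) (hT : T.IsTree) (n : ℕ)
    (hn : n + 1 ≤ Fintype.card W) :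
    ∃ (σ : ℕ → W) (p : ℕ → ℕ), (∀ i ≤ n, ∀ j ≤ n, σ i = σ j → i = j) ∧
      (∀ k, 0 < k → p k < k) ∧ ∀ k, 0 < k → k ≤ n → T.Adj (σ (p k)) (σ k) := by
  induction n with
  | zero =>
    have := hT.1.nonempty
    exact ⟨fun _ => Classical.arbitrary W, fun _ => 0, fun i hi j hj _ => by omega,
      fun k hk => hk, fun k h1 h2 => by omega⟩
  | succ n ih =>
    obtain ⟨σ, p, h1, h2, h3⟩ := ih (by omega)
    have hex : ∃ w : W, w ∉ (Finset.range (n + 1)).image σ := by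
      by_contra hcon
      push Not at hcon
      have : Finset.univ ⊆ (Finset.range (n + 1)).image σ := fun w _ => hcon w
      have h := (Finset.card_le_card this).trans Finset.card_image_le
      rw [Finset.card_range, Finset.card_univ] at h
      omega
    obtain ⟨w, hw⟩ := hex
    obtain ⟨wk⟩ := hT.1.preconnected (σ 0) w
    obtain ⟨e, _, he1, he2⟩ := wk.exists_boundary_dart
      {x | x ∈ (Finset.range (n + 1)).image σ} (by simp; exact ⟨0, by omega, rfl⟩) (by simpa using hw)
    simp only [Set.mem_ofPred_eq, Finset.mem_image, Finset.mem_range] at he1 he2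
    obtain ⟨j, hj, hje⟩ := he1
    push Not at he2
    have hs : ∀ i ≤ n, Function.update σ (n + 1) e.snd i = σ i := fun i hi =>
      Function.update_of_ne (by omega) _ _
    have hs' : Function.update σ (n + 1) e.snd (n + 1) = e.snd := Function.update_self _ _ _
    refine ⟨Function.update σ (n + 1) e.snd, Function.update p (n + 1) j, ?_, ?_, ?_⟩
    · intro i hi i' hi' hii
      by_cases ha : i = n + 1
      · by_cases hb : i' = n + 1
        · omega
        · rw [ha, hs', hs i' (by omega)] at hii
          exact absurd hii.symm (he2 i' (by omega))
      · by_cases hb : i' = n + 1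
        · rw [hb, hs', hs i (by omega)] at hii
          exact absurd hii (he2 i (by omega))
        · rw [hs i (by omega), hs i' (by omega)] at hii
          exact h1 i (by omega) i' (by omega) hii
    · intro k hk
      by_cases ha : k = n + 1
      · subst ha; rw [Function.update_self]; exact hj
      · rw [Function.update_of_ne ha]; exact h2 k hk
    · intro k hk hkn
      by_cases ha : k = n + 1
      · subst ha
        rw [Function.update_self, hs', hs j (by omega), hje]
        exact e.adj
      · have := h2 k hk
        rw [Function.update_of_ne ha, hs _ (by omega), hs _ (by omega)]
        exact h3 k hk (by omega)

theorem tree_order {W : Type} [Fintype W] (T : SimpleGraph W) (hT : T.IsTree) (d Δ : ℕ)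
    (hd : T.edgeSet.ncard = d) (hΔ : ∀ w : W, (T.neighborSet w).ncard ≤ Δ) :
    ∃ p : ℕ → ℕ, (∀ k, 0 < k → p k < k) ∧
      (∀ j, ((Finset.range (d + 1)).filter (fun k => 0 < k ∧ p k = j)).card ≤ Δ) ∧
      ∀ (V : Type) (G : SimpleGraph V), (∃ f : ℕ → V,
        (∀ i < d + 1, ∀ j < d + 1, f i = f j → i = j) ∧
        ∀ k, 0 < k → k < d + 1 → G.Adj (f (p k)) (f k)) →
        ∃ f : T →g G, Function.Injective f := by
  have hcard : Fintype.card W = d + 1 := by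
    have h1 := hT.card_edgeFinset
    rw [← hd, ← h1]
    congr 1
    rw [Set.ncard_eq_toFinset_card', SimpleGraph.edgeFinset]
  obtain ⟨σ, p, h1, h2, h3⟩ := tree_enum T hT d (by omega)
  have hsurj : ∀ w, ∃ k, k < d + 1 ∧ σ k = w := by
    have himg : (Finset.range (d + 1)).image σ = Finset.univ := by
      apply Finset.eq_univ_of_card
      rw [Finset.card_image_of_injOn, Finset.card_range, hcard]
      intro i hi j hj hij
      simp only [Finset.coe_range, Set.mem_Iio] at hi hj
      exact h1 i (by omega) j (by omega) hij
    intro w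
    have : w ∈ (Finset.range (d + 1)).image σ := by rw [himg]; simp
    simpa using this
  have hedge : ∀ a b, T.Adj a b → ∃ k, 0 < k ∧ k < d + 1 ∧ s(σ (p k), σ k) = s(a, b) := by
    have himg : (Finset.Ico 1 (d + 1)).image (fun k => s(σ (p k), σ k)) = T.edgeFinset := by
      apply Finset.eq_of_subset_of_card_le
      · intro e he
        rw [Finset.mem_image] at he
        obtain ⟨k, hk, rfl⟩ := he
        rw [Finset.mem_Ico] at hk
        rw [SimpleGraph.mem_edgeFinset, SimpleGraph.mem_edgeSet]
        exact h3 k (by omega) (by omega)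
      · rw [Finset.card_image_of_injOn]
        · have := hT.card_edgeFinset
          rw [Nat.card_Ico]
          omega
        · intro k hk l hl hkl
          simp only [Finset.coe_Ico, Set.mem_Ico] at hk hl
          simp only [Sym2.eq_iff] at hkl
          have hpk := h2 k (by omega)
          have hpl := h2 l (by omega)
          rcases hkl with ⟨_, h⟩ | ⟨ha, hb⟩
          · exact h1 k (by omega) l (by omega) h
          · have := h1 _ (by omega) _ (by omega) ha
            have := h1 _ (by omega) _ (by omega) hb
            omega
    intro a b hab
    have : s(a, b) ∈ T.edgeFinset := by simpa using hab
    rw [← himg, Finset.mem_image] at this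
    obtain ⟨k, hk, hke⟩ := this
    rw [Finset.mem_Ico] at hk
    exact ⟨k, by omega, by omega, hke⟩
  refine ⟨p, h2, ?_, ?_⟩
  · intro j
    have : ((Finset.range (d + 1)).filter (fun k => 0 < k ∧ p k = j)).card ≤
        (T.neighborSet (σ j)).ncard := by
      rw [Set.ncard_eq_toFinset_card']
      apply Finset.card_le_card_of_injOn σ
      · intro k hk
        simp only [Finset.coe_filter, Finset.mem_range, Set.mem_ofPred_eq] at hk
        simp only [Set.coe_toFinset, SimpleGraph.mem_neighborSet]
        have := h3 k hk.2.1 (by omega)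
        rwa [hk.2.2] at this
      · intro k hk l hl hkl
        simp only [Finset.coe_filter, Finset.mem_range, Set.mem_ofPred_eq] at hk hl
        exact h1 k (by omega) l (by omega) hkl
    exact this.trans (hΔ _)
  · rintro V G ⟨f, hf1, hf2⟩
    choose τ hτ1 hτ2 using hsurj
    have hτσ : ∀ k, k < d + 1 → τ (σ k) = k := fun k hk =>
      h1 _ (by have := hτ1 (σ k); omega) _ (by omega) (hτ2 (σ k))
    refine ⟨⟨fun w => f (τ w), ?_⟩, ?_⟩
    · intro a b hab
      obtain ⟨k, hk0, hkd, hke⟩ := hedge a b hab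
      have hpk := h2 k hk0
      have hadj := hf2 k hk0 hkd
      rw [Sym2.eq_iff] at hke
      rcases hke with ⟨rfl, rfl⟩ | ⟨rfl, rfl⟩
      · rw [hτσ _ (by omega), hτσ _ hkd]; exact hadj
      · rw [hτσ k hkd, hτσ (p k) (by omega)]; exact hadj.symm
    · intro a b hab
      have := hf1 _ (hτ1 a) _ (hτ1 b) hab
      rw [← hτ2 a, ← hτ2 b, this]

section cuts
variable (N : ℕ) (p : ℕ → ℕ) (θ : ℕ)

/-- The piece hanging at `j`. -/
noncomputable def piece (j : ℕ) : Finset ℕ :=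
  insert j ((((Finset.range N).filter (fun i => j < i ∧ p i = j)).attach).biUnion
    (fun i => if (piece i.1).card ≤ θ then piece i.1 else ∅))
termination_by N - j
decreasing_by
  all_goals
    have := i.2
    simp only [Finset.mem_filter, Finset.mem_range] at this
    omega

theorem mem_piece (j x : ℕ) : x ∈ piece N p θ j ↔ x = j ∨
    ∃ i, i < N ∧ j < i ∧ p i = j ∧ (piece N p θ i).card ≤ θ ∧ x ∈ piece N p θ i := by
  rw [piece]
  simp only [Finset.mem_insert, Finset.mem_biUnion, Finset.mem_attach, true_and, Subtype.exists,
    Finset.mem_filter, Finset.mem_range]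
  constructor
  · rintro (h | ⟨i, ⟨h1, h2, h3⟩, h4⟩)
    · exact Or.inl h
    · split_ifs at h4 with h5
      · exact Or.inr ⟨i, h1, h2, h3, h5, h4⟩
      · simp at h4
  · rintro (h | ⟨i, h1, h2, h3, h5, h4⟩)
    · exact Or.inl h
    · exact Or.inr ⟨i, ⟨h1, h2, h3⟩, by rw [if_pos h5]; exact h4⟩

theorem piece_subset (j : ℕ) (hj : j < N) : piece N p θ j ⊆ Finset.range N := by
  induction h : N - j using Nat.strong_induction_on generalizing j with
  | _ n ih =>
    intro x hx
    rw [mem_piece] at hx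
    rcases hx with rfl | ⟨i, h1, h2, h3, _, h5⟩
    · simpa using hj
    · exact ih (N - i) (by omega) i h1 rfl h5

theorem piece_card (Δ j : ℕ)
    (hΔ : ((Finset.range N).filter (fun k => 0 < k ∧ p k = j)).card ≤ Δ) :
    (piece N p θ j).card ≤ 1 + Δ * θ := by
  have : piece N p θ j ⊆ insert j (((Finset.range N).filter (fun k => 0 < k ∧ p k = j)).biUnion
      (fun i => if (piece N p θ i).card ≤ θ then piece N p θ i else ∅)) := by
    intro x hx
    rw [mem_piece] at hx
    rw [Finset.mem_insert, Finset.mem_biUnion]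
    rcases hx with rfl | ⟨i, h1, h2, h3, h4, h5⟩
    · exact Or.inl rfl
    · refine Or.inr ⟨i, by simp; omega, by rw [if_pos h4]; exact h5⟩
  refine (Finset.card_le_card this).trans ((Finset.card_insert_le _ _).trans ?_)
  have h2 : (((Finset.range N).filter (fun k => 0 < k ∧ p k = j)).biUnion
      (fun i => if (piece N p θ i).card ≤ θ then piece N p θ i else ∅)).card ≤
      ((Finset.range N).filter (fun k => 0 < k ∧ p k = j)).card * θ := by
    apply Finset.card_biUnion_le_card_mul
    intro i _
    split_ifs with h
    · exact h
    · simp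
  have := Nat.mul_le_mul_right θ hΔ
  omega

end cuts

/-- Cut data: decomposition of the tree into pieces. -/
structure Cut (N : ℕ) (p : ℕ → ℕ) (Δ B C : ℕ) where
  cut : ℕ → Prop
  pid : ℕ → ℕ
  dp : ℕ → ℕ
  ec : ℕ → ℕ
  cut0 : cut 0
  pid_cut : ∀ k, cut k → pid k = k
  pid_not : ∀ k, ¬ cut k → pid k = pid (p k)
  dp_cut : ∀ k, cut k → dp k = 0
  dp_not : ∀ k, ¬ cut k → dp k = dp (p k) + 1
  ec0 : ec 0 = 0
  ec_cut : ∀ k, 0 < k → cut k → ec k = ec (p k) + 1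
  ec_not : ∀ k, ¬ cut k → ec k = ec (p k)
  ec_le : ∀ k < N, ec k ≤ C
  piece_le : ∀ k, ((Finset.range N).filter (fun x => pid x = k)).card ≤ B
  light : ∀ l, ((Finset.range N).filter (fun x => dp x ≤ l)).card ≤ C * (l + 1) * Δ ^ l

/-- Recursion along parents. -/
noncomputable def prec {α : Type} (p : ℕ → ℕ) (hp : ∀ k, 0 < k → p k < k) (z : α)
    (g : ℕ → α → α) : ℕ → α
  | 0 => z
  | (k + 1) => g (k + 1) (prec p hp z g (p (k + 1)))
termination_by k => k
decreasing_by exact hp (k + 1) (by omega)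

theorem exists_cut (N : ℕ) (p : ℕ → ℕ) (Δ θ C : ℕ) (hΔ1 : 1 ≤ Δ)
    (hp : ∀ k, 0 < k → p k < k)
    (hΔ : ∀ j, ((Finset.range N).filter (fun k => 0 < k ∧ p k = j)).card ≤ Δ)
    (hC : N ≤ θ * (C - 1)) (hC1 : 1 ≤ C) (hθ : 1 ≤ θ) : Nonempty (Cut N p Δ (1 + Δ * θ) C) := by
  let cut : ℕ → Prop := fun k => k = 0 ∨ θ < (piece N p θ k).card
  let pid : ℕ → ℕ := prec p hp 0 (fun k x => if cut k then k else x)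
  let dp : ℕ → ℕ := prec p hp 0 (fun k x => if cut k then 0 else x + 1)
  let ec : ℕ → ℕ := prec p hp 0 (fun k x => if cut k then x + 1 else x)
  have c0 : cut 0 := Or.inl rfl
  have pid_cut : ∀ k, cut k → pid k = k := by
    intro k hk
    cases k with
    | zero => simp only [pid, prec]
    | succ k => simp only [pid, prec]; rw [if_pos hk]
  have pid_not : ∀ k, ¬ cut k → pid k = pid (p k) := by
    intro k hk
    cases k with
    | zero => exact absurd c0 hk
    | succ k => simp only [pid]; rw [prec]; rw [if_neg hk]
  have dp_cut : ∀ k, cut k → dp k = 0 := by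
    intro k hk
    cases k with
    | zero => simp only [dp, prec]
    | succ k => simp only [dp, prec]; rw [if_pos hk]
  have dp_not : ∀ k, ¬ cut k → dp k = dp (p k) + 1 := by
    intro k hk
    cases k with
    | zero => exact absurd c0 hk
    | succ k => simp only [dp]; rw [prec]; rw [if_neg hk]
  have ec0 : ec 0 = 0 := by simp only [ec, prec]
  have ec_cut : ∀ k, 0 < k → cut k → ec k = ec (p k) + 1 := by
    intro k h0 hk
    cases k with
    | zero => omega
    | succ k => simp only [ec]; rw [prec]; rw [if_pos hk]
  have ec_not : ∀ k, ¬ cut k → ec k = ec (p k) := by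
    intro k hk
    cases k with
    | zero => exact absurd c0 hk
    | succ k => simp only [ec]; rw [prec]; rw [if_neg hk]
  have pid_piece : ∀ j x, x ∈ piece N p θ j → pid x = pid j := by
    intro j
    induction h : N - j using Nat.strong_induction_on generalizing j with
    | _ n ih =>
      intro x hx
      rw [mem_piece] at hx
      rcases hx with rfl | ⟨i, h1, h2, h3, h4, h5⟩
      · rfl
      · have hni : ¬ cut i := by rintro (h | h) <;> omega
        rw [ih (N - i) (by omega) i rfl x h5, pid_not i hni, h3]
  have mem_pid : ∀ x, x < N → ∀ z, z ∈ piece N p θ x → z ∈ piece N p θ (pid x) := by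
    intro x
    induction x using Nat.strong_induction_on with
    | _ x ih =>
      intro hx z hz
      by_cases hc : cut x
      · rw [pid_cut x hc]; exact hz
      · have hx0 : 0 < x := by
          rcases Nat.eq_zero_or_pos x with h | h
          · exact absurd (Or.inl h) hc
          · exact h
        have := hp x hx0
        rw [pid_not x hc]
        apply ih (p x) this (by omega)
        rw [mem_piece]
        refine Or.inr ⟨x, hx, this, rfl, ?_, hz⟩
        by_contra hcon
        exact hc (Or.inr (by omega))
  have cuts : ((Finset.range N).filter cut).card ≤ C := by
    have hsub : (Finset.range N).filter cut ⊆
        insert 0 ((Finset.range N).filter (fun k => 0 < k ∧ cut k)) := by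
      intro k hk
      simp only [Finset.mem_filter, Finset.mem_insert] at hk ⊢
      rcases Nat.eq_zero_or_pos k with h | h
      · exact Or.inl h
      · exact Or.inr ⟨hk.1, h, hk.2⟩
    have h1 := (Finset.card_le_card hsub).trans (Finset.card_insert_le _ _)
    have h2 : ((Finset.range N).filter (fun k => 0 < k ∧ cut k)).card * θ ≤ N := by
      have hdis : Set.PairwiseDisjoint
          (((Finset.range N).filter (fun k => 0 < k ∧ cut k) : Finset ℕ) : Set ℕ)
          (piece N p θ) := by
        intro k hk l hl hkl
        simp only [Finset.coe_filter, Set.mem_ofPred_eq] at hk hl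
        rw [Function.onFun, Finset.disjoint_left]
        intro x hx hx'
        have e1 := pid_piece k x hx
        have e2 := pid_piece l x hx'
        rw [pid_cut k hk.2.2] at e1
        rw [pid_cut l hl.2.2] at e2
        omega
      have e3 := Finset.card_biUnion hdis
      have e4 : (((Finset.range N).filter (fun k => 0 < k ∧ cut k)).biUnion
          (piece N p θ)).card ≤ N := by
        have : (((Finset.range N).filter (fun k => 0 < k ∧ cut k)).biUnion
          (piece N p θ)) ⊆ Finset.range N := by
          apply Finset.biUnion_subset.2
          intro k hk
          simp only [Finset.mem_filter, Finset.mem_range] at hk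
          exact piece_subset N p θ k hk.1
        simpa using Finset.card_le_card this
      rw [e3] at e4
      refine le_trans ?_ e4
      rw [← smul_eq_mul]
      apply Finset.card_nsmul_le_sum
      intro k hk
      simp only [Finset.mem_filter] at hk
      rcases hk.2.2 with h | h
      · omega
      · exact h.le
    have h3 : ((Finset.range N).filter (fun k => 0 < k ∧ cut k)).card ≤ C - 1 := by
      have : θ * ((Finset.range N).filter (fun k => 0 < k ∧ cut k)).card ≤ θ * (C - 1) := by
        rw [mul_comm]; exact h2.trans hC
      exact Nat.le_of_mul_le_mul_left this (by omega)
    omega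
  have lev : ∀ t, ((Finset.range N).filter (fun x => dp x = t)).card ≤ C * Δ ^ t := by
    intro t
    induction t with
    | zero =>
      refine le_trans (Finset.card_le_card ?_) (by simpa using cuts)
      intro x hx
      simp only [Finset.mem_filter] at hx ⊢
      refine ⟨hx.1, ?_⟩
      by_contra hc
      have := dp_not x hc
      omega
    | succ t ih =>
      have hsub : (Finset.range N).filter (fun x => dp x = t + 1) ⊆
          ((Finset.range N).filter (fun x => dp x = t)).biUnion
            (fun y => (Finset.range N).filter (fun k => 0 < k ∧ p k = y)) := by
        intro x hx
        simp only [Finset.mem_filter, Finset.mem_biUnion, Finset.mem_range] at hx ⊢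
        have hc : ¬ cut x := by
          intro hc
          have := dp_cut x hc
          omega
        have hx0 : 0 < x := by
          rcases Nat.eq_zero_or_pos x with h | h
          · exact absurd (Or.inl h) hc
          · exact h
        have := dp_not x hc
        have := hp x hx0
        exact ⟨p x, ⟨by omega, by omega⟩, hx.1, hx0, rfl⟩
      refine (Finset.card_le_card hsub).trans ?_
      refine (Finset.card_biUnion_le_card_mul _ _ Δ (fun y _ => hΔ y)).trans ?_
      calc _ ≤ C * Δ ^ t * Δ := Nat.mul_le_mul_right _ ih
        _ = C * Δ ^ (t + 1) := by ring
  refine ⟨⟨cut, pid, dp, ec, c0, pid_cut, pid_not, dp_cut, dp_not, ec0, ec_cut, ec_not,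
    ?_, ?_, ?_⟩⟩
  · have key : ∀ k, ec k + 1 ≤ ((Finset.range (k + 1)).filter cut).card := by
      intro k
      induction k using Nat.strong_induction_on with
      | _ k ih =>
        rcases Nat.eq_zero_or_pos k with h | h
        · subst h
          rw [ec0]
          apply Finset.card_pos.2
          exact ⟨0, by simp [c0]⟩
        · have hpk := hp k h
          have ih' := ih (p k) hpk
          by_cases hc : cut k
          · rw [ec_cut k h hc]
            have hsub : insert k ((Finset.range (p k + 1)).filter cut) ⊆
                (Finset.range (k + 1)).filter cut := by
              intro x hx
              simp only [Finset.mem_insert, Finset.mem_filter, Finset.mem_range] at hx ⊢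
              rcases hx with rfl | hx
              · exact ⟨by omega, hc⟩
              · exact ⟨by omega, hx.2⟩
            have := Finset.card_le_card hsub
            rw [Finset.card_insert_of_notMem (by simp; omega)] at this
            omega
          · rw [ec_not k hc]
            refine ih'.trans (Finset.card_le_card ?_)
            intro x hx
            simp only [Finset.mem_filter, Finset.mem_range] at hx ⊢
            exact ⟨by omega, hx.2⟩
    intro k hk
    have h1 := key k
    have h2 : ((Finset.range (k + 1)).filter cut).card ≤ ((Finset.range N).filter cut).card := by
      apply Finset.card_le_card
      intro x hx
      simp only [Finset.mem_filter, Finset.mem_range] at hx ⊢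
      exact ⟨by omega, hx.2⟩
    omega
  · intro k
    by_cases hk : ∃ x, x < N ∧ pid x = k
    · obtain ⟨x, hx, hxk⟩ := hk
      refine le_trans (Finset.card_le_card ?_) (piece_card N p θ Δ k (hΔ k))
      intro y hy
      simp only [Finset.mem_filter, Finset.mem_range] at hy
      rw [← hy.2]
      apply mem_pid y hy.1
      rw [mem_piece]
      exact Or.inl rfl
    · have : (Finset.range N).filter (fun x => pid x = k) = ∅ := by
        apply Finset.filter_eq_empty_iff.2
        intro x hx hxk
        exact hk ⟨x, by simpa using hx, hxk⟩
      rw [this]; simp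
  · intro l
    have hsub : (Finset.range N).filter (fun x => dp x ≤ l) ⊆
        (Finset.range (l + 1)).biUnion (fun t => (Finset.range N).filter (fun x => dp x = t)) := by
      intro x hx
      simp only [Finset.mem_filter, Finset.mem_biUnion, Finset.mem_range] at hx ⊢
      exact ⟨dp x, by omega, hx.1, rfl⟩
    refine (Finset.card_le_card hsub).trans ?_
    refine (Finset.card_biUnion_le_card_mul _ _ (C * Δ ^ l) ?_).trans ?_
    · intro t ht
      rw [Finset.mem_range] at ht
      refine (lev t).trans (Nat.mul_le_mul_left _ (Nat.pow_le_pow_right hΔ1 (by omega)))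
    · rw [Finset.card_range]
      apply le_of_eq
      ring

end HS


namespace HS
open scoped Classical

/-- Number of pairs `(x,y) ∈ X × Y` that are adjacent. -/
noncomputable def ec {V : Type} (G : SimpleGraph V) (X Y : Finset V) : ℕ :=
  ∑ x ∈ X, (nbr G Y x).card

section ecl
variable {V : Type} (G : SimpleGraph V)

theorem nbr_card_eq (Y : Finset V) (x : V) :
    (nbr G Y x).card = ∑ y ∈ Y, if G.Adj x y then 1 else 0 := by
  unfold nbr
  rw [Finset.card_filter]

theorem ec_comm (X Y : Finset V) : ec G X Y = ec G Y X := by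
  unfold ec
  simp_rw [nbr_card_eq]
  rw [Finset.sum_comm]
  simp_rw [G.adj_comm]

theorem ec_union_left (X X' Y : Finset V) (h : Disjoint X X') :
    ec G (X ∪ X') Y = ec G X Y + ec G X' Y := by
  unfold ec
  rw [Finset.sum_union h]

theorem ec_union_right (X Y Y' : Finset V) (h : Disjoint Y Y') :
    ec G X (Y ∪ Y') = ec G X Y + ec G X Y' := by
  rw [ec_comm, ec_union_left G _ _ _ h, ec_comm, ec_comm G Y']

theorem nbr_mono {A B : Finset V} (h : A ⊆ B) (v : V) : nbr G A v ⊆ nbr G B v :=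
  Finset.filter_subset_filter _ h

theorem nbr_le (A : Finset V) (v : V) : (nbr G A v).card ≤ A.card :=
  Finset.card_le_card (Finset.filter_subset _ _)

theorem nbr_sdiff_card (A B : Finset V) (v : V) :
    (nbr G A v).card ≤ (nbr G (A \ B) v).card + B.card := by
  have : nbr G A v ⊆ nbr G (A \ B) v ∪ B := by
    intro z hz
    rw [mem_nbr] at hz
    rw [Finset.mem_union, mem_nbr, Finset.mem_sdiff]
    tauto
  exact (Finset.card_le_card this).trans (Finset.card_union_le _ _)

end ecl

theorem avg_subset {V : Type} (g : V → ℝ) (c : ℝ) (k : ℕ) (A : Finset V) (hk : k ≤ A.card)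
    (h : c * A.card ≤ ∑ a ∈ A, g a) : ∃ A' ⊆ A, A'.card = k ∧ c * k ≤ ∑ a ∈ A', g a := by
  obtain ⟨j, hj⟩ := Nat.exists_eq_add_of_le hk
  induction j generalizing A with
  | zero => exact ⟨A, Finset.Subset.refl _, by omega, by simpa [hj] using h⟩
  | succ j ih =>
    have hne : A.Nonempty := Finset.card_pos.1 (by omega)
    have : ∃ a ∈ A, c * (A.erase a).card ≤ ∑ x ∈ A.erase a, g x := by
      by_cases hc : ∃ a ∈ A, g a ≤ c
      · obtain ⟨a, ha, hac⟩ := hc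
        refine ⟨a, ha, ?_⟩
        have e1 := Finset.add_sum_erase A g ha
        have e2 : (A.card : ℝ) = (A.erase a).card + 1 := by
          exact_mod_cast (Finset.card_erase_add_one ha).symm
        rw [e2] at h
        linarith
      · push Not at hc
        obtain ⟨a, ha⟩ := hne
        refine ⟨a, ha, ?_⟩
        have := Finset.card_nsmul_le_sum (A.erase a) g c
          (fun x hx => (hc x (Finset.mem_of_mem_erase hx)).le)
        rw [nsmul_eq_mul] at this
        linarith
    obtain ⟨a, ha, h'⟩ := this
    have e := Finset.card_erase_of_mem ha
    obtain ⟨A', h1, h2, h3⟩ := ih (A.erase a) (by omega) h' (by omega)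
    exact ⟨A', h1.trans (Finset.erase_subset _ _), h2, h3⟩

theorem ec_cast {V : Type} (G : SimpleGraph V) (X Y : Finset V) :
    (ec G X Y : ℝ) = ∑ x ∈ X, ((nbr G Y x).card : ℝ) := by
  unfold ec; push_cast; rfl

theorem shrink_ge {V : Type} (G : SimpleGraph V) (A B : Finset V) (D : ℝ) (a b : ℕ)
    (ha : a ≤ A.card) (hb : b ≤ B.card) (h : D * A.card * B.card ≤ ec G A B) :
    ∃ A' ⊆ A, ∃ B' ⊆ B, A'.card = a ∧ B'.card = b ∧ D * a * b ≤ ec G A' B' := by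
  rw [ec_cast] at h
  obtain ⟨A', hA, hAc, hA'⟩ := avg_subset (fun x => ((nbr G B x).card : ℝ)) (D * B.card) a A ha
    (by linarith)
  rw [← ec_cast, ec_comm, ec_cast] at hA'
  obtain ⟨B', hB, hBc, hB'⟩ := avg_subset (fun x => ((nbr G A' x).card : ℝ)) (D * a) b B hb
    (by linarith)
  rw [← ec_cast, ec_comm] at hB'
  exact ⟨A', hA, B', hB, hAc, hBc, hB'⟩

theorem shrink_le {V : Type} (G : SimpleGraph V) (A B : Finset V) (D : ℝ) (a b : ℕ)
    (ha : a ≤ A.card) (hb : b ≤ B.card) (h : (ec G A B : ℝ) ≤ D * A.card * B.card) :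
    ∃ A' ⊆ A, ∃ B' ⊆ B, A'.card = a ∧ B'.card = b ∧ (ec G A' B' : ℝ) ≤ D * a * b := by
  rw [ec_cast] at h
  obtain ⟨A', hA, hAc, hA'⟩ := avg_subset (fun x => -((nbr G B x).card : ℝ)) (-(D * B.card)) a A ha
    (by rw [Finset.sum_neg_distrib]; linarith)
  rw [Finset.sum_neg_distrib, ← ec_cast, ec_comm, ec_cast] at hA'
  obtain ⟨B', hB, hBc, hB'⟩ := avg_subset (fun x => -((nbr G A' x).card : ℝ)) (-(D * a)) b B hb
    (by rw [Finset.sum_neg_distrib]; linarith)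
  rw [Finset.sum_neg_distrib, ← ec_cast, ec_comm] at hB'
  exact ⟨A', hA, B', hB, hAc, hBc, by linarith⟩

theorem ec_le {V : Type} (G : SimpleGraph V) (A B : Finset V) : ec G A B ≤ A.card * B.card := by
  unfold ec
  rw [← smul_eq_mul]
  exact Finset.sum_le_card_nsmul _ _ _ (fun x _ => nbr_le G B x)

theorem density_incr {V : Type} (G : SimpleGraph V) (A B : Finset V) (D p₀ : ℝ) (q k' : ℕ)
    (hq : 2 ≤ q) (hk' : 1 ≤ k')
    (hA : A.card = q * k') (hB : B.card = q * k') (hp₀ : 0 < p₀) (hD : p₀ ≤ D)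
    (hden : D * A.card * B.card ≤ ec G A B)
    (hbad : ∃ A' ⊆ A, ∃ B' ⊆ B, k' ≤ A'.card ∧ k' ≤ B'.card ∧
      (ec G A' B' : ℝ) < p₀ / 2 * A'.card * B'.card) :
    ∃ A₁ ⊆ A, ∃ B₁ ⊆ B, A₁.card = k' ∧ B₁.card = k' ∧
      D * (1 + 1 / (2 * q ^ 2)) * k' * k' ≤ ec G A₁ B₁ := by
  obtain ⟨A'', hA'', B'', hB'', ha, hb, hlt⟩ := hbad
  obtain ⟨A', hA', B', hB', hac, hbc, hle⟩ := shrink_le G A'' B'' (p₀ / 2) k' k' ha hb hlt.le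
  have hAs : A' ⊆ A := hA'.trans hA''
  have hBs : B' ⊆ B := hB'.trans hB''
  have e1 : ec G A B = ec G A' B + ec G (A \ A') B := by
    rw [← ec_union_left G _ _ _ Finset.disjoint_sdiff, Finset.union_sdiff_of_subset hAs]
  have e2 : ec G A' B = ec G A' B' + ec G A' (B \ B') := by
    rw [← ec_union_right G _ _ _ Finset.disjoint_sdiff, Finset.union_sdiff_of_subset hBs]
  have c1 : ((A \ A').card : ℝ) = (q - 1) * k' := by
    rw [Finset.cast_card_sdiff hAs, hA, hac]; push_cast; ring
  have c2 : ((B \ B').card : ℝ) = (q - 1) * k' := by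
    rw [Finset.cast_card_sdiff hBs, hB, hbc]; push_cast; ring
  have e3 : (ec G A B : ℝ) = ec G A' B' + ec G A' (B \ B') + ec G (A \ A') B := by
    rw [e1, e2]; push_cast; ring
  rw [hA, hB] at hden
  push_cast at hden
  have hqr : (2 : ℝ) ≤ q := by exact_mod_cast hq
  have hkr : (1 : ℝ) ≤ k' := by exact_mod_cast hk'
  have hk2 : 0 < (k' : ℝ) * k' := by positivity
  have hDpos : 0 < D := by linarith
  have hkey : D * (1 + 1 / (2 * q ^ 2)) * ((q : ℝ) ^ 2 - 1) ≤ D * (q ^ 2 - 1 / 2) := by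
    rw [mul_assoc]
    apply mul_le_mul_of_nonneg_left _ hDpos.le
    have : (1 + 1 / (2 * (q : ℝ) ^ 2)) * ((q : ℝ) ^ 2 - 1) = q ^ 2 - 1 / 2 - 1 / (2 * q ^ 2) := by
      field_simp
      ring
    rw [this]
    have : 0 ≤ 1 / (2 * (q : ℝ) ^ 2) := by positivity
    linarith
  have hsmall : (ec G A' B' : ℝ) ≤ D / 2 * (k' * k') := by
    have : p₀ / 2 * k' * k' ≤ D / 2 * (k' * k') := by
      rw [mul_assoc]
      apply mul_le_mul_of_nonneg_right _ hk2.le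
      linarith
    linarith
  set E := D * (1 + 1 / (2 * (q : ℝ) ^ 2)) with hE
  have hqk : k' ≤ (q - 1) * k' := by
    have : 1 ≤ q - 1 := by omega
    nlinarith
  have n1 : (A \ A').card = (q - 1) * k' := by
    rw [Finset.card_sdiff_of_subset hAs, hA, hac, Nat.sub_mul, one_mul]
  have n2 : (B \ B').card = (q - 1) * k' := by
    rw [Finset.card_sdiff_of_subset hBs, hB, hbc, Nat.sub_mul, one_mul]
  by_cases hcase : E * (A \ A').card * B.card ≤ ec G (A \ A') B
  · obtain ⟨A₁, h1, B₁, h2, h3, h4, h5⟩ := shrink_ge G (A \ A') B E k' k'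
      (by rw [n1]; exact hqk) (by rw [hB]; nlinarith) hcase
    exact ⟨A₁, h1.trans Finset.sdiff_subset, B₁, h2, h3, h4, h5⟩
  · have hcase2 : E * A'.card * (B \ B').card ≤ ec G A' (B \ B') := by
      push Not at hcase
      rw [hac, c2]
      rw [c1, hB] at hcase
      push_cast at hcase
      have h1 : E * ((q : ℝ) ^ 2 - 1) * (k' * k') ≤ D * (q ^ 2 - 1 / 2) * (k' * k') :=
        mul_le_mul_of_nonneg_right hkey hk2.le
      nlinarith
    obtain ⟨A₁, h1, B₁, h2, h3, h4, h5⟩ := shrink_ge G A' (B \ B') E k' k'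
      (by rw [hac]) (by rw [n2]; exact hqk) hcase2
    exact ⟨A₁, h1.trans hAs, B₁, h2.trans Finset.sdiff_subset, h3, h4, h5⟩

theorem exists_regular {V : Type} (G : SimpleGraph V) (p₀ : ℝ) (hp₀ : 0 < p₀) (q s' : ℕ)
    (hq : 2 ≤ q) (hs' : 1 ≤ s') (M : ℕ) :
    ∀ (A B : Finset V) (D : ℝ), p₀ ≤ D → 1 < D * (1 + 1 / (2 * (q : ℝ) ^ 2)) ^ M →
      A.card = s' * q ^ M → B.card = s' * q ^ M → D * A.card * B.card ≤ ec G A B →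
      ∃ A₁ ⊆ A, ∃ B₁ ⊆ B, ∃ k' : ℕ, s' ≤ k' ∧ q * k' ≤ s' * q ^ M ∧
        A₁.card = q * k' ∧ B₁.card = q * k' ∧
        ∀ A' ⊆ A₁, ∀ B' ⊆ B₁, k' ≤ A'.card → k' ≤ B'.card →
          p₀ / 2 * A'.card * B'.card ≤ ec G A' B' := by
  induction M with
  | zero =>
    intro A B D hD h1 hA hB hden
    exfalso
    have h2 := ec_le G A B
    have h3 : (ec G A B : ℝ) ≤ A.card * B.card := by exact_mod_cast h2
    simp only [pow_zero, mul_one] at h1 hA hB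
    rw [hA, hB] at h3 hden
    have hs : (1 : ℝ) ≤ s' := by exact_mod_cast hs'
    have : 0 < (s' : ℝ) * s' := by positivity
    nlinarith
  | succ M ih =>
    intro A B D hD h1 hA hB hden
    have hk1 : 1 ≤ s' * q ^ M := Nat.mul_pos (by omega) (pow_pos (by omega) _)
    have hA' : A.card = q * (s' * q ^ M) := by rw [hA, pow_succ]; ring
    have hB' : B.card = q * (s' * q ^ M) := by rw [hB, pow_succ]; ring
    by_cases hbad : ∃ A' ⊆ A, ∃ B' ⊆ B, s' * q ^ M ≤ A'.card ∧ s' * q ^ M ≤ B'.card ∧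
      (ec G A' B' : ℝ) < p₀ / 2 * A'.card * B'.card
    · obtain ⟨A₁, hA₁, B₁, hB₁, ha, hb, hd⟩ := density_incr G A B D p₀ q _ hq hk1 hA' hB' hp₀ hD
        hden hbad
      have hx : 0 ≤ 1 / (2 * (q : ℝ) ^ 2) := by positivity
      obtain ⟨A₂, hA₂, B₂, hB₂, k', g1, g2, g3, g4, g5⟩ := ih A₁ B₁
        (D * (1 + 1 / (2 * (q : ℝ) ^ 2))) (by nlinarith)
        (by rw [mul_assoc, ← pow_succ']; exact h1) ha hb (by rw [ha, hb]; exact hd)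
      refine ⟨A₂, hA₂.trans hA₁, B₂, hB₂.trans hB₁, k', g1, ?_, g3, g4, g5⟩
      refine g2.trans (Nat.mul_le_mul_left _ (Nat.pow_le_pow_right (by omega) (by omega)))
    · push Not at hbad
      refine ⟨A, Finset.Subset.refl _, B, Finset.Subset.refl _, s' * q ^ M, ?_, ?_, hA', hB', ?_⟩
      · exact Nat.le_mul_of_pos_right _ (pow_pos (by omega) _)
      · rw [pow_succ]; apply le_of_eq; ring
      · intro A' h1 B' h2 h3 h4
        exact hbad A' h1 B' h2 h3 h4

end HS


namespace HS
open scoped Classical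

/-- A candidate dense spot: two sides, each split into a main part and a reserve part. -/
structure Spot (V : Type) where
  s : ℕ
  M : Bool → Finset V
  R : Bool → Finset V

noncomputable def Spot.side {V : Type} (P : Spot V) (b : Bool) : Finset V := P.M b ∪ P.R b

noncomputable def Spot.vs {V : Type} (P : Spot V) : Finset V := P.side true ∪ P.side false

structure IsSpot {V : Type} (G : SimpleGraph V) (τ η p : ℝ) (P : Spot V) : Prop where
  dMR : ∀ b, Disjoint (P.M b) (P.R b)
  dside : ∀ b, Disjoint (P.side b) (P.side (!b))
  card_side : ∀ b, (P.side b).card ≤ P.s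
  card_M : ∀ b, 17 / 20 * (P.s : ℝ) ≤ (P.M b).card
  degM : ∀ b, ∀ v ∈ P.side b, τ * P.s ≤ (nbr G (P.M (!b)) v).card
  degR : ∀ b, ∀ v ∈ P.side b, τ * P.s ≤ (nbr G (P.R (!b)) v).card
  reg : ∀ b, ∀ X ⊆ P.side b, ∀ Y ⊆ P.side (!b), η * P.s ≤ X.card → η * P.s ≤ Y.card →
    p * X.card * Y.card ≤ ec G X Y

theorem nbr_mono_graph {V : Type} {F G : SimpleGraph V} (h : F ≤ G) (A : Finset V) (v : V) :
    nbr F A v ⊆ nbr G A v := by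
  intro z
  rw [mem_nbr, mem_nbr]
  exact fun hz => ⟨hz.1, h hz.2⟩

theorem ec_mono_graph {V : Type} {F G : SimpleGraph V} (h : F ≤ G) (X Y : Finset V) :
    ec F X Y ≤ ec G X Y :=
  Finset.sum_le_sum (fun x _ => Finset.card_le_card (nbr_mono_graph h Y x))

theorem IsSpot.mono {V : Type} {F G : SimpleGraph V} (h : F ≤ G) {τ η p : ℝ} {P : Spot V}
    (hP : IsSpot F τ η p P) : IsSpot G τ η p P where
  dMR := hP.dMR
  dside := hP.dside
  card_side := hP.card_side
  card_M := hP.card_M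
  degM b v hv := (hP.degM b v hv).trans
    (by exact_mod_cast Finset.card_le_card (nbr_mono_graph h _ v))
  degR b v hv := (hP.degR b v hv).trans
    (by exact_mod_cast Finset.card_le_card (nbr_mono_graph h _ v))
  reg b X hX Y hY h1 h2 := (hP.reg b X hX Y hY h1 h2).trans
    (by exact_mod_cast ec_mono_graph h X Y)

theorem main_exp {V : Type} (G : SimpleGraph V) (τ η p : ℝ) (P : Spot V)
    (hP : IsSpot G τ η p P) (Δ : ℕ) (hp : 0 < p) (hη : 0 < η) (hτ : 0 < τ)
    (hτ1 : τ ≤ 1 / 20) (hητ : 8 * Δ * η ≤ τ) (hΔ : 1 ≤ Δ) (hs : 4 * (Δ : ℝ) ≤ τ * P.s)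
    (b : Bool) (V' : Finset V) (hV' : V' ⊆ P.M b)
    (hV'c : ((P.M b \ V').card : ℝ) ≤ τ * P.s / 2) (cap : ℕ) (hcap : (cap : ℝ) ≤ 3 / 4 * P.s) :
    (∀ X ⊆ P.side (!b), X.card ≤ ⌈η * P.s⌉₊ →
      Δ * X.card ≤ (X.biUnion (nbr G V')).card) ∧
    (∀ X ⊆ P.side (!b), ⌈η * P.s⌉₊ < X.card → X.card ≤ 2 * ⌈η * P.s⌉₊ →
      Δ * X.card + cap ≤ (X.biUnion (nbr G V')).card) := by
  have hΔr : (1 : ℝ) ≤ Δ := by exact_mod_cast hΔ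
  have hs0 : 0 < (P.s : ℝ) := by
    have : 0 < τ * P.s := by linarith
    exact (pos_iff_pos_of_mul_pos this).1 hτ
  set m := ⌈η * P.s⌉₊ with hm
  have hm1 : η * P.s ≤ m := Nat.le_ceil _
  have hm2 : (m : ℝ) < η * P.s + 1 := Nat.ceil_lt_add_one (by positivity)
  have hΔm : (Δ : ℝ) * m ≤ τ * P.s * (3 / 8) := by
    have h1 : (Δ : ℝ) * m ≤ Δ * (η * P.s + 1) := by
      apply mul_le_mul_of_nonneg_left hm2.le; linarith
    have h2 : 8 * Δ * η * P.s ≤ τ * P.s := mul_le_mul_of_nonneg_right hητ hs0.le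
    nlinarith
  constructor
  · intro X hX hXm
    rcases X.eq_empty_or_nonempty with rfl | ⟨x, hx⟩
    · simp
    · have h1 := hP.degM (!b) x (hX hx)
      rw [Bool.not_not] at h1
      have h2 := nbr_sdiff_card G (P.M b) (P.M b \ V') x
      have h3 : P.M b \ (P.M b \ V') = V' := by
        exact Finset.sdiff_sdiff_eq_self hV'
      rw [h3] at h2
      have h4 : (nbr G V' x).card ≤ (X.biUnion (nbr G V')).card :=
        Finset.card_le_card (Finset.subset_biUnion_of_mem (nbr G V') hx)
      have h2' : ((nbr G (P.M b) x).card : ℝ) ≤ (nbr G V' x).card + (P.M b \ V').card := by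
        exact_mod_cast h2
      have h4' : ((nbr G V' x).card : ℝ) ≤ (X.biUnion (nbr G V')).card := by exact_mod_cast h4
      have h5 : (Δ : ℝ) * X.card ≤ Δ * m := by
        apply mul_le_mul_of_nonneg_left _ (by linarith)
        exact_mod_cast hXm
      have : (Δ : ℝ) * X.card ≤ (X.biUnion (nbr G V')).card := by nlinarith
      exact_mod_cast this
  · intro X hX hXm hXm2
    set Y := V' \ X.biUnion (nbr G V') with hY
    have hXr : (m : ℝ) < X.card := by exact_mod_cast hXm
    have hYs : (Y.card : ℝ) < η * P.s := by
      by_contra hcon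
      push Not at hcon
      have h1 := hP.reg (!b) X hX Y (by
        rw [Bool.not_not]
        exact Finset.sdiff_subset.trans (hV'.trans Finset.subset_union_left)) (by linarith) hcon
      have h2 : ec G X Y = 0 := by
        unfold ec
        apply Finset.sum_eq_zero
        intro x hx
        rw [Finset.card_eq_zero]
        apply Finset.eq_empty_of_forall_notMem
        intro z hz
        rw [mem_nbr, hY, Finset.mem_sdiff] at hz
        apply hz.1.2
        rw [Finset.mem_biUnion]
        exact ⟨x, hx, mem_nbr.2 ⟨hz.1.1, hz.2⟩⟩
      rw [h2] at h1
      have h3 : 0 < η * P.s := by positivity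
      have h4 : 0 < (Y.card : ℝ) := by linarith
      have h5 : 0 < (X.card : ℝ) := by linarith
      have : 0 < p * X.card * Y.card := by positivity
      push_cast at h1
      linarith
    have hYc : V'.card ≤ Y.card + (X.biUnion (nbr G V')).card := by
      have := Finset.le_card_sdiff (X.biUnion (nbr G V')) V'
      rw [hY]; omega
    have hMc : ((P.M b).card : ℝ) = (P.M b \ V').card + V'.card := by
      rw [Finset.cast_card_sdiff hV']; ring
    have hYc' : (V'.card : ℝ) ≤ Y.card + (X.biUnion (nbr G V')).card := by exact_mod_cast hYc
    have h6 := hP.card_M b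
    have h5 : (Δ : ℝ) * X.card ≤ 2 * (Δ * m) := by
      have : (X.card : ℝ) ≤ 2 * m := by exact_mod_cast hXm2
      nlinarith
    have hη' : η * P.s ≤ τ / 8 * P.s := by
      apply mul_le_mul_of_nonneg_right _ hs0.le
      nlinarith
    have hτs : τ * P.s ≤ 1 / 20 * P.s := mul_le_mul_of_nonneg_right hτ1 hs0.le
    have : (Δ : ℝ) * X.card + cap ≤ (X.biUnion (nbr G V')).card := by nlinarith
    exact_mod_cast this

theorem spot_of_regular {V : Type} (G : SimpleGraph V) (p : ℝ) (hp : 0 < p) (hp1 : p ≤ 1)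
    (q k' : ℕ) (hk' : 1 ≤ k') (hq : 80 ≤ p * q) (S : Bool → Finset V)
    (hdis : ∀ b, Disjoint (S b) (S (!b))) (hc : ∀ b, (S b).card = q * k')
    (hreg : ∀ b, ∀ X ⊆ S b, ∀ Y ⊆ S (!b), k' ≤ X.card → k' ≤ Y.card →
      p * X.card * Y.card ≤ ec G X Y) :
    ∃ P : Spot V, IsSpot G (p / 20) (1 / q) p P ∧ P.s = q * k' := by
  have hq80r : (80 : ℝ) ≤ q := by
    have : (0 : ℝ) ≤ q := by positivity
    nlinarith
  have hq80 : 80 ≤ q := by exact_mod_cast hq80r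
  have hkr : (1 : ℝ) ≤ k' := by exact_mod_cast hk'
  set r := q * k' / 10 with hr
  have hrk : k' ≤ r := by
    rw [hr, Nat.le_div_iff_mul_le (by norm_num)]
    nlinarith
  have hr10 : 10 * r ≤ q * k' := Nat.mul_div_le _ _
  have hr10' : q * k' < 10 * r + 10 := by omega
  have hex : ∀ b, ∃ R0 ⊆ S b, R0.card = r := fun b =>
    Finset.exists_subset_card_eq (by rw [hc]; omega)
  choose R0 hR0 hR0c using hex
  have atyp : ∀ b, ∀ Y ⊆ S (!b), k' ≤ Y.card →
      ((S b).filter (fun v => ((nbr G Y v).card : ℝ) < p * Y.card)).card ≤ k' := by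
    intro b Y hY hYc
    by_contra hcon
    push Not at hcon
    have h1 := hreg b _ (Finset.filter_subset _ _) Y hY hcon.le hYc
    rw [ec_cast] at h1
    have h2 := Finset.sum_lt_sum_of_nonempty
      (s := (S b).filter (fun v => ((nbr G Y v).card : ℝ) < p * Y.card))
      (f := fun v => ((nbr G Y v).card : ℝ)) (g := fun _ => p * Y.card)
      (Finset.card_pos.1 (by omega)) (fun v hv => (Finset.mem_filter.1 hv).2)
    rw [Finset.sum_const, nsmul_eq_mul] at h2
    nlinarith
  let Bad : Bool → Finset V := fun b =>
    ((S b).filter (fun v => ((nbr G (R0 (!b)) v).card : ℝ) < p * (R0 (!b)).card)) ∪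
    ((S b).filter (fun v => ((nbr G (S (!b) \ R0 (!b)) v).card : ℝ) <
      p * (S (!b) \ R0 (!b)).card))
  have hM0c : ∀ b, (S b \ R0 b).card = q * k' - r := fun b => by
    rw [Finset.card_sdiff_of_subset (hR0 b), hc, hR0c]
  have hBadc : ∀ b, (Bad b).card ≤ 2 * k' := by
    intro b
    refine (Finset.card_union_le _ _).trans ?_
    have h1 := atyp b (R0 (!b)) (hR0 _) (by rw [hR0c]; exact hrk)
    have h2 := atyp b (S (!b) \ R0 (!b)) Finset.sdiff_subset (by rw [hM0c]; omega)
    omega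
  have hside : ∀ b, (S b \ R0 b) \ Bad b ∪ R0 b \ Bad b ⊆ S b := by
    intro b
    exact Finset.union_subset (Finset.sdiff_subset.trans Finset.sdiff_subset)
      (Finset.sdiff_subset.trans (hR0 b))
  have hsideBad : ∀ b, ∀ v ∈ (S b \ R0 b) \ Bad b ∪ R0 b \ Bad b, v ∉ Bad b := by
    intro b v hv
    simp only [Finset.mem_union, Finset.mem_sdiff] at hv
    tauto
  have hqk : ((q * k' : ℕ) : ℝ) = q * k' := by push_cast; ring
  have hrr : (10 : ℝ) * r ≤ q * k' := by exact_mod_cast hr10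
  have hrr' : (q : ℝ) * k' < 10 * r + 10 := by exact_mod_cast hr10'
  have hBr : ∀ b, ((Bad b).card : ℝ) ≤ 2 * k' := fun b => by exact_mod_cast hBadc b
  have hpqk : 80 * (k' : ℝ) ≤ p * q * k' := mul_le_mul_of_nonneg_right hq (by linarith)
  have h80 : (80 : ℝ) ≤ q * k' := by nlinarith
  refine ⟨⟨q * k', fun b => (S b \ R0 b) \ Bad b, fun b => R0 b \ Bad b⟩,
    ⟨?_, ?_, ?_, ?_, ?_, ?_, ?_⟩, rfl⟩
  · intro b
    rw [Finset.disjoint_left]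
    intro v hv hv'
    simp only [Finset.mem_sdiff] at hv hv'
    tauto
  · intro b
    exact Finset.disjoint_of_subset_left (hside b)
      (Finset.disjoint_of_subset_right (hside (!b)) (hdis b))
  · intro b
    have := Finset.card_le_card (hside b)
    rw [hc] at this
    exact this
  · intro b
    have h1 := Finset.le_card_sdiff (Bad b) (S b \ R0 b)
    rw [hM0c] at h1
    have h2 : q * k' ≤ ((S b \ R0 b) \ Bad b).card + (Bad b).card + r := by omega
    have h3 : (q : ℝ) * k' ≤ ((S b \ R0 b) \ Bad b).card + (Bad b).card + r := by
      exact_mod_cast h2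
    have := hBr b
    simp only [hqk]
    nlinarith
  · intro b v hv
    have hnb := hsideBad b v hv
    have hvS := hside b hv
    have h1 : ¬ (((nbr G (S (!b) \ R0 (!b)) v).card : ℝ) < p * (S (!b) \ R0 (!b)).card) := by
      intro h
      exact hnb (Finset.mem_union_right _ (Finset.mem_filter.2 ⟨hvS, h⟩))
    push Not at h1
    have h2 := nbr_sdiff_card G (S (!b) \ R0 (!b)) (Bad (!b)) v
    have h2' : ((nbr G (S (!b) \ R0 (!b)) v).card : ℝ) ≤
      (nbr G ((S (!b) \ R0 (!b)) \ Bad (!b)) v).card + (Bad (!b)).card := by exact_mod_cast h2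
    have h3 := hBr (!b)
    have h4 : ((S (!b) \ R0 (!b)).card : ℝ) = q * k' - r := by
      rw [Finset.cast_card_sdiff (hR0 _), hc, hR0c]; push_cast; ring
    rw [h4] at h1
    simp only [hqk]
    have h5 : p * (10 * r) ≤ p * (q * k') := mul_le_mul_of_nonneg_left hrr hp.le
    nlinarith
  · intro b v hv
    have hnb := hsideBad b v hv
    have hvS := hside b hv
    have h1 : ¬ (((nbr G (R0 (!b)) v).card : ℝ) < p * (R0 (!b)).card) := by
      intro h
      exact hnb (Finset.mem_union_left _ (Finset.mem_filter.2 ⟨hvS, h⟩))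
    push Not at h1
    have h2 := nbr_sdiff_card G (R0 (!b)) (Bad (!b)) v
    have h2' : ((nbr G (R0 (!b)) v).card : ℝ) ≤
      (nbr G (R0 (!b) \ Bad (!b)) v).card + (Bad (!b)).card := by exact_mod_cast h2
    have h3 := hBr (!b)
    rw [hR0c] at h1
    simp only [hqk]
    have h5 : p * (q * k') ≤ p * (10 * r + 10) := mul_le_mul_of_nonneg_left hrr'.le hp.le
    have h6 : p * 80 ≤ p * (q * k') := mul_le_mul_of_nonneg_left h80 hp.le
    nlinarith
  · intro b X hX Y hY hXc hYc
    have hqpos : (0 : ℝ) < q := by linarith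
    have e : 1 / (q : ℝ) * ((q * k' : ℕ) : ℝ) = k' := by
      rw [hqk]; field_simp
    simp only [e] at hXc hYc
    exact hreg b X (hX.trans (hside b)) Y (hY.trans (hside _)) (by exact_mod_cast hXc)
      (by exact_mod_cast hYc)

/-- The abstract embedding predicate for the ordered tree. -/
def Emb {V : Type} (N : ℕ) (p : ℕ → ℕ) (G : SimpleGraph V) : Prop :=
  ∃ f : ℕ → V, (∀ i < N, ∀ j < N, f i = f j → i = j) ∧
    ∀ k, 0 < k → k < N → G.Adj (f (p k)) (f k)

theorem exists_dense_core {V : Type} [Fintype V] (F : SimpleGraph V) (c : ℝ)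
    (h : 2 * c * Fintype.card V < ec F Finset.univ Finset.univ) :
    ∃ W : Finset V, W.Nonempty ∧ ∀ v ∈ W, c ≤ (nbr F W v).card := by
  obtain ⟨W, _, hW⟩ := Finset.exists_max_image (Finset.univ : Finset (Finset V))
    (fun W => (ec F W W : ℝ) - 2 * c * W.card) ⟨∅, Finset.mem_univ _⟩
  refine ⟨W, ?_, ?_⟩
  · rw [Finset.nonempty_iff_ne_empty]
    rintro rfl
    have := hW Finset.univ (Finset.mem_univ _)
    simp only [Finset.card_univ, Finset.card_empty] at this
    have h0 : ec F ∅ ∅ = 0 := by simp [ec]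
    rw [h0] at this
    push_cast at this
    linarith
  · intro v hv
    have := hW (W.erase v) (Finset.mem_univ _)
    have e1 : W = {v} ∪ W.erase v := by
      ext x; simp only [Finset.mem_union, Finset.mem_singleton, Finset.mem_erase]
      by_cases h : x = v <;> simp [h, hv]
    have hd : Disjoint {v} (W.erase v) := by simp
    have e2 : ec F W W = ec F {v} W + ec F (W.erase v) W := by
      conv_lhs => rw [e1]
      rw [ec_union_left F _ _ _ hd, ← e1]
    have e3 : ec F (W.erase v) W = ec F (W.erase v) {v} + ec F (W.erase v) (W.erase v) := by
      conv_lhs => rw [e1]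
      rw [Finset.erase_union_distrib, Finset.erase_singleton, Finset.empty_union,
        Finset.erase_idem, ec_union_right F _ _ _ hd]
    have e4 : ec F {v} W = (nbr F W v).card := by simp [ec]
    have e5 : ec F (W.erase v) {v} ≤ (nbr F W v).card := by
      rw [ec_comm]
      simp only [ec, Finset.sum_singleton]
      exact Finset.card_le_card (nbr_mono F (Finset.erase_subset _ _) v)
    have e6 : (W.card : ℝ) = (W.erase v).card + 1 := by
      exact_mod_cast (Finset.card_erase_add_one hv).symm
    have e7 : (ec F W W : ℝ) = (nbr F W v).card + ec F (W.erase v) {v} +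
        ec F (W.erase v) (W.erase v) := by
      rw [e2, e3, e4]; push_cast; ring
    have e8 : (ec F (W.erase v) {v} : ℝ) ≤ (nbr F W v).card := by exact_mod_cast e5
    rw [e7, e6] at this
    linarith

theorem exists_spot {V : Type} [Fintype V] (F : SimpleGraph V) (d : ℕ) (p : ℕ → ℕ)
    (hp : ∀ k, 0 < k → p k < k) (Δ : ℕ)
    (hΔ : ∀ j, ((Finset.range (d + 1)).filter (fun k => 0 < k ∧ p k = j)).card ≤ Δ)
    (hΔ1 : 1 ≤ Δ) (hfree : ¬ Emb (d + 1) p F) (δ : ℝ) (hδ : 0 < δ) (hδ1 : δ ≤ 1)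
    (q M s' m1 : ℕ) (hq : 640 ≤ δ * q) (hM : 1 < δ / 4 * (1 + 1 / (2 * (q : ℝ) ^ 2)) ^ M)
    (hs' : 1 ≤ s') (hsm : s' * q ^ M ≤ m1) (hm1 : 4 * Δ * (m1 : ℝ) ≤ δ * d) (hd2 : 2 ≤ δ * d)
    (hF : 2 * (δ * d) * Fintype.card V < ec F Finset.univ Finset.univ) :
    ∃ P : Spot V, IsSpot F (δ / 160) (1 / q) (δ / 8) P ∧ s' ≤ P.s ∧ P.s ≤ d := by
  obtain ⟨W, ⟨r, hr⟩, hW⟩ := exists_dense_core F (δ * d) hF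
  have hΔr : (1 : ℝ) ≤ Δ := by exact_mod_cast hΔ1
  have hq2 : 2 ≤ q := by
    have : (640 : ℝ) ≤ q := by
      have : (0 : ℝ) ≤ q := by positivity
      nlinarith
    have : 640 ≤ q := by exact_mod_cast this
    omega
  have hm1' : 1 ≤ m1 := le_trans (Nat.mul_pos hs' (pow_pos (by omega) _)) hsm
  have hd0 : (0 : ℝ) ≤ d := by positivity
  have hdd : δ * d ≤ d := by nlinarith
  have hΔm : (Δ : ℝ) * m1 ≤ δ * d / 4 := by linarith
  have hm1d : (m1 : ℝ) ≤ δ * d / 4 := by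
    have : (0 : ℝ) ≤ m1 := by positivity
    nlinarith
  have hX : ∃ X ⊆ W, m1 < X.card ∧ X.card ≤ 2 * m1 ∧
      (X.biUnion (nbr F (W.erase r))).card < Δ * X.card + (d + 1) := by
    by_contra hcon
    push Not at hcon
    apply hfree
    refine engine F (d + 1) p (fun k h _ => hp k h) Δ hΔ (I := Unit) (Q := V)
      (fun _ => W.erase r) (fun _ => W) (fun _ => m1) (fun _ => d + 1) {r} ?_ ?_ ?_ ?_ ?_
      id (fun _ _ s' => s' ∈ W) r (by simp) ?_
    · intro i j h; exact absurd (Subsingleton.elim i j) h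
    · intro i; simp
    · intro _; exact hm1'
    · intro _ X hX hXm
      rcases X.eq_empty_or_nonempty with rfl | ⟨x, hx⟩
      · simp
      · have h1 := hW x (hX hx)
        have h2 : (nbr F W x).card ≤ (nbr F (W.erase r) x).card + 1 := by
          have := nbr_sdiff_card F W {r} x
          rwa [Finset.card_singleton, Finset.sdiff_singleton_eq_erase] at this
        have h3 : (nbr F (W.erase r) x).card ≤ (X.biUnion (nbr F (W.erase r))).card :=
          Finset.card_le_card (Finset.subset_biUnion_of_mem (nbr F (W.erase r)) hx)
        have h4 : ((nbr F W x).card : ℝ) ≤ (X.biUnion (nbr F (W.erase r))).card + 1 := by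
          exact_mod_cast (by omega : (nbr F W x).card ≤ (X.biUnion (nbr F (W.erase r))).card + 1)
        have h5 : (Δ : ℝ) * X.card ≤ Δ * m1 := by
          apply mul_le_mul_of_nonneg_left _ (by linarith)
          exact_mod_cast hXm
        have : (Δ : ℝ) * X.card ≤ (X.biUnion (nbr F (W.erase r))).card := by linarith
        exact_mod_cast this
    · intro _ X hX h1 h2
      exact hcon X hX h1 h2
    · intro k h0 hk st hv
      right
      refine ⟨(), ?_, ?_, ?_⟩
      · rcases Nat.eq_zero_or_pos (p k) with h | h
        · rw [h, hv.root]; exact hr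
        · exact hv.move (p k) h (hp k h0)
      · intro z hz _
        exact ⟨z, rfl, Finset.mem_of_mem_erase hz⟩
      · refine lt_of_le_of_lt (Finset.card_filter_le _ _) ?_
        rw [Finset.card_range]; exact hk
  obtain ⟨X, hXW, hX1, hX2, hX3⟩ := hX
  set B₀ := X.biUnion (nbr F W) \ X with hB₀
  have hX2r : (X.card : ℝ) ≤ 2 * m1 := by exact_mod_cast hX2
  have hXpos : 0 < X.card := by omega
  have hdeg : ∀ x ∈ X, δ * d / 2 ≤ (nbr F B₀ x).card := by
    intro x hx
    have h1 := hW x (hXW hx)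
    have h2 : nbr F W x ⊆ nbr F B₀ x ∪ X := by
      intro z hz
      rw [Finset.mem_union, mem_nbr, hB₀, Finset.mem_sdiff, Finset.mem_biUnion]
      by_cases hzX : z ∈ X
      · exact Or.inr hzX
      · exact Or.inl ⟨⟨⟨x, hx, hz⟩, hzX⟩, (mem_nbr.1 hz).2⟩
    have h3 := (Finset.card_le_card h2).trans (Finset.card_union_le _ _)
    have h4 : ((nbr F W x).card : ℝ) ≤ (nbr F B₀ x).card + X.card := by exact_mod_cast h3
    linarith
  have hB₀c : (B₀.card : ℝ) ≤ 2 * d := by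
    have h1 : X.biUnion (nbr F W) ⊆ insert r (X.biUnion (nbr F (W.erase r))) := by
      intro z hz
      rw [Finset.mem_biUnion] at hz
      obtain ⟨x, hx, hz⟩ := hz
      rw [mem_nbr] at hz
      rw [Finset.mem_insert, Finset.mem_biUnion]
      by_cases h : z = r
      · exact Or.inl h
      · exact Or.inr ⟨x, hx, mem_nbr.2 ⟨Finset.mem_erase.2 ⟨h, hz.1⟩, hz.2⟩⟩
    have h2 : B₀.card ≤ Δ * X.card + (d + 1) := by
      have := (Finset.card_le_card h1).trans (Finset.card_insert_le _ _)
      have h3 : B₀.card ≤ (X.biUnion (nbr F W)).card := Finset.card_le_card Finset.sdiff_subset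
      omega
    have h3 : (B₀.card : ℝ) ≤ Δ * X.card + (d + 1) := by exact_mod_cast h2
    have h4 : (Δ : ℝ) * X.card ≤ Δ * (2 * m1) := mul_le_mul_of_nonneg_left hX2r (by linarith)
    linarith
  have hden : δ / 4 * X.card * B₀.card ≤ ec F X B₀ := by
    rw [ec_cast]
    have h1 := Finset.card_nsmul_le_sum X (fun x => ((nbr F B₀ x).card : ℝ)) (δ * d / 2) hdeg
    rw [nsmul_eq_mul] at h1
    refine le_trans ?_ h1
    have hXr : (0 : ℝ) ≤ X.card := by positivity
    have : δ / 4 * B₀.card ≤ δ * d / 2 := by nlinarith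
    nlinarith
  have hB₀m : m1 ≤ B₀.card := by
    obtain ⟨x, hx⟩ := Finset.card_pos.1 hXpos
    have h1 := hdeg x hx
    have h2 := nbr_le F B₀ x
    have h3 : ((nbr F B₀ x).card : ℝ) ≤ B₀.card := by exact_mod_cast h2
    have : (m1 : ℝ) ≤ B₀.card := by linarith
    exact_mod_cast this
  obtain ⟨A, hA, B, hB, hAc, hBc, hAB⟩ := shrink_ge F X B₀ (δ / 4) (s' * q ^ M) (s' * q ^ M)
    (by omega) (by omega) hden
  obtain ⟨A₁, hA₁, B₁, hB₁, k', hk1, hk2, hA₁c, hB₁c, hreg⟩ := exists_regular F (δ / 4)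
    (by linarith) q s' hq2 hs' M A B (δ / 4) le_rfl hM hAc hBc (by rw [hAc, hBc]; exact hAB)
  have hdis : Disjoint A₁ B₁ := by
    have : Disjoint X B₀ := Finset.disjoint_sdiff
    exact Finset.disjoint_of_subset_left (hA₁.trans hA)
      (Finset.disjoint_of_subset_right (hB₁.trans hB) this)
  obtain ⟨P, hP, hPs⟩ := spot_of_regular F (δ / 8) (by linarith) (by linarith) q k' (by omega)
    (by linarith) (fun b => if b then A₁ else B₁)
    (by intro b; cases b
        · simpa using hdis.symm
        · simpa using hdis)
    (by intro b; cases b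
        · simpa using hB₁c
        · simpa using hA₁c)
    (by
      intro b X hX Y hY h1 h2
      have e : δ / 8 = δ / 4 / 2 := by ring
      rw [e]
      cases b
      · simp only [Bool.not_false, if_true] at hY
        simp only [Bool.false_eq_true, if_false] at hX
        have := hreg Y hY X hX h2 h1
        rw [ec_comm]
        linarith
      · simp only [Bool.not_true, Bool.false_eq_true, if_false] at hY
        simp only [if_true] at hX
        exact hreg X hX Y hY h1 h2)
  refine ⟨P, ?_, ?_, ?_⟩
  · have e : δ / 160 = δ / 8 / 20 := by ring
    rw [e]; exact hP
  · rw [hPs]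
    exact hk1.trans (Nat.le_mul_of_pos_left _ (by omega))
  · rw [hPs]
    have : (m1 : ℝ) ≤ d := by linarith
    have : m1 ≤ d := by exact_mod_cast this
    omega

end HS


namespace HS
open scoped Classical

/-- `v` can robustly reach `X` in at most `n` steps through `Rs`. -/
def Reach {V : Type} (G : SimpleGraph V) (N0 : ℕ) (Rs X : Finset V) : ℕ → V → Prop
  | 0, v => v ∈ X
  | (n + 1), v => Reach G N0 Rs X n v ∨
      ∃ L : Finset V, L ⊆ Rs ∧ N0 ≤ L.card ∧ ∀ u ∈ L, G.Adj v u ∧ Reach G N0 Rs X n u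

section reach
variable {V : Type} {G : SimpleGraph V} {N0 : ℕ} {Rs X : Finset V}

theorem Reach.mono_n {n m : ℕ} (h : n ≤ m) {v : V} (hv : Reach G N0 Rs X n v) :
    Reach G N0 Rs X m v := by
  induction m, h using Nat.le_induction with
  | base => exact hv
  | succ m _ ih => exact Or.inl ih

theorem Reach.mono_R {Rs' : Finset V} (h : Rs ⊆ Rs') {n : ℕ} {v : V}
    (hv : Reach G N0 Rs X n v) : Reach G N0 Rs' X n v := by
  induction n generalizing v with
  | zero => exact hv
  | succ n ih =>
    rcases hv with hv | ⟨L, h1, h2, h3⟩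
    · exact Or.inl (ih hv)
    · exact Or.inr ⟨L, h1.trans h, h2, fun u hu => ⟨(h3 u hu).1, ih (h3 u hu).2⟩⟩

theorem Reach.trans {Y : Finset V} {m : ℕ} (h : ∀ u ∈ X, Reach G N0 Rs Y m u) {n : ℕ} {v : V}
    (hv : Reach G N0 Rs X n v) : Reach G N0 Rs Y (n + m) v := by
  induction n generalizing v with
  | zero => rw [Nat.zero_add]; exact h v hv
  | succ n ih =>
    rw [Nat.succ_add]
    rcases hv with hv | ⟨L, h1, h2, h3⟩
    · exact Or.inl (ih hv)
    · exact Or.inr ⟨L, h1, h2, fun u hu => ⟨(h3 u hu).1, ih (h3 u hu).2⟩⟩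

theorem Reach.step {n : ℕ} {v : V} (hv : Reach G N0 Rs X n v) (hX : v ∉ X) :
    1 ≤ n ∧ ∃ L : Finset V, L ⊆ Rs ∧ N0 ≤ L.card ∧
      ∀ u ∈ L, G.Adj v u ∧ Reach G N0 Rs X (n - 1) u := by
  induction n with
  | zero => exact absurd hv hX
  | succ n ih =>
    refine ⟨by omega, ?_⟩
    rcases hv with hv | ⟨L, h1, h2, h3⟩
    · obtain ⟨h0, L, h1, h2, h3⟩ := ih hv
      exact ⟨L, h1, h2, fun u hu => ⟨(h3 u hu).1, (h3 u hu).2.mono_n (by omega)⟩⟩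
    · exact ⟨L, h1, h2, h3⟩

theorem reach_of_nbr {n : ℕ} {v : V} (A : Finset V) (hA : A ⊆ Rs)
    (hAr : ∀ u ∈ A, Reach G N0 Rs X n u) (hc : N0 ≤ (nbr G A v).card) :
    Reach G N0 Rs X (n + 1) v :=
  Or.inr ⟨nbr G A v, (Finset.filter_subset _ _).trans hA, hc, fun u hu =>
    ⟨(mem_nbr.1 hu).2, hAr u (mem_nbr.1 hu).1⟩⟩

end reach

theorem double_count {V : Type} (G : SimpleGraph V) (S Y : Finset V) (N0 : ℕ) :
    ec G S Y ≤ (Y.filter (fun y => N0 ≤ (nbr G S y).card)).card * S.card + Y.card * N0 := by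
  rw [ec_comm]
  unfold ec
  rw [← Finset.sum_filter_add_sum_filter_not Y (fun y => N0 ≤ (nbr G S y).card)]
  apply add_le_add
  · rw [← smul_eq_mul]
    exact Finset.sum_le_card_nsmul _ _ _ (fun x _ => nbr_le G S x)
  · have : ∑ x ∈ Y with ¬N0 ≤ (nbr G S x).card, (nbr G S x).card ≤
        (Y.filter (fun x => ¬N0 ≤ (nbr G S x).card)).card • N0 :=
      Finset.sum_le_card_nsmul _ _ _ (fun x hx => by
        have := (Finset.mem_filter.1 hx).2
        omega)
    refine this.trans ?_
    rw [smul_eq_mul]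
    exact Nat.mul_le_mul_right _ (Finset.card_filter_le _ _)

/-- Numerical hypotheses used for routing. -/
structure RParam (τ η p kd : ℝ) (d N0 M0 M0' : ℕ) (sm : ℝ) : Prop where
  hτ : 0 < τ
  hη : 0 < η
  hp : 0 < p
  hp1 : p ≤ 1
  hητ : 4 * η ≤ τ
  hkd : 0 < kd
  hsm : 0 < sm
  hM0 : 2 * (N0 : ℝ) * d ≤ M0 * kd
  hM0' : (M0' : ℝ) ≤ kd / 2
  hM0τ : 2 * (N0 : ℝ) ≤ τ * M0'
  hN0s : 2 * (N0 : ℝ) < p * (τ * sm)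
  hN0 : 1 ≤ N0
  hd : 1 ≤ d

theorem exit_lemma {V : Type} (G : SimpleGraph V) {τ η p kd sm : ℝ} {d N0 M0 M0' : ℕ}
    (hr : RParam τ η p kd d N0 M0 M0' sm) (P : Spot V)
    (hP : IsSpot G τ η p P) (hs1 : sm ≤ P.s) (hs2 : P.s ≤ d) (b : Bool) (S : Finset V)
    (hS : M0 ≤ S.card) (hSd : ∀ v ∈ S, kd ≤ (nbr G (P.side b) v).card) :
    ∃ A' ⊆ P.side b, A'.card ≤ M0' ∧ ∀ Rs : Finset V, S ⊆ Rs → A' ⊆ Rs →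
      (∀ b, P.R b ⊆ Rs) → ∀ v ∈ P.vs, Reach G N0 Rs S 5 v := by
  have hN0r : (1 : ℝ) ≤ N0 := by exact_mod_cast hr.hN0
  have hdr : (1 : ℝ) ≤ d := by exact_mod_cast hr.hd
  have hkd := hr.hkd
  have hτ := hr.hτ
  have hη := hr.hη
  have hp := hr.hp
  have hsm : 0 < (P.s : ℝ) := lt_of_lt_of_le hr.hsm hs1
  have hM0pos : 0 < (M0 : ℝ) := by
    have h1 := hr.hM0
    by_contra hcon
    have : (M0 : ℝ) = 0 := le_antisymm (not_lt.1 hcon) (by positivity)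
    rw [this] at h1
    nlinarith
  have hM0'pos : 0 < (M0' : ℝ) := by
    have h1 := hr.hM0τ
    by_contra hcon
    have : (M0' : ℝ) = 0 := le_antisymm (not_lt.1 hcon) (by positivity)
    rw [this] at h1
    nlinarith
  have hτs : 2 * (N0 : ℝ) < p * (τ * P.s) := by
    refine lt_of_lt_of_le hr.hN0s ?_
    gcongr
  have hτs1 : 2 * (N0 : ℝ) < τ * P.s := by
    refine lt_of_lt_of_le hτs ?_
    have := hr.hp1
    have : 0 < τ * P.s := by positivity
    nlinarith
  have hηs : η * P.s ≤ τ * P.s / 4 := by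
    have := hr.hητ
    nlinarith
  obtain ⟨S0, hS0, hS0c⟩ := Finset.exists_subset_card_eq hS
  set A1 := (P.side b).filter (fun y => N0 ≤ (nbr G S0 y).card) with hA1
  have hA1c : kd / 2 ≤ A1.card := by
    have h1 : (M0 : ℝ) * kd ≤ ec G S0 (P.side b) := by
      rw [ec_cast]
      have := Finset.card_nsmul_le_sum S0 (fun x => ((nbr G (P.side b) x).card : ℝ)) kd
        (fun x hx => hSd x (hS0 hx))
      rwa [nsmul_eq_mul, hS0c] at this
    have h2 := double_count G S0 (P.side b) N0
    have h3 : (ec G S0 (P.side b) : ℝ) ≤ A1.card * M0 + (P.side b).card * N0 := by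
      rw [← hA1, hS0c] at h2
      exact_mod_cast h2
    have h4 : ((P.side b).card : ℝ) ≤ d := by exact_mod_cast (hP.card_side b).trans hs2
    have h5 : ((P.side b).card : ℝ) * N0 ≤ M0 * kd / 2 := by
      have := hr.hM0
      nlinarith
    have h6 : (M0 : ℝ) * (kd / 2) ≤ M0 * A1.card := by linarith
    exact le_of_mul_le_mul_left h6 hM0pos
  have hA1c' : M0' ≤ A1.card := by
    have : (M0' : ℝ) ≤ A1.card := hr.hM0'.trans hA1c
    exact_mod_cast this
  obtain ⟨A', hA', hA'c⟩ := Finset.exists_subset_card_eq hA1c'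
  have hA's : A' ⊆ P.side b := hA'.trans (Finset.filter_subset _ _)
  refine ⟨A', hA's, hA'c.le, ?_⟩
  intro Rs hSR hA'R hRR
  have r1 : ∀ v ∈ A', Reach G N0 Rs S 1 v := by
    intro v hv
    exact reach_of_nbr (n := 0) (X := S) S0 (hS0.trans hSR) (fun u hu => hS0 hu)
      (Finset.mem_filter.1 (hA' hv)).2
  set B2 := (P.R (!b)).filter (fun y => N0 ≤ (nbr G A' y).card) with hB2
  have hB2c : τ * P.s / 2 ≤ B2.card := by
    have h1 : (M0' : ℝ) * (τ * P.s) ≤ ec G A' (P.R (!b)) := by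
      rw [ec_cast]
      have := Finset.card_nsmul_le_sum A' (fun x => ((nbr G (P.R (!b)) x).card : ℝ)) (τ * P.s)
        (fun x hx => hP.degR b x (hA's hx))
      rwa [nsmul_eq_mul, hA'c] at this
    have h2 := double_count G A' (P.R (!b)) N0
    have h3 : (ec G A' (P.R (!b)) : ℝ) ≤ B2.card * M0' + (P.R (!b)).card * N0 := by
      rw [← hB2, hA'c] at h2
      exact_mod_cast h2
    have h4 : ((P.R (!b)).card : ℝ) ≤ P.s := by
      exact_mod_cast (Finset.card_le_card Finset.subset_union_right).trans (hP.card_side (!b))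
    have h5 : ((P.R (!b)).card : ℝ) * N0 ≤ M0' * (τ * P.s) / 2 := by
      have := hr.hM0τ
      nlinarith
    have h6 : (M0' : ℝ) * (τ * P.s / 2) ≤ M0' * B2.card := by linarith
    exact le_of_mul_le_mul_left h6 hM0'pos
  have hB2R : B2 ⊆ P.R (!b) := Finset.filter_subset _ _
  have r2 : ∀ v ∈ B2, Reach G N0 Rs S 2 v := by
    intro v hv
    exact reach_of_nbr A' hA'R r1 (Finset.mem_filter.1 hv).2
  set Z := (P.R b).filter (fun y => ¬ N0 ≤ (nbr G B2 y).card) with hZ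
  have hZc : (Z.card : ℝ) < η * P.s := by
    by_contra hcon
    push Not at hcon
    have h1 := hP.reg b Z ((Finset.filter_subset _ _).trans Finset.subset_union_right) B2
      (hB2R.trans Finset.subset_union_right) hcon (by linarith)
    have h2 : (ec G Z B2 : ℝ) ≤ Z.card * N0 := by
      rw [ec_cast]
      have := Finset.sum_le_card_nsmul Z (fun x => ((nbr G B2 x).card : ℝ)) N0 (fun x hx => by
        have := (Finset.mem_filter.1 hx).2
        push Not at this
        exact_mod_cast this.le)
      rwa [nsmul_eq_mul] at this
    have hZpos : 0 < (Z.card : ℝ) := by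
      have : 0 < η * P.s := by positivity
      linarith
    have h3 : (Z.card : ℝ) * (p * B2.card) ≤ Z.card * N0 := by linarith
    have h4 := le_of_mul_le_mul_left h3 hZpos
    nlinarith
  have r3 : ∀ v ∈ P.R b \ Z, Reach G N0 Rs S 3 v := by
    intro v hv
    rw [Finset.mem_sdiff] at hv
    apply reach_of_nbr B2 (hB2R.trans (hRR _)) r2
    by_contra hcon
    exact hv.2 (Finset.mem_filter.2 ⟨hv.1, hcon⟩)
  have r4 : ∀ v ∈ P.side (!b), Reach G N0 Rs S 4 v := by
    intro v hv
    apply reach_of_nbr (P.R b \ Z) (Finset.sdiff_subset.trans (hRR _)) r3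
    have h1 := hP.degR (!b) v hv
    rw [Bool.not_not] at h1
    have h2 := nbr_sdiff_card G (P.R b) Z v
    have h3 : ((nbr G (P.R b) v).card : ℝ) ≤ (nbr G (P.R b \ Z) v).card + Z.card := by
      exact_mod_cast h2
    have : (N0 : ℝ) ≤ (nbr G (P.R b \ Z) v).card := by linarith
    exact_mod_cast this
  have r5 : ∀ v ∈ P.side b, Reach G N0 Rs S 5 v := by
    intro v hv
    apply reach_of_nbr (P.R (!b)) (hRR _) (fun u hu => r4 u (Finset.mem_union_right _ hu))
    have h1 := hP.degR b v hv
    have : (N0 : ℝ) ≤ (nbr G (P.R (!b)) v).card := by linarith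
    exact_mod_cast this
  intro v hv
  have : v ∈ P.side b ∨ v ∈ P.side (!b) := by
    unfold Spot.vs at hv
    rw [Finset.mem_union] at hv
    cases b
    · exact hv.symm
    · exact hv
  rcases this with h | h
  · exact r5 v h
  · exact (r4 v h).mono_n (by omega)

/-- The vertices with many neighbours in some side of `P`. -/
noncomputable def Spot.D {V : Type} [Fintype V] (G : SimpleGraph V) (kd : ℝ) (P : Spot V) :
    Finset V :=
  Finset.univ.filter (fun v => ∃ b, kd ≤ (nbr G (P.side b) v).card)

theorem entry_lemma {V : Type} [Fintype V] (G : SimpleGraph V) {τ η p kd sm : ℝ}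
    {d N0 M0 M0' : ℕ}
    (hr : RParam τ η p kd d N0 M0 M0' sm) (hkN : (N0 : ℝ) ≤ kd) (P : Spot V) (v : V)
    (hv : v ∈ P.D G kd) :
    ∃ E ⊆ P.vs, E.card ≤ N0 ∧ ∀ Rs : Finset V, E ⊆ Rs → Reach G N0 Rs P.vs 1 v := by
  have _ := hr
  obtain ⟨b, hb⟩ := (Finset.mem_filter.1 hv).2
  have h1 : N0 ≤ (nbr G (P.side b) v).card := by exact_mod_cast hkN.trans hb
  obtain ⟨E, hE, hEc⟩ := Finset.exists_subset_card_eq h1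
  have hEs : E ⊆ P.vs := by
    intro x hx
    have := (mem_nbr.1 (hE hx)).1
    unfold Spot.vs
    rw [Finset.mem_union]
    cases b
    · exact Or.inr this
    · exact Or.inl this
  refine ⟨E, hEs, hEc.le, fun Rs hR => ?_⟩
  exact Or.inr ⟨E, hR, hEc.ge, fun u hu => ⟨(mem_nbr.1 (hE hu)).2, hEs hu⟩⟩

/-- Families of spots that are connected through links. -/
inductive Grown {V : Type} [Fintype V] (G : SimpleGraph V) (kd : ℝ) (N2 : ℕ) :
    Finset (Spot V) → Prop
  | single (P : Spot V) : Grown G kd N2 {P}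
  | grow (J : Finset (Spot V)) (P Q : Spot V) : Grown G kd N2 J → P ∈ J → Q ∉ J →
      N2 ≤ (P.D G kd ∩ Q.D G kd).card → Grown G kd N2 (insert Q J)

theorem vs_side {V : Type} (P : Spot V) (b : Bool) : P.side b ⊆ P.vs := by
  unfold Spot.vs
  cases b
  · exact Finset.subset_union_right
  · exact Finset.subset_union_left

theorem entry_set {V : Type} [Fintype V] (G : SimpleGraph V) {τ η p kd sm : ℝ}
    {d N0 M0 M0' : ℕ}
    (hr : RParam τ η p kd d N0 M0 M0' sm) (hkN : (N0 : ℝ) ≤ kd) (P : Spot V) (S : Finset V)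
    (hS : S ⊆ P.D G kd) :
    ∃ E ⊆ P.vs, E.card ≤ S.card * N0 ∧ ∀ Rs : Finset V, E ⊆ Rs → ∀ v ∈ S,
      Reach G N0 Rs P.vs 1 v := by
  have : ∀ v, ∃ E ⊆ P.vs, E.card ≤ N0 ∧
      (v ∈ S → ∀ Rs : Finset V, E ⊆ Rs → Reach G N0 Rs P.vs 1 v) := by
    intro v
    by_cases hv : v ∈ S
    · obtain ⟨E, h1, h2, h3⟩ := entry_lemma G hr hkN P v (hS hv)
      exact ⟨E, h1, h2, fun _ => h3⟩
    · exact ⟨∅, by simp, by simp, fun h => absurd h hv⟩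
  choose E h1 h2 h3 using this
  refine ⟨S.biUnion E, Finset.biUnion_subset.2 (fun v _ => h1 v),
    Finset.card_biUnion_le_card_mul _ _ _ (fun v _ => h2 v), ?_⟩
  intro Rs hR v hv
  exact h3 v hv Rs ((Finset.subset_biUnion_of_mem E hv).trans hR)

/-- Pigeonhole on the sides. -/
theorem pigeon_side {V : Type} [Fintype V] (G : SimpleGraph V) (kd : ℝ) (P : Spot V)
    (S : Finset V) (hS : S ⊆ P.D G kd) (m : ℕ) (hm : 2 * m ≤ S.card) :
    ∃ b, ∃ S' ⊆ S, m ≤ S'.card ∧ ∀ v ∈ S', kd ≤ (nbr G (P.side b) v).card := by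
  by_contra hcon
  push Not at hcon
  have h : ∀ b, (S.filter (fun v => kd ≤ (nbr G (P.side b) v).card)).card < m := by
    intro b
    by_contra h
    push Not at h
    obtain ⟨v, hv, hv'⟩ := hcon b _ (Finset.filter_subset _ _) h
    exact absurd (Finset.mem_filter.1 hv).2 (not_le.2 hv')
  have hsub : S ⊆ (S.filter (fun v => kd ≤ (nbr G (P.side true) v).card)) ∪
      (S.filter (fun v => kd ≤ (nbr G (P.side false) v).card)) := by
    intro v hv
    obtain ⟨b, hb⟩ := (Finset.mem_filter.1 (hS hv)).2
    rw [Finset.mem_union, Finset.mem_filter, Finset.mem_filter]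
    cases b
    · exact Or.inr ⟨hv, hb⟩
    · exact Or.inl ⟨hv, hb⟩
  have := (Finset.card_le_card hsub).trans (Finset.card_union_le _ _)
  have := h true
  have := h false
  omega

theorem grown_route {V : Type} [Fintype V] (G : SimpleGraph V) {τ η p kd sm : ℝ}
    {d N0 M0 M0' : ℕ}
    (hr : RParam τ η p kd d N0 M0 M0' sm) (hkN : (N0 : ℝ) ≤ kd) (J : Finset (Spot V))
    (hJ : Grown G kd (4 * M0) J)
    (hsp : ∀ P ∈ J, IsSpot G τ η p P ∧ sm ≤ P.s ∧ P.s ≤ d) :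
    ∃ Ψ : Finset V, Ψ.card ≤ J.card * (M0 + 2 * M0' + 2 * (M0 * N0)) ∧
      ∀ Rs : Finset V, Ψ ⊆ Rs → (∀ P ∈ J, ∀ b, P.R b ⊆ Rs) →
        ∀ g ∈ J, ∀ v ∈ Ψ ∪ J.biUnion Spot.vs, Reach G N0 Rs g.vs (7 * J.card) v := by
  induction hJ with
  | single P =>
    refine ⟨∅, by simp, ?_⟩
    intro Rs _ _ g hg v hv
    rw [Finset.mem_singleton] at hg
    subst hg
    simp only [Finset.singleton_biUnion, Finset.empty_union] at hv
    exact Reach.mono_n (Nat.zero_le _) hv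
  | grow J P Q hJ hPJ hQJ hlink ih =>
    obtain ⟨Ψ, hΨc, hΨ⟩ := ih (fun P' hP' => hsp P' (Finset.mem_insert_of_mem hP'))
    obtain ⟨b, S1, hS1, hS1c, hS1d⟩ := pigeon_side G kd P _ Finset.inter_subset_left (2 * M0)
      (by omega : 2 * (2 * M0) ≤ (P.D G kd ∩ Q.D G kd).card)
    obtain ⟨b', S2, hS2, hS2c, hS2d⟩ := pigeon_side G kd Q S1
      (hS1.trans Finset.inter_subset_right) M0 hS1c
    obtain ⟨S, hS, hSc⟩ := Finset.exists_subset_card_eq hS2c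
    have hSP : ∀ v ∈ S, kd ≤ (nbr G (P.side b) v).card := fun v hv => hS1d v (hS2 (hS hv))
    have hSQ : ∀ v ∈ S, kd ≤ (nbr G (Q.side b') v).card := fun v hv => hS2d v (hS hv)
    have hSin : S ⊆ P.D G kd ∩ Q.D G kd := hS.trans (hS2.trans hS1)
    obtain ⟨hP1, hP2, hP3⟩ := hsp P (Finset.mem_insert_of_mem hPJ)
    obtain ⟨hQ1, hQ2, hQ3⟩ := hsp Q (Finset.mem_insert_self _ _)
    obtain ⟨A, hA, hAc, hAr⟩ := exit_lemma G hr P hP1 hP2 hP3 b S hSc.ge hSP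
    obtain ⟨A₂, hA₂, hA₂c, hA₂r⟩ := exit_lemma G hr Q hQ1 hQ2 hQ3 b' S hSc.ge hSQ
    obtain ⟨E, hE, hEc, hEr⟩ := entry_set G hr hkN P S (hSin.trans Finset.inter_subset_left)
    obtain ⟨E₂, hE₂, hE₂c, hE₂r⟩ := entry_set G hr hkN Q S (hSin.trans Finset.inter_subset_right)
    rw [hSc] at hEc hE₂c
    refine ⟨Ψ ∪ (S ∪ (A ∪ (A₂ ∪ (E ∪ E₂)))), ?_, ?_⟩
    · rw [Finset.card_insert_of_notMem hQJ]
      have u1 := Finset.card_union_le Ψ (S ∪ (A ∪ (A₂ ∪ (E ∪ E₂))))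
      have u2 := Finset.card_union_le S (A ∪ (A₂ ∪ (E ∪ E₂)))
      have u3 := Finset.card_union_le A (A₂ ∪ (E ∪ E₂))
      have u4 := Finset.card_union_le A₂ (E ∪ E₂)
      have u5 := Finset.card_union_le E E₂
      rw [Nat.add_mul, one_mul]
      omega
    · intro Rs hRs hRR g hg v hv
      simp only [Finset.union_subset_iff] at hRs
      obtain ⟨k1, k2, k3, k4, k5, k6⟩ := hRs
      have hold := hΨ Rs k1 (fun P' hP' => hRR P' (Finset.mem_insert_of_mem hP'))
      have t1 := hAr Rs k2 k3 (hRR P (Finset.mem_insert_of_mem hPJ))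
      have t2 := hA₂r Rs k2 k4 (hRR Q (Finset.mem_insert_self _ _))
      have t3 := hEr Rs k5
      have t4 := hE₂r Rs k6
      have PQ : ∀ v ∈ P.vs, Reach G N0 Rs Q.vs 6 v := fun v hv => (t1 v hv).trans t4
      have QP : ∀ v ∈ Q.vs, Reach G N0 Rs P.vs 6 v := fun v hv => (t2 v hv).trans t3
      have Pg : ∀ g ∈ J, ∀ v ∈ P.vs, Reach G N0 Rs g.vs (7 * J.card) v := fun g hg v hv =>
        hold g hg v (Finset.mem_union_right _ (Finset.mem_biUnion.2 ⟨P, hPJ, hv⟩))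
      have hcases : v ∈ Ψ ∪ J.biUnion Spot.vs ∨ v ∈ S ∨ v ∈ Q.vs := by
        rw [Finset.mem_union] at hv
        rcases hv with hv | hv
        · simp only [Finset.mem_union] at hv
          rcases hv with hv | hv | hv | hv | hv | hv
          · exact Or.inl (Finset.mem_union_left _ hv)
          · exact Or.inr (Or.inl hv)
          · exact Or.inl (Finset.mem_union_right _
              (Finset.mem_biUnion.2 ⟨P, hPJ, vs_side P b (hA hv)⟩))
          · exact Or.inr (Or.inr (vs_side Q b' (hA₂ hv)))
          · exact Or.inl (Finset.mem_union_right _ (Finset.mem_biUnion.2 ⟨P, hPJ, hE hv⟩))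
          · exact Or.inr (Or.inr (hE₂ hv))
        · rw [Finset.biUnion_insert, Finset.mem_union] at hv
          rcases hv with hv | hv
          · exact Or.inr (Or.inr hv)
          · exact Or.inl (Finset.mem_union_right _ hv)
      rw [Finset.card_insert_of_notMem hQJ]
      rw [Finset.mem_insert] at hg
      rcases hg with rfl | hg
      · rcases hcases with hv | hv | hv
        · exact ((hold P hPJ v hv).trans PQ).mono_n (by omega)
        · exact (t4 v hv).mono_n (by omega)
        · exact Reach.mono_n (Nat.zero_le _) (show Reach G N0 Rs _ 0 v from hv)
      · rcases hcases with hv | hv | hv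
        · exact (hold g hg v hv).mono_n (by omega)
        · exact ((t3 v hv).trans (Pg g hg)).mono_n (by omega)
        · exact ((QP v hv).trans (Pg g hg)).mono_n (by omega)

end HS


namespace HS
open scoped Classical

theorem bin_pack {ι : Type} (J : Finset ι) (hJ : J.Nonempty) (c : ι → ℕ) (w : ℕ → ℕ) (B : ℕ)
    (hw : ∀ t, w t ≤ B) (T : Finset ℕ) (h : ∑ t ∈ T, w t + J.card * B ≤ ∑ g ∈ J, c g) :
    ∃ asg : ℕ → ι, (∀ t, asg t ∈ J) ∧
      ∀ g ∈ J, ∑ t ∈ T.filter (fun t => asg t = g), w t ≤ c g := by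
  induction T using Finset.induction_on with
  | empty =>
    obtain ⟨g, hg⟩ := hJ
    exact ⟨fun _ => g, fun _ => hg, by simp⟩
  | insert a T ha ih =>
    rw [Finset.sum_insert ha] at h
    obtain ⟨asg, h1, h2⟩ := ih (by omega)
    have : ∃ g ∈ J, ∑ t ∈ T.filter (fun t => asg t = g), w t + w a ≤ c g := by
      by_contra hcon
      push Not at hcon
      have h3 : ∑ g ∈ J, c g < ∑ g ∈ J, (∑ t ∈ T.filter (fun t => asg t = g), w t + B) := by
        apply Finset.sum_lt_sum_of_nonempty hJ
        intro g hg
        have := hcon g hg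
        have := hw a
        omega
      rw [Finset.sum_add_distrib, Finset.sum_fiberwise_of_maps_to (fun t _ => h1 t)] at h3
      simp at h3
      omega
    obtain ⟨g, hg, hgc⟩ := this
    refine ⟨Function.update asg a g, ?_, ?_⟩
    · intro t
      by_cases hta : t = a
      · subst hta; simpa using hg
      · simpa [hta] using h1 t
    · intro g' hg'
      have hT : T.filter (fun t => Function.update asg a g t = g') =
          T.filter (fun t => asg t = g') := by
        apply Finset.filter_congr
        intro t ht
        have : t ≠ a := fun h => ha (h ▸ ht)
        simp [this]
      rw [Finset.filter_insert, hT]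
      by_cases hgg : g = g'
      · subst hgg
        simp only [Function.update_self, if_true]
        rw [Finset.sum_insert (by simp [ha])]
        omega
      · simp only [Function.update_self, hgg, if_false]
        exact h2 g' hg'

theorem root_exists {V : Type} (G : SimpleGraph V) {τ η p : ℝ} (hτ : 0 < τ) (P : Spot V)
    (hP : IsSpot G τ η p P) (hs : 0 < (P.s : ℝ)) : ∃ v, v ∈ P.R true := by
  have h1 : 0 < ((P.M false).card : ℝ) := lt_of_lt_of_le (by linarith) (hP.card_M false)
  have h2 : 0 < (P.M false).card := by exact_mod_cast h1
  obtain ⟨v, hv⟩ := Finset.card_pos.1 h2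
  have h3 := hP.degR false v (Finset.mem_union_left _ hv)
  have h4 : 0 < ((nbr G (P.R (!false)) v).card : ℝ) := lt_of_lt_of_le (by positivity) h3
  have h5 : 0 < (nbr G (P.R (!false)) v).card := by exact_mod_cast h4
  obtain ⟨z, hz⟩ := Finset.card_pos.1 h5
  exact ⟨z, (mem_nbr.1 hz).1⟩

theorem mem_vs_iff {V : Type} (P : Spot V) (v : V) : v ∈ P.vs ↔ ∃ b, v ∈ P.side b := by
  simp [Spot.vs, or_comm]

theorem R_vs {V : Type} (P : Spot V) (b : Bool) : P.R b ⊆ P.vs :=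
  Finset.subset_union_right.trans (vs_side P b)

theorem M_vs {V : Type} (P : Spot V) (b : Bool) : P.M b ⊆ P.vs :=
  Finset.subset_union_left.trans (vs_side P b)

theorem M_disj_R {V : Type} {G : SimpleGraph V} {τ η p : ℝ} {P : Spot V} (hP : IsSpot G τ η p P)
    (b b' : Bool) : Disjoint (P.M b) (P.R b') := by
  by_cases h : b = b'
  · subst h; exact hP.dMR b
  · have : b' = !b := by cases b <;> cases b' <;> simp_all
    subst this
    exact (hP.dside b).mono Finset.subset_union_left Finset.subset_union_right

set_option maxHeartbeats 1000000 in
theorem e3 {V : Type} [Fintype V] (G : SimpleGraph V) {τ η p0 kd sm : ℝ} {d N0 M0 M0' : ℕ}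
    (hr : RParam τ η p0 kd d N0 M0 M0' sm) (hkN : (N0 : ℝ) ≤ kd)
    (hτ1 : τ ≤ 1 / 20) (Δ : ℕ) (hΔ1 : 1 ≤ Δ) (hητ : 8 * Δ * η ≤ τ) (hsm : 4 * (Δ : ℝ) ≤ τ * sm)
    (N : ℕ) (p : ℕ → ℕ) (hp : ∀ k, 0 < k → p k < k)
    (hΔ : ∀ j, ((Finset.range N).filter (fun k => 0 < k ∧ p k = j)).card ≤ Δ)
    (Bd C : ℕ) (cu : Cut N p Δ Bd C)
    (J : Finset (Spot V)) (hJ : Grown G kd (4 * M0) J)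
    (hsp : ∀ P ∈ J, IsSpot G τ η p0 P ∧ sm ≤ P.s ∧ P.s ≤ d)
    (μ : ℝ) (hμ : ∀ P ∈ J, ∀ Q ∈ J, P ≠ Q → ((P.vs ∩ Q.vs).card : ℝ) ≤ μ) (hμ0 : 0 ≤ μ)
    (hrem : J.card * μ + ((J.card * (M0 + 2 * M0' + 2 * (M0 * N0)) : ℕ) : ℝ) ≤ τ * sm / 2)
    (hlight : C * (7 * J.card + 1) * Δ ^ (7 * J.card) < N0)
    (hcap : N + J.card * Bd ≤ ∑ P ∈ J, 3 * P.s / 4) : Emb N p G := by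
  obtain ⟨Ψ, hΨc, hΨ⟩ := grown_route G hr hkN J hJ hsp
  have hJne : J.Nonempty := by
    cases hJ with
    | single P => exact ⟨P, by simp⟩
    | grow J P Q => exact ⟨Q, by simp⟩
  set ℓ := 7 * J.card with hℓ
  have hpos : ∀ P ∈ J, 0 < (P.s : ℝ) := fun P hP => lt_of_lt_of_le hr.hsm (hsp P hP).2.1
  -- assignment
  obtain ⟨asg, hasg, hload⟩ := bin_pack J hJne (fun P => 3 * P.s / 4)
    (fun i => ((Finset.range N).filter (fun x => cu.pid x = i)).card) Bd cu.piece_le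
    ((Finset.range N).image cu.pid) (by
      rw [← Finset.card_eq_sum_card_fiberwise (fun x hx => Finset.mem_coe.2 (Finset.mem_image_of_mem _ hx))]
      simpa using hcap)
  have hload' : ∀ g ∈ J, ((Finset.range N).filter (fun j => asg (cu.pid j) = g)).card ≤ 3 * g.s / 4 := by
    intro g hg
    refine le_trans (le_of_eq ?_) (hload g hg)
    rw [Finset.card_eq_sum_card_fiberwise (f := cu.pid)
      (t := ((Finset.range N).image cu.pid).filter (fun t => asg t = g))]
    · apply Finset.sum_congr rfl
      intro i hi
      congr 1
      ext x
      simp only [Finset.mem_filter] at hi ⊢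
      constructor
      · exact fun h => ⟨h.1.1, h.2⟩
      · exact fun h => ⟨⟨h.1, by rw [h.2]; exact hi.2⟩, h.2⟩
    · intro x hx
      simp only [Finset.coe_filter, Set.mem_ofPred_eq, Finset.mem_image] at hx ⊢
      exact ⟨⟨x, hx.1, rfl⟩, hx.2⟩
  set Rs : Finset V := Ψ ∪ J.biUnion (fun P => P.R true ∪ P.R false) with hRs
  set dom : Finset V := Ψ ∪ J.biUnion Spot.vs with hdom
  have hRR : ∀ P ∈ J, ∀ b, P.R b ⊆ Rs := by
    intro P hP b z hz
    apply Finset.mem_union_right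
    refine Finset.mem_biUnion.2 ⟨P, hP, ?_⟩
    cases b <;> simp [hz]
  have hreach := hΨ Rs Finset.subset_union_left hRR
  have hRd : Rs ⊆ dom := by
    apply Finset.union_subset_union_right
    intro z hz
    obtain ⟨P, hP, hz⟩ := Finset.mem_biUnion.1 hz
    refine Finset.mem_biUnion.2 ⟨P, hP, ?_⟩
    rcases Finset.mem_union.1 hz with hz | hz
    · exact R_vs P _ hz
    · exact R_vs P _ hz
  have hvd : ∀ P ∈ J, P.vs ⊆ dom := fun P hP =>
    (Finset.subset_biUnion_of_mem Spot.vs hP).trans Finset.subset_union_right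
  let tgt : (↥J × Bool) → Finset V := fun i =>
    i.1.1.M i.2 \ (Rs ∪ (J.erase i.1.1).biUnion Spot.vs)
  let cap : (↥J × Bool) → ℕ := fun i =>
    ((Finset.range N).filter (fun j => asg (cu.pid j) = i.1.1)).card
  have htM : ∀ i, tgt i ⊆ i.1.1.M i.2 := fun i => Finset.sdiff_subset
  have htR : ∀ i, Disjoint (tgt i) Rs := by
    intro i
    rw [Finset.disjoint_left]
    intro z hz hz'
    exact (Finset.mem_sdiff.1 hz).2 (Finset.mem_union_left _ hz')
  have htv : ∀ i, ∀ P ∈ J, ∀ z ∈ tgt i, z ∈ P.vs → P = i.1.1 := by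
    intro i P hP z hz hzP
    by_contra hne
    exact (Finset.mem_sdiff.1 hz).2 (Finset.mem_union_right _
      (Finset.mem_biUnion.2 ⟨P, Finset.mem_erase.2 ⟨hne, hP⟩, hzP⟩))
  have hremov : ∀ i : ↥J × Bool, ((i.1.1.M i.2 \ tgt i).card : ℝ) ≤ τ * i.1.1.s / 2 := by
    rintro ⟨⟨P, hP⟩, b⟩
    have h1 : P.M b \ tgt ⟨⟨P, hP⟩, b⟩ ⊆ Ψ ∪ (J.erase P).biUnion (fun Q => P.vs ∩ Q.vs) := by
      intro z hz
      obtain ⟨hz1, hz2⟩ := Finset.mem_sdiff.1 hz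
      have hz3 : z ∈ Rs ∪ (J.erase P).biUnion Spot.vs := by
        by_contra h
        exact hz2 (Finset.mem_sdiff.2 ⟨hz1, h⟩)
      have key : ∀ Q ∈ J.erase P, z ∈ Q.vs →
          z ∈ Ψ ∪ (J.erase P).biUnion (fun Q => P.vs ∩ Q.vs) := fun Q hQ hzQ =>
        Finset.mem_union_right _ (Finset.mem_biUnion.2
          ⟨Q, hQ, Finset.mem_inter.2 ⟨M_vs P b hz1, hzQ⟩⟩)
      rcases Finset.mem_union.1 hz3 with h | h
      · rcases Finset.mem_union.1 h with h | h
        · exact Finset.mem_union_left _ h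
        · obtain ⟨Q, hQ, hzQ⟩ := Finset.mem_biUnion.1 h
          have hzQ' : ∃ b', z ∈ Q.R b' := by
            rcases Finset.mem_union.1 hzQ with h | h
            · exact ⟨_, h⟩
            · exact ⟨_, h⟩
          obtain ⟨b', hb'⟩ := hzQ'
          by_cases hQP : Q = P
          · subst hQP
            exact absurd hb' (Finset.disjoint_left.1 (M_disj_R (hsp Q hQ).1 b b') hz1)
          · exact key Q (Finset.mem_erase.2 ⟨hQP, hQ⟩) (R_vs Q _ hb')
      · obtain ⟨Q, hQ, hzQ⟩ := Finset.mem_biUnion.1 h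
        exact key Q hQ hzQ
    have h2 : ((P.M b \ tgt ⟨⟨P, hP⟩, b⟩).card : ℝ) ≤
        (Ψ.card : ℝ) + ∑ Q ∈ J.erase P, ((P.vs ∩ Q.vs).card : ℝ) := by
      have := (Finset.card_le_card h1).trans ((Finset.card_union_le _ _).trans
        (Nat.add_le_add_left Finset.card_biUnion_le _))
      exact_mod_cast this
    have h3 : ∑ Q ∈ J.erase P, ((P.vs ∩ Q.vs).card : ℝ) ≤ J.card * μ := by
      calc ∑ Q ∈ J.erase P, ((P.vs ∩ Q.vs).card : ℝ) ≤ ∑ Q ∈ J.erase P, μ := by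
            apply Finset.sum_le_sum
            intro Q hQ
            obtain ⟨h1, h2⟩ := Finset.mem_erase.1 hQ
            exact hμ P hP Q h2 (Ne.symm h1)
        _ = (J.erase P).card * μ := by simp
        _ ≤ J.card * μ := by
            apply mul_le_mul_of_nonneg_right _ hμ0
            exact_mod_cast Finset.card_le_card (Finset.erase_subset _ _)
    have h4 : (Ψ.card : ℝ) ≤ ((J.card * (M0 + 2 * M0' + 2 * (M0 * N0)) : ℕ) : ℝ) := by
      exact_mod_cast hΨc
    have h5 : τ * sm ≤ τ * P.s := mul_le_mul_of_nonneg_left (hsp P hP).2.1 hr.hτ.le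
    show _ ≤ τ * P.s / 2
    linarith
  have hexp : ∀ i : ↥J × Bool, _ := fun i => main_exp G τ η p0 i.1.1 (hsp _ i.1.2).1 Δ hr.hp hr.hη
    hr.hτ hτ1 hητ hΔ1 (hsm.trans (mul_le_mul_of_nonneg_left (hsp _ i.1.2).2.1 hr.hτ.le)) i.2 (tgt i)
    (htM i) (hremov i) (cap i) (by
      have h1 : cap i ≤ 3 * i.1.1.s / 4 := hload' _ i.1.2
      have h2 : 4 * cap i ≤ 3 * i.1.1.s := by omega
      have h3 : (4 : ℝ) * cap i ≤ 3 * i.1.1.s := by exact_mod_cast h2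
      linarith)
  obtain ⟨g0, hg0⟩ := hJne
  obtain ⟨r, hr0⟩ := root_exists G hr.hτ g0 (hsp g0 hg0).1 (hpos g0 hg0)
  have hrR : r ∈ Rs := hRR g0 hg0 true hr0
  let Move : ℕ → V → V → Prop := fun k _ z => z ∈ dom ∧
    Reach G N0 Rs (asg (cu.pid k)).vs (ℓ - cu.dp k) z ∧ (z ∈ Rs → cu.dp k ≤ ℓ) ∧
    ∀ i : ↥J × Bool, z ∈ tgt i → asg (cu.pid k) = i.1.1
  apply engine G N p (fun k h _ => hp k h) Δ hΔ tgt (fun i => i.1.1.side (!i.2))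
    (fun i => ⌈η * i.1.1.s⌉₊) cap Rs ?_ htR ?_ (fun i => (hexp i).1) (fun i => (hexp i).2) id Move r hrR
  · intro k hk hkN st hv
    set v := st (p k) with hvdef
    have hdp0 : cu.dp 0 = 0 := cu.dp_cut 0 cu.cut0
    have hinv : v ∈ dom ∧ Reach G N0 Rs (asg (cu.pid (p k))).vs (ℓ - cu.dp (p k)) v := by
      by_cases h0 : p k = 0
      · have : v = r := by rw [hvdef, h0]; exact hv.root
        rw [this, h0, hdp0]
        exact ⟨hRd hrR, hreach _ (hasg _) r (hRd hrR)⟩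
      · have := hv.move (p k) (by omega) (hp k hk)
        exact ⟨this.1, this.2.1⟩
    have hlt : ((Finset.range k).filter (fun j => id (st j) ∈ Rs)).card < N0 := by
      refine lt_of_le_of_lt ?_ hlight
      refine le_trans ?_ (cu.light ℓ)
      apply Finset.card_le_card
      intro j hj
      simp only [Finset.mem_filter, Finset.mem_range, id] at hj ⊢
      refine ⟨by omega, ?_⟩
      by_cases h0 : j = 0
      · subst h0; omega
      · exact (hv.move j (by omega) hj.1).2.2.1 hj.2
    have hinvk : (Reach G N0 Rs (asg (cu.pid k)).vs (ℓ - cu.dp k + 1) v) ∧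
        (v ∉ (asg (cu.pid k)).vs → cu.dp k ≤ ℓ ∧ ∃ L : Finset V, L ⊆ Rs ∧ N0 ≤ L.card ∧
      ∀ u ∈ L, G.Adj v u ∧ Reach G N0 Rs (asg (cu.pid k)).vs (ℓ - cu.dp k) u) := by
      by_cases hc : cu.cut k
      · have h1 := hreach _ (hasg (cu.pid k)) v hinv.1
        rw [cu.dp_cut k hc]
        refine ⟨h1.mono_n (by omega), fun hnv => ⟨by omega, ?_⟩⟩
        obtain ⟨_, L, h3, h4, h5⟩ := h1.step hnv
        exact ⟨L, h3, h4, fun u hu => ⟨(h5 u hu).1, (h5 u hu).2.mono_n (by omega)⟩⟩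
      · have h1 := hinv.2
        rw [← cu.pid_not k hc] at h1
        have h2 := cu.dp_not k hc
        refine ⟨h1.mono_n (by omega), fun hnv => ?_⟩
        obtain ⟨h0, L, h3, h4, h5⟩ := h1.step hnv
        refine ⟨by omega, L, h3, h4, fun u hu => ⟨(h5 u hu).1, (h5 u hu).2.mono_n (by omega)⟩⟩
    by_cases hvv : v ∈ (asg (cu.pid k)).vs
    · right
      obtain ⟨b, hb⟩ := (mem_vs_iff _ _).1 hvv
      refine ⟨⟨⟨_, hasg (cu.pid k)⟩, !b⟩, by simpa using hb, ?_, ?_⟩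
      · intro z hz _
        have hzv : z ∈ (asg (cu.pid k)).vs := M_vs _ _ (htM _ hz)
        refine ⟨z, rfl, hvd _ (hasg _) hzv, ?_, ?_, ?_⟩
        · exact Reach.mono_n (n := 0) (by omega) hzv
        · exact fun h => absurd h (Finset.disjoint_left.1 (htR _) hz)
        · intro i hi
          exact htv i _ (hasg _) z hi hzv
      · apply Finset.card_lt_card
        refine ⟨?_, ?_⟩
        · intro j hj
          simp only [Finset.mem_filter, Finset.mem_range, id] at hj ⊢
          refine ⟨by omega, ?_⟩
          by_cases h0 : j = 0
          · subst h0
            rw [hv.root] at hj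
            exact absurd hrR (Finset.disjoint_left.1 (htR _) hj.2)
          · exact (hv.move j (by omega) hj.1).2.2.2 _ hj.2
        · intro hsub
          have : k ∈ (Finset.range k).filter (fun j => id (st j) ∈ tgt ⟨⟨_, hasg (cu.pid k)⟩, !b⟩) := by
            apply hsub
            simp [hkN]
          simp at this
    · left
      obtain ⟨hd1, L, h1, h2, h3⟩ := hinvk.2 hvv
      refine ⟨L, fun z hz => ⟨h1 hz, (h3 z hz).1, z, rfl, hRd (h1 hz), (h3 z hz).2, fun _ => hd1, ?_⟩,
        lt_of_lt_of_le hlt h2⟩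
      intro i hi
      exact absurd (h1 hz) (Finset.disjoint_left.1 (htR i) hi)
  · rintro ⟨⟨P, hP⟩, b⟩ ⟨⟨Q, hQ⟩, b'⟩ hne
    by_cases hPQ : P = Q
    · subst hPQ
      have hb : b' = !b := by
        have hbb : b ≠ b' := fun h => hne (by rw [h])
        cases b <;> cases b' <;> first | rfl | exact absurd rfl hbb
      subst hb
      exact ((hsp P hP).1.dside b).mono ((htM _).trans Finset.subset_union_left)
        ((htM _).trans Finset.subset_union_left)
    · rw [Finset.disjoint_left]
      intro z hz hz'
      exact hPQ (htv ⟨⟨Q, hQ⟩, b'⟩ P hP z hz' (M_vs _ _ (htM _ hz)))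
  · intro i
    have := hpos _ i.1.2
    have := hr.hη
    exact Nat.one_le_iff_ne_zero.2 (Nat.ceil_pos.2 (by positivity)).ne'

end HS


namespace HS
open scoped Classical

/-- Number of heap labels up to a given level. -/
def heapB (M1 : ℕ) : ℕ → ℕ
  | 0 => 1
  | (e + 1) => M1 * heapB M1 e + 1

theorem heapB_mono (M1 : ℕ) (hM1 : 1 ≤ M1) : Monotone (heapB M1) := by
  apply monotone_nat_of_le_succ
  intro e
  show heapB M1 e ≤ M1 * heapB M1 e + 1
  nlinarith

section run
variable {V : Type} (G : SimpleGraph V) (N0 ℓ M1 : ℕ) (S : ℕ → Finset V) (h : ℕ → Spot V)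
  (g : ℕ → V) (Rs : Finset V)

/-- Invariant for the states of the run; the Boolean is true in the staying mode. -/
def SInv {N : ℕ} {p : ℕ → ℕ} {Δ Bd C : ℕ} (cu : Cut N p Δ Bd C) (k : ℕ) (s : ℕ × Bool × V) : Prop :=
  (s.2.1 = true → s.1 < heapB M1 (cu.ec k) ∧ s.2.2 ∉ S s.1 ∧
    (s.2.2 ∈ (h s.1).vs ∨ (s.2.2 = g s.1 ∧ cu.dp k ≤ ℓ ∧ s.2.2 ∈ Rs)) ∧ (s.2.2 ∈ Rs → cu.dp k ≤ ℓ + 1)) ∧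
  (s.2.1 = false → (∃ e, cu.ec k = e + 1 ∧ s.1 < heapB M1 e) ∧ s.2.2 ∉ S s.1 ∧ s.2.2 ∈ Rs ∧
    cu.dp k ≤ ℓ ∧ Reach G N0 Rs (S s.1) (ℓ - cu.dp k) s.2.2)

end run

set_option maxHeartbeats 1000000 in
theorem e2_run {V : Type} (G : SimpleGraph V) {τ η p0 sm : ℝ}
    (hτ : 0 < τ) (hη : 0 < η) (hp0 : 0 < p0) (hsm0 : 0 < sm)
    (hτ1 : τ ≤ 1 / 20) (Δ : ℕ) (hΔ1 : 1 ≤ Δ) (hητ : 8 * Δ * η ≤ τ) (hsm : 4 * (Δ : ℝ) ≤ τ * sm)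
    (N : ℕ) (p : ℕ → ℕ) (hp : ∀ k, 0 < k → p k < k)
    (hΔ : ∀ j, ((Finset.range N).filter (fun k => 0 < k ∧ p k = j)).card ≤ Δ)
    (Bd C : ℕ) (cu : Cut N p Δ Bd C) (N0 ℓ M1 n : ℕ) (hM1 : 1 ≤ M1) (hn : n = heapB M1 C)
    (S : ℕ → Finset V) (h : ℕ → Spot V) (g : ℕ → V) (E : ℕ → Finset V) (Rs : Finset V)
    (hsp : ∀ t < n, IsSpot G τ η p0 (h t) ∧ sm ≤ (h t).s)
    (hrem : ∀ t < n, ∀ b, (((h t).M b \ ((h t).M b \ (Rs ∪ ((Finset.range n).erase t).biUnion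
      (fun t' => (h t').vs)))).card : ℝ) ≤ τ * sm / 2)
    (hS : ∀ t < n, ∀ z ∈ S t, ∃ t', z = g t' ∧ t' ≤ M1 * t + M1)
    (hSR : ∀ t < n, S t ⊆ Rs)
    (hreach : ∀ t < n, ∀ v, (v ∈ (h t).vs ∨ v = g t) → Reach G N0 Rs (S t) ℓ v)
    (hE : ∀ t < n, E t ⊆ Rs ∧ E t ⊆ (h t).vs ∧ Disjoint (E t) (S t) ∧
      (g t ∉ (h t).vs → N0 ≤ (E t).card ∧ ∀ z ∈ E t, G.Adj (g t) z))
    (hgS : ∀ t < n, g t ∉ S t) (hgR : g 0 ∈ Rs) (hg0 : g 0 ∈ (h 0).vs)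
    (hlight : C * (ℓ + 2) * Δ ^ (ℓ + 1) < N0) (hcap : (Bd : ℝ) ≤ 3 / 4 * sm) : Emb N p G := by
  have hmono := heapB_mono M1 hM1
  let tgt : (Fin n × Bool) → Finset V := fun i =>
    (h i.1).M i.2 \ (Rs ∪ ((Finset.range n).erase i.1).biUnion (fun t' => (h t').vs))
  have htM : ∀ i, tgt i ⊆ (h i.1).M i.2 := fun i => Finset.sdiff_subset
  have htR : ∀ i, Disjoint (tgt i) Rs := by
    intro i
    rw [Finset.disjoint_left]
    intro z hz hz'
    exact (Finset.mem_sdiff.1 hz).2 (Finset.mem_union_left _ hz')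
  have htv : ∀ i, ∀ t < n, ∀ z ∈ tgt i, z ∈ (h t).vs → t = i.1 := by
    intro i t ht z hz hzP
    by_contra hne
    exact (Finset.mem_sdiff.1 hz).2 (Finset.mem_union_right _
      (Finset.mem_biUnion.2 ⟨t, Finset.mem_erase.2 ⟨hne, Finset.mem_range.2 ht⟩, hzP⟩))
  have hpos : ∀ t < n, 0 < ((h t).s : ℝ) := fun t ht => lt_of_lt_of_le hsm0 (hsp t ht).2
  have hn0 : 0 < n := by
    have := hmono (Nat.zero_le C)
    rw [← hn] at this
    exact this
  have hexp : ∀ i : Fin n × Bool, _ := fun i => main_exp G τ η p0 (h i.1) (hsp _ i.1.2).1 Δ hp0 hη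
    hτ hτ1 hητ hΔ1 (hsm.trans (mul_le_mul_of_nonneg_left (hsp _ i.1.2).2 hτ.le)) i.2 (tgt i)
    (htM i) ((hrem i.1 i.1.2 i.2).trans (by
      have := mul_le_mul_of_nonneg_left (hsp _ i.1.2).2 hτ.le
      linarith)) Bd (by
      have := (hsp _ i.1.2).2
      linarith)
  let Move : ℕ → (ℕ × Bool × V) → (ℕ × Bool × V) → Prop := fun k s s' =>
    SInv G N0 ℓ M1 S h g Rs cu k s' ∧
    (s'.2.1 = true → s'.2.2 = g s'.1 ∨ (s.2.1 = true ∧ s.1 = s'.1 ∧ ¬ cu.cut k))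
  have hdp0 : cu.dp 0 = 0 := cu.dp_cut 0 cu.cut0
  have hI0 : SInv G N0 ℓ M1 S h g Rs cu 0 (0, true, g 0) := by
    refine ⟨fun _ => ⟨?_, hgS 0 hn0, Or.inl hg0, fun _ => by omega⟩, fun hh => by simp at hh⟩
    rw [cu.ec0]
    exact Nat.zero_lt_one
  apply engine G N p (fun k h _ => hp k h) Δ hΔ tgt (fun i => (h i.1).side (!i.2))
    (fun i => ⌈η * (h i.1).s⌉₊) (fun _ => Bd) Rs ?_ htR ?_ (fun i => (hexp i).1)
    (fun i => (hexp i).2) (fun s => s.2.2) Move (0, true, g 0) hgR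
  · intro k hk hkN st hv
    have hinv : ∀ j < k, SInv G N0 ℓ M1 S h g Rs cu j (st j) := by
      intro j hj
      by_cases h0 : j = 0
      · subst h0; rw [hv.root]; exact hI0
      · exact (hv.move j (by omega) hj).1
    have hlab : ∀ j < k, (st j).2.1 = true → (st j).1 < n := by
      intro j hj hm
      have h1 := ((hinv j hj).1 hm).1
      have h2 := hmono (cu.ec_le j (by omega))
      rw [← hn] at h2
      omega
    have hlight' : ((Finset.range k).filter (fun j => (st j).2.2 ∈ Rs)).card < N0 := by
      refine lt_of_le_of_lt ?_ hlight
      refine le_trans ?_ (cu.light (ℓ + 1))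
      apply Finset.card_le_card
      intro j hj
      simp only [Finset.mem_filter, Finset.mem_range] at hj ⊢
      refine ⟨by omega, ?_⟩
      have h1 := hinv j hj.1
      cases hm : (st j).2.1 with
      | true => exact (h1.1 hm).2.2.2 hj.2
      | false => exact (h1.2 hm).2.2.2.1.trans (by omega)
    have hgate : ∀ j, j < k → (st j).2.1 = true →
        ∃ i0 < k, (st i0).2.2 = g (st j).1 ∧ cu.pid j = cu.pid i0 := by
      intro j
      induction j using Nat.strong_induction_on with
      | _ j ih =>
        intro hj hm
        by_cases h0 : j = 0
        · subst h0
          refine ⟨0, hk, ?_, rfl⟩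
          rw [hv.root]
        · rcases (hv.move j (by omega) hj).2 hm with h1 | ⟨h1, h2, h3⟩
          · exact ⟨j, hj, h1, rfl⟩
          · obtain ⟨i0, h4, h5, h6⟩ := ih (p j) (hp j (by omega)) (by have := hp j (by omega); omega) h1
            refine ⟨i0, h4, by rw [h5, h2], ?_⟩
            rw [cu.pid_not j h3, h6]
    have hpk := hp k hk
    -- an exit step
    have exitstep : ∀ e, cu.ec k = e + 1 → (st (p k)).1 < heapB M1 e → cu.dp k ≤ ℓ →
        (∃ L : Finset V, L ⊆ Rs ∧ N0 ≤ L.card ∧ ∀ u ∈ L, G.Adj (st (p k)).2.2 u ∧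
          Reach G N0 Rs (S (st (p k)).1) (ℓ - cu.dp k) u) →
        ∃ L : Finset V, (∀ z ∈ L, z ∈ Rs ∧ G.Adj (st (p k)).2.2 z ∧
          ∃ s' : ℕ × Bool × V, s'.2.2 = z ∧ Move k (st (p k)) s') ∧
        ((Finset.range k).filter (fun j => (st j).2.2 ∈ Rs)).card < L.card := by
      rintro e he ht hdp ⟨L, h1, h2, h3⟩
      refine ⟨L, fun z hz => ⟨h1 hz, (h3 z hz).1, ?_⟩, lt_of_lt_of_le hlight' h2⟩
      have hek : cu.ec k ≤ C := cu.ec_le k hkN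
      have htn : (st (p k)).1 < n := by
        have := hmono (show e ≤ C by omega)
        omega
      by_cases hzS : z ∈ S (st (p k)).1
      · obtain ⟨t', hzt, ht'⟩ := hS _ htn z hzS
        have ht'2 : t' < heapB M1 (cu.ec k) := by
          rw [he]
          show t' < M1 * heapB M1 e + 1
          have : M1 * (st (p k)).1 + M1 ≤ M1 * heapB M1 e := by
            rw [← Nat.mul_succ]; exact Nat.mul_le_mul_left _ ht
          omega
        have ht'n : t' < n := by
          have := hmono hek
          omega
        refine ⟨(t', true, z), rfl, ⟨fun _ => ⟨ht'2, ?_, Or.inr ⟨hzt, hdp, h1 hz⟩, fun _ => by omega⟩,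
          fun hh => by simp at hh⟩, fun _ => Or.inl hzt⟩
        show z ∉ S t'
        rw [hzt]
        exact hgS t' ht'n
      · exact ⟨((st (p k)).1, false, z), rfl, ⟨fun hh => by simp at hh, fun _ =>
          ⟨⟨e, he, ht⟩, hzS, h1 hz, hdp, (h3 z hz).2⟩⟩, fun hh => by simp at hh⟩
    by_cases hc : cu.cut k
    · -- a cut vertex
      left
      have hd0 := cu.dp_cut k hc
      have he := cu.ec_cut k hk hc
      have hek : cu.ec (p k) ≤ C := cu.ec_le (p k) (by omega)
      have hfin : ∀ v, v = (st (p k)).2.2 → v ∉ S (st (p k)).1 →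
          Reach G N0 Rs (S (st (p k)).1) ℓ v →
          (∃ L : Finset V, L ⊆ Rs ∧ N0 ≤ L.card ∧ ∀ u ∈ L, G.Adj (st (p k)).2.2 u ∧
          Reach G N0 Rs (S (st (p k)).1) (ℓ - cu.dp k) u) := by
        rintro v rfl hvS hvr
        obtain ⟨_, L, h3, h4, h5⟩ := hvr.step hvS
        exact ⟨L, h3, h4, fun u hu => ⟨(h5 u hu).1, (h5 u hu).2.mono_n (by omega)⟩⟩
      cases hm : (st (p k)).2.1 with
      | true =>
        obtain ⟨i1, i2, i3, i4⟩ := (hinv (p k) hpk).1 hm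
        refine exitstep (cu.ec (p k)) he i1 (by omega) (hfin _ rfl i2 (hreach _ (hlab _ hpk hm) _ ?_))
        rcases i3 with i3 | i3
        · exact Or.inl i3
        · exact Or.inr i3.1
      | false =>
        obtain ⟨⟨e, e1, e2⟩, i2, i3, i4, i5⟩ := (hinv (p k) hpk).2 hm
        refine exitstep (cu.ec (p k)) he ?_ (by omega) (hfin _ rfl i2 (i5.mono_n (by omega)))
        have := hmono (show e ≤ cu.ec (p k) by omega)
        omega
    · have hdk := cu.dp_not k hc
      have hek := cu.ec_not k hc
      cases hm : (st (p k)).2.1 with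
      | false =>
        left
        obtain ⟨⟨e, e1, e2⟩, i2, i3, i4, i5⟩ := (hinv (p k) hpk).2 hm
        obtain ⟨h0, L, h3, h4, h5⟩ := i5.step i2
        exact exitstep e (by omega) e2 (by omega) ⟨L, h3, h4, fun u hu =>
          ⟨(h5 u hu).1, (h5 u hu).2.mono_n (by omega)⟩⟩
      | true =>
        obtain ⟨i1, i2, i3, i4⟩ := (hinv (p k) hpk).1 hm
        have htn := hlab _ hpk hm
        by_cases hvv : (st (p k)).2.2 ∈ (h (st (p k)).1).vs
        · right
          obtain ⟨b, hb⟩ := (mem_vs_iff _ _).1 hvv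
          refine ⟨⟨⟨(st (p k)).1, htn⟩, !b⟩, by simpa using hb, ?_, ?_⟩
          · intro z hz _
            have hzR : z ∉ Rs := Finset.disjoint_left.1 (htR _) hz
            refine ⟨((st (p k)).1, true, z), rfl, ⟨fun _ => ⟨?_, ?_, ?_, ?_⟩,
              fun hh => by simp at hh⟩, fun _ => Or.inr ⟨hm, rfl, hc⟩⟩
            · rw [hek]; exact i1
            · exact fun hzS => hzR (hSR _ htn hzS)
            · exact Or.inl (M_vs _ _ (htM _ hz))
            · exact fun hh => absurd hh hzR
          · obtain ⟨i0, q1, q2, q3⟩ := hgate (p k) hpk hm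
            refine lt_of_lt_of_le (Finset.card_lt_card (t := (Finset.range N).filter
              (fun x => cu.pid x = cu.pid i0)) ⟨?_, ?_⟩) (cu.piece_le (cu.pid i0))
            · intro j hj
              simp only [Finset.mem_filter, Finset.mem_range] at hj ⊢
              refine ⟨by omega, ?_⟩
              have hjR : (st j).2.2 ∉ Rs := Finset.disjoint_left.1 (htR _) hj.2
              have hmj : (st j).2.1 = true := by
                cases hmj : (st j).2.1 with
                | true => rfl
                | false => exact absurd ((hinv j hj.1).2 hmj).2.2.1 hjR
              have hjn := hlab j hj.1 hmj
              obtain ⟨a1, a2, a3, a4⟩ := (hinv j hj.1).1 hmj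
              have hlabel : (st j).1 = (st (p k)).1 := by
                rcases a3 with a3 | a3
                · exact htv _ _ hjn _ hj.2 a3
                · exact absurd a3.2.2 hjR
              obtain ⟨j0, r1, r2, r3⟩ := hgate j hj.1 hmj
              rw [hlabel, ← q2] at r2
              have := hv.inj j0 r1 i0 q1 r2
              rw [r3, this]
            · intro hsub
              have : k ∈ (Finset.range k).filter (fun j => (st j).2.2 ∈
                tgt ⟨⟨(st (p k)).1, htn⟩, !b⟩) := by
                apply hsub
                simp only [Finset.mem_filter, Finset.mem_range]
                refine ⟨hkN, ?_⟩
                rw [cu.pid_not k hc, q3]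
              simp at this
        · left
          have hvg : (st (p k)).2.2 = g (st (p k)).1 ∧ cu.dp (p k) ≤ ℓ := by
            rcases i3 with i3 | i3
            · exact absurd i3 hvv
            · exact ⟨i3.1, i3.2.1⟩
          obtain ⟨e1, e2, e3, e4⟩ := hE _ htn
          obtain ⟨e5, e6⟩ := e4 (by rw [← hvg.1]; exact hvv)
          refine ⟨E (st (p k)).1, fun z hz => ⟨e1 hz, by rw [hvg.1]; exact e6 z hz, 
            ((st (p k)).1, true, z), rfl, ⟨fun _ => ⟨by rw [hek]; exact i1,
              Finset.disjoint_left.1 e3 hz, Or.inl (e2 hz), fun _ => by omega⟩,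
              fun hh => by simp at hh⟩, fun _ => Or.inr ⟨hm, rfl, hc⟩⟩,
            lt_of_lt_of_le hlight' e5⟩
  · rintro ⟨⟨t, ht⟩, b⟩ ⟨⟨t', ht'⟩, b'⟩ hne
    by_cases hPQ : t = t'
    · subst hPQ
      have hb : b' = !b := by
        have hbb : b ≠ b' := fun h => hne (by rw [h])
        cases b <;> cases b' <;> first | rfl | exact absurd rfl hbb
      subst hb
      exact ((hsp t ht).1.dside b).mono ((htM _).trans Finset.subset_union_left)
        ((htM _).trans Finset.subset_union_left)
    · rw [Finset.disjoint_left]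
      intro z hz hz'
      exact hPQ (htv ⟨⟨t', ht'⟩, b'⟩ t ht z hz' (M_vs _ _ (htM _ hz)))
  · intro i
    have := hpos _ i.1.2
    exact Nat.one_le_iff_ne_zero.2 (Nat.ceil_pos.2 (by positivity)).ne'

end HS


namespace HS
open scoped Classical

theorem choose_seq {ι V : Type} (𝓕 : Finset ι) (h𝓕 : 𝓕.Nonempty) (D : ι → Finset V) (N3 M1 : ℕ)
    (_hM1 : 1 ≤ M1) (h3 : ∀ c ∈ 𝓕, ∀ c' ∈ 𝓕, c ≠ c' → (D c ∩ D c').card ≤ N3) (n : ℕ)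
    (hbig : ∀ c ∈ 𝓕, n * (N3 + 1) < (D c ∩ (𝓕.erase c).biUnion D).card) :
    ∃ (cls : ℕ → ι) (g : ℕ → V), (∀ t, cls t ∈ 𝓕) ∧
      (∀ t < n, ∀ t' < n, cls t = cls t' → t = t') ∧
      (∀ t, 0 < t → t < n → g t ∈ D (cls ((t - 1) / M1)) ∧ g t ∈ D (cls t)) ∧
      (∀ t, 0 < t → t < n → ∀ t', 0 < t' → t' < n → g t = g t' → t = t') := by
  induction n with
  | zero =>
    obtain ⟨c, hc⟩ := h𝓕
    obtain ⟨v, hv⟩ := Finset.card_pos.1 (lt_of_le_of_lt (Nat.zero_le _) (hbig c hc))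
    exact ⟨fun _ => c, fun _ => v, fun _ => hc, by simp, by simp, by simp⟩
  | succ n ih =>
    obtain ⟨cls, g, a1, a2, a3, a4⟩ := ih (fun c hc => lt_of_le_of_lt
      (Nat.mul_le_mul_right _ (Nat.le_succ n)) (hbig c hc))
    by_cases hn : n = 0
    · subst hn
      exact ⟨cls, g, a1, fun t ht t' ht' _ => by omega, fun t _ _ => by omega,
        fun t _ _ => by omega⟩
    set u := (n - 1) / M1 with hu
    have hun : u < n := lt_of_le_of_lt (Nat.div_le_self _ _) (by omega)
    set W := D (cls u) ∩ (𝓕.erase (cls u)).biUnion D with hW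
    set Bad := ((Finset.range n).erase u).biUnion (fun t => D (cls u) ∩ D (cls t)) ∪
      (Finset.range n).image g with hBad
    have hBc : Bad.card ≤ n * (N3 + 1) := by
      refine (Finset.card_union_le _ _).trans ?_
      have h1 : (((Finset.range n).erase u).biUnion (fun t => D (cls u) ∩ D (cls t))).card ≤ n * N3 := by
        refine (Finset.card_biUnion_le_card_mul _ _ N3 ?_).trans ?_
        · intro t ht
          obtain ⟨h1, h2⟩ := Finset.mem_erase.1 ht
          apply h3 _ (a1 u) _ (a1 t)
          intro h
          exact h1 (a2 u hun t (Finset.mem_range.1 h2) h).symm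
        · apply Nat.mul_le_mul_right
          exact (Finset.card_le_card (Finset.erase_subset _ _)).trans (by simp)
      have h2 : ((Finset.range n).image g).card ≤ n := Finset.card_image_le.trans (by simp)
      calc _ ≤ n * N3 + n := Nat.add_le_add h1 h2
        _ = _ := by ring
    obtain ⟨v, hvW, hvB⟩ : ∃ v ∈ W, v ∉ Bad := by
      by_contra hcon
      push Not at hcon
      have h1 := Finset.card_le_card (show W ⊆ Bad from hcon)
      have h2 : (n + 1) * (N3 + 1) < W.card := hbig (cls u) (a1 u)
      have : n * (N3 + 1) ≤ (n + 1) * (N3 + 1) := Nat.mul_le_mul_right _ (Nat.le_succ n)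
      omega
    obtain ⟨hv1, hv2⟩ := Finset.mem_inter.1 hvW
    obtain ⟨c', hc', hvc'⟩ := Finset.mem_biUnion.1 hv2
    obtain ⟨hc'1, hc'2⟩ := Finset.mem_erase.1 hc'
    have hnew : ∀ t < n, cls t ≠ c' := by
      intro t ht he
      by_cases htu : t = u
      · subst htu; exact hc'1 he.symm
      · apply hvB
        apply Finset.mem_union_left
        refine Finset.mem_biUnion.2 ⟨t, Finset.mem_erase.2 ⟨htu, Finset.mem_range.2 ht⟩,
          Finset.mem_inter.2 ⟨hv1, by rw [he]; exact hvc'⟩⟩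
    have hgnew : ∀ t < n, g t ≠ v := by
      intro t ht he
      apply hvB
      apply Finset.mem_union_right
      exact Finset.mem_image.2 ⟨t, Finset.mem_range.2 ht, he⟩
    have up1 : ∀ t < n, Function.update cls n c' t = cls t := fun t ht =>
      Function.update_of_ne (by omega) _ _
    have up2 : ∀ t < n, Function.update g n v t = g t := fun t ht =>
      Function.update_of_ne (by omega) _ _
    refine ⟨Function.update cls n c', Function.update g n v, ?_, ?_, ?_, ?_⟩
    · intro t
      by_cases ht : t = n
      · subst ht; rw [Function.update_self]; exact hc'2
      · rw [Function.update_of_ne ht]; exact a1 t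
    · intro t ht t' ht' he
      rcases Nat.lt_succ_iff_lt_or_eq.1 ht with h1 | h1 <;>
        rcases Nat.lt_succ_iff_lt_or_eq.1 ht' with h2 | h2
      · rw [up1 t h1, up1 t' h2] at he; exact a2 t h1 t' h2 he
      · rw [h2, Function.update_self, up1 t h1] at he; exact absurd he (hnew t h1)
      · rw [h1, Function.update_self, up1 t' h2] at he; exact absurd he.symm (hnew t' h2)
      · omega
    · intro t h0 ht
      rcases Nat.lt_succ_iff_lt_or_eq.1 ht with h1 | h1
      · rw [up2 t h1, up1 t h1, up1 _ (lt_of_le_of_lt (Nat.div_le_self _ _) (by omega))]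
        exact a3 t h0 h1
      · subst h1
        rw [Function.update_self, Function.update_self, up1 _ hun]
        exact ⟨hv1, hvc'⟩
    · intro t h0 ht t' h0' ht' he
      rcases Nat.lt_succ_iff_lt_or_eq.1 ht with h1 | h1 <;>
        rcases Nat.lt_succ_iff_lt_or_eq.1 ht' with h2 | h2
      · rw [up2 t h1, up2 t' h2] at he; exact a4 t h0 h1 t' h0' h2 he
      · rw [h2, Function.update_self, up2 t h1] at he; exact absurd he (hgnew t h1)
      · rw [h1, Function.update_self, up2 t' h2] at he; exact absurd he.symm (hgnew t' h2)
      · omega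

/-- The vertices attached to a class of spots. -/
noncomputable def DC {V : Type} [Fintype V] (G : SimpleGraph V) (kd : ℝ) (J : Finset (Spot V)) :
    Finset V := J.biUnion (fun P => P.D G kd)

theorem vs_sub_D {V : Type} [Fintype V] (G : SimpleGraph V) {τ η p kd : ℝ} (P : Spot V)
    (hP : IsSpot G τ η p P) (hk : kd ≤ τ * P.s) : P.vs ⊆ P.D G kd := by
  intro v hv
  obtain ⟨b, hb⟩ := (mem_vs_iff _ _).1 hv
  refine Finset.mem_filter.2 ⟨Finset.mem_univ _, !b, ?_⟩
  refine hk.trans ((hP.degM b v hb).trans ?_)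
  exact_mod_cast Finset.card_le_card (nbr_mono _ Finset.subset_union_left v)

theorem grown_nonempty {V : Type} [Fintype V] {G : SimpleGraph V} {kd : ℝ} {N2 : ℕ}
    {J : Finset (Spot V)} (hJ : Grown G kd N2 J) : J.Nonempty := by
  cases hJ with
  | single P => exact ⟨P, by simp⟩
  | grow J P Q => exact ⟨Q, by simp⟩

theorem class_pack {V : Type} [Fintype V] (G : SimpleGraph V) {τ η p kd sm : ℝ}
    {d N0 M0 M0' : ℕ}
    (hr : RParam τ η p kd d N0 M0 M0' sm) (hkN : (N0 : ℝ) ≤ kd) (J : Finset (Spot V))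
    (hJ : Grown G kd (4 * M0) J)
    (hsp : ∀ P ∈ J, IsSpot G τ η p P ∧ sm ≤ P.s ∧ P.s ≤ d) (K : ℕ) (hK : J.card ≤ K)
    (S : Finset V) (hS : S ⊆ DC G kd J) (hSc : K * (2 * M0) ≤ S.card) :
    ∃ Ψ : Finset V, Ψ.card ≤ K * (M0 + 2 * M0' + 2 * (M0 * N0)) + M0' ∧
      ∀ Rs : Finset V, Ψ ⊆ Rs → S ⊆ Rs → (∀ P ∈ J, ∀ b, P.R b ⊆ Rs) →
        ∀ v ∈ J.biUnion Spot.vs, Reach G N0 Rs S (7 * K + 5) v := by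
  obtain ⟨Ψ, hΨc, hΨ⟩ := grown_route G hr hkN J hJ hsp
  have hex : ∃ P ∈ J, 2 * M0 ≤ (S ∩ P.D G kd).card := by
    by_contra hcon
    push Not at hcon
    have h1 : S ⊆ J.biUnion (fun P => S ∩ P.D G kd) := by
      intro v hv
      obtain ⟨P, hP, hvP⟩ := Finset.mem_biUnion.1 (hS hv)
      exact Finset.mem_biUnion.2 ⟨P, hP, Finset.mem_inter.2 ⟨hv, hvP⟩⟩
    have h2 := (Finset.card_le_card h1).trans Finset.card_biUnion_le
    have h3 : ∑ P ∈ J, (S ∩ P.D G kd).card < ∑ P ∈ J, (2 * M0) :=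
      Finset.sum_lt_sum_of_nonempty (grown_nonempty hJ) hcon
    simp only [Finset.sum_const, smul_eq_mul] at h3
    have h4 : J.card * (2 * M0) ≤ K * (2 * M0) := Nat.mul_le_mul_right _ hK
    omega
  obtain ⟨P, hP, hPc⟩ := hex
  obtain ⟨b, S', hS', hS'c, hS'd⟩ := pigeon_side G kd P (S ∩ P.D G kd) Finset.inter_subset_right M0 hPc
  obtain ⟨h1, h2, h3⟩ := hsp P hP
  obtain ⟨A, hA, hAc, hAr⟩ := exit_lemma G hr P h1 h2 h3 b S' hS'c hS'd
  refine ⟨Ψ ∪ A, ?_, ?_⟩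
  · refine (Finset.card_union_le _ _).trans (Nat.add_le_add ?_ hAc)
    exact hΨc.trans (Nat.mul_le_mul_right _ hK)
  · intro Rs hR1 hR2 hR3 v hv
    have e1 := hΨ Rs (Finset.subset_union_left.trans hR1) hR3 P hP v (Finset.mem_union_right _ hv)
    have hS'S : S' ⊆ S := hS'.trans Finset.inter_subset_left
    have e2 := hAr Rs (hS'S.trans hR2) (Finset.subset_union_right.trans hR1) (hR3 P hP)
    have e3 := Reach.trans e2 e1
    have e4 := Reach.trans (Y := S) (m := 0) (fun u hu => hS'S hu) e3
    exact e4.mono_n (by omega)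

end HS


namespace HS
open scoped Classical

set_option maxHeartbeats 1000000 in
theorem e2 {V : Type} [Fintype V] (G : SimpleGraph V) {τ η p0 kd sm : ℝ} {d N0 M0 M0' : ℕ}
    (hr : RParam τ η p0 kd d N0 M0 M0' sm)
    (hτ1 : τ ≤ 1 / 20) (Δ : ℕ) (hΔ1 : 1 ≤ Δ) (hητ : 8 * Δ * η ≤ τ) (hsm : 4 * (Δ : ℝ) ≤ τ * sm)
    (N : ℕ) (p : ℕ → ℕ) (hp : ∀ k, 0 < k → p k < k)
    (hΔ : ∀ j, ((Finset.range N).filter (fun k => 0 < k ∧ p k = j)).card ≤ Δ)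
    (Bd C : ℕ) (cu : Cut N p Δ Bd C)
    (𝓕 : Finset (Finset (Spot V))) (h𝓕 : 𝓕.Nonempty)
    (hgr : ∀ J ∈ 𝓕, Grown G kd (4 * M0) J) (K : ℕ) (hK : ∀ J ∈ 𝓕, J.card ≤ K)
    (hsp : ∀ J ∈ 𝓕, ∀ P ∈ J, IsSpot G τ η p0 P ∧ sm ≤ P.s ∧ P.s ≤ d)
    (hkτ : kd ≤ τ * sm) (N3 : ℕ)
    (h3 : ∀ J ∈ 𝓕, ∀ J' ∈ 𝓕, J ≠ J' → (DC G kd J ∩ DC G kd J').card ≤ N3)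
    (μ : ℝ) (hμ0 : 0 ≤ μ)
    (hμ : ∀ J ∈ 𝓕, ∀ P ∈ J, ∀ Q ∈ J, P ≠ Q → ((P.vs ∩ Q.vs).card : ℝ) ≤ μ)
    (M1 ℓ n nm : ℕ) (hM1 : M1 = K * (2 * M0)) (hM11 : 1 ≤ M1) (hℓ : ℓ = 7 * K + 6)
    (hn : n = heapB M1 C) (hnm : nm = heapB M1 (C + 1))
    (hbig : ∀ J ∈ 𝓕, nm * (N3 + 1) < (DC G kd J ∩ (𝓕.erase J).biUnion (DC G kd)).card)
    (hrem : K * μ + ((n * (K * (M0 + 2 * M0' + 2 * (M0 * N0)) + M0') + n * N0 + (nm + 1) +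
      n * N3 : ℕ) : ℝ) ≤ τ * sm / 2)
    (hkN : (N0 : ℝ) + nm ≤ kd)
    (hlight : C * (ℓ + 2) * Δ ^ (ℓ + 1) < N0) (hcap : (Bd : ℝ) ≤ 3 / 4 * sm) : Emb N p G := by
  have hkN' : (N0 : ℝ) ≤ kd := by
    have : (0 : ℝ) ≤ nm := by positivity
    linarith
  obtain ⟨cls, g, c1, c2, c3, c4⟩ := choose_seq 𝓕 h𝓕 (DC G kd) N3 M1 hM11 h3 nm
    (fun c hc => by convert hbig c hc)
  have hnnm : nm = M1 * n + 1 := by rw [hnm, hn]; rfl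
  have hn1 : 1 ≤ n := by rw [hn]; exact heapB_mono M1 hM11 (Nat.zero_le C)
  have hnlt : n < nm := by
    rw [hnnm]; have := Nat.le_mul_of_pos_left n hM11; omega
  set Gall := (Finset.Ioo 0 nm).image g with hGall
  have hGc : Gall.card ≤ nm := by
    refine Finset.card_image_le.trans ?_
    simp
  -- child gates
  let S : ℕ → Finset V := fun t => (Finset.Icc (M1 * t + 1) (M1 * t + M1)).image g
  have hchild : ∀ t < n, ∀ t' ∈ Finset.Icc (M1 * t + 1) (M1 * t + M1), 0 < t' ∧ t' < nm ∧
      (t' - 1) / M1 = t := by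
    intro t ht t' ht'
    obtain ⟨h1, h2⟩ := Finset.mem_Icc.1 ht'
    refine ⟨by omega, ?_, ?_⟩
    · have : M1 * t + M1 ≤ M1 * n := by
        rw [← Nat.mul_succ]; exact Nat.mul_le_mul_left _ ht
      omega
    · apply Nat.div_eq_of_lt_le
      · rw [Nat.mul_comm]; omega
      · rw [Nat.mul_comm, Nat.mul_succ]; omega
  have hSG : ∀ t < n, S t ⊆ Gall := by
    intro t ht
    apply Finset.image_subset_image
    intro t' ht'
    have := hchild t ht t' ht'
    exact Finset.mem_Ioo.2 ⟨this.1, this.2.1⟩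
  have hSD : ∀ t < n, S t ⊆ DC G kd (cls t) := by
    intro t ht z hz
    obtain ⟨t', ht', rfl⟩ := Finset.mem_image.1 hz
    obtain ⟨q1, q2, q3⟩ := hchild t ht t' ht'
    have := (c3 t' q1 q2).1
    rwa [q3] at this
  have hSc : ∀ t < n, K * (2 * M0) ≤ (S t).card := by
    intro t ht
    rw [Finset.card_image_of_injOn]
    · rw [← hM1, Nat.card_Icc]; omega
    · intro a ha b hb hab
      have qa := hchild t ht a (Finset.mem_coe.1 ha)
      have qb := hchild t ht b (Finset.mem_coe.1 hb)
      exact c4 a qa.1 qa.2.1 b qb.1 qb.2.1 hab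
  have hpack : ∀ t, ∃ Ψ : Finset V, t < n → (Ψ.card ≤ K * (M0 + 2 * M0' + 2 * (M0 * N0)) + M0' ∧
      ∀ Rs : Finset V, Ψ ⊆ Rs → S t ⊆ Rs → (∀ P ∈ cls t, ∀ b, P.R b ⊆ Rs) →
        ∀ v ∈ (cls t).biUnion Spot.vs, Reach G N0 Rs (S t) (7 * K + 5) v) := by
    intro t
    by_cases ht : t < n
    · obtain ⟨Ψ, hΨ⟩ := class_pack G hr hkN' (cls t) (hgr _ (c1 t)) (hsp _ (c1 t)) K (hK _ (c1 t))
        (S t) (hSD t ht) (hSc t ht)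
      exact ⟨Ψ, fun _ => hΨ⟩
    · exact ⟨∅, fun h => absurd h ht⟩
  choose Ψ hΨ using hpack
  have hmain : ∀ t, ∃ P : Spot V, P ∈ cls t ∧ (0 < t → t < n → g t ∈ P.D G kd) := by
    intro t
    by_cases ht : 0 < t ∧ t < n
    · obtain ⟨P, hP, hPg⟩ := Finset.mem_biUnion.1 (c3 t ht.1 (by omega)).2
      exact ⟨P, hP, fun _ _ => hPg⟩
    · obtain ⟨P, hP⟩ := grown_nonempty (hgr _ (c1 t))
      exact ⟨P, hP, fun h1 h2 => absurd ⟨h1, h2⟩ ht⟩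
  choose h hh1 hh2 using hmain
  have hspt := fun t => hsp _ (c1 t) _ (hh1 t)
  have hEex : ∀ t, ∃ E : Finset V, E.card ≤ N0 ∧ E ⊆ (h t).vs ∧ Disjoint E Gall ∧
      (0 < t → t < n → N0 ≤ E.card ∧ ∀ z ∈ E, G.Adj (g t) z) := by
    intro t
    by_cases ht : 0 < t ∧ t < n
    · obtain ⟨b, hb⟩ := (Finset.mem_filter.1 (hh2 t ht.1 ht.2)).2
      have q1 := nbr_sdiff_card G ((h t).side b) Gall (g t)
      have q2 : N0 + nm ≤ (nbr G ((h t).side b) (g t)).card := by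
        exact_mod_cast hkN.trans hb
      obtain ⟨E, hE, hEc⟩ := Finset.exists_subset_card_eq
        (show N0 ≤ (nbr G ((h t).side b \ Gall) (g t)).card by omega)
      refine ⟨E, hEc.le, ?_, ?_, fun _ _ => ⟨hEc.ge, fun z hz => (mem_nbr.1 (hE hz)).2⟩⟩
      · intro z hz
        exact vs_side _ b (Finset.mem_sdiff.1 (mem_nbr.1 (hE hz)).1).1
      · rw [Finset.disjoint_left]
        intro z hz
        exact (Finset.mem_sdiff.1 (mem_nbr.1 (hE hz)).1).2
    · exact ⟨∅, by simp, by simp, by simp, fun h1 h2 => absurd ⟨h1, h2⟩ ht⟩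
  choose E hE1 hE2 hE3 hE4 using hEex
  -- the root
  obtain ⟨r, hr1, hr2⟩ : ∃ r ∈ (h 0).vs, r ∉ Gall := by
    by_contra hcon
    push Not at hcon
    have q1 := (Finset.card_le_card (show (h 0).vs ⊆ Gall from hcon)).trans hGc
    obtain ⟨v, hv⟩ := root_exists G hr.hτ (h 0) (hspt 0).1 (lt_of_lt_of_le hr.hsm (hspt 0).2.1)
    have q2 := (hspt 0).1.degM true v (Finset.mem_union_right _ hv)
    have q3 : (nbr G ((h 0).M (!true)) v).card ≤ (h 0).vs.card :=
      Finset.card_le_card ((Finset.filter_subset _ _).trans (M_vs _ _))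
    have q4 : ((nbr G ((h 0).M (!true)) v).card : ℝ) ≤ nm := by exact_mod_cast q3.trans q1
    have q5 : τ * sm ≤ τ * (h 0).s := mul_le_mul_of_nonneg_left (hspt 0).2.1 hr.hτ.le
    have q6 : (1 : ℝ) ≤ N0 := by exact_mod_cast hr.hN0
    linarith
  set g' := Function.update g 0 r with hg'
  have hg'0 : g' 0 = r := Function.update_self _ _ _
  have hg'p : ∀ t, 0 < t → g' t = g t := fun t ht => Function.update_of_ne (by omega) _ _
  -- the reserve
  set Cs : Finset V := (Finset.range n).biUnion Ψ ∪ (Finset.range n).biUnion E ∪ insert r Gall with hCs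
  have hCsc : Cs.card ≤ n * (K * (M0 + 2 * M0' + 2 * (M0 * N0)) + M0') + n * N0 + (nm + 1) := by
    refine (Finset.card_union_le _ _).trans (Nat.add_le_add ?_ ?_)
    · refine (Finset.card_union_le _ _).trans (Nat.add_le_add ?_ ?_)
      · refine (Finset.card_biUnion_le_card_mul _ _ _
          (fun t ht => (hΨ t (Finset.mem_range.1 ht)).1)).trans (by simp)
      · refine (Finset.card_biUnion_le_card_mul _ _ _ (fun t ht => hE1 t)).trans (by simp)
    · exact (Finset.card_insert_le _ _).trans (by omega)
  set Rs : Finset V := Cs ∪ (Finset.range n).biUnion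
    (fun t => (cls t).biUnion (fun P => P.R true ∪ P.R false)) with hRs
  have hRR : ∀ t < n, ∀ P ∈ cls t, ∀ b, P.R b ⊆ Rs := by
    intro t ht P hP b z hz
    apply Finset.mem_union_right
    refine Finset.mem_biUnion.2 ⟨t, Finset.mem_range.2 ht, Finset.mem_biUnion.2 ⟨P, hP, ?_⟩⟩
    cases b <;> simp [hz]
  have hΨR : ∀ t < n, Ψ t ⊆ Rs := fun t ht z hz => Finset.mem_union_left _
    (Finset.mem_union_left _ (Finset.mem_union_left _
      (Finset.mem_biUnion.2 ⟨t, Finset.mem_range.2 ht, hz⟩)))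
  have hER : ∀ t < n, E t ⊆ Rs := fun t ht z hz => Finset.mem_union_left _
    (Finset.mem_union_left _ (Finset.mem_union_right _
      (Finset.mem_biUnion.2 ⟨t, Finset.mem_range.2 ht, hz⟩)))
  have hGR : insert r Gall ⊆ Rs := fun z hz => Finset.mem_union_left _ (Finset.mem_union_right _ hz)
  have hSR : ∀ t < n, S t ⊆ Rs := fun t ht =>
    ((hSG t ht).trans (Finset.subset_insert _ _)).trans hGR
  have hreach1 : ∀ t < n, ∀ v ∈ (h t).vs, Reach G N0 Rs (S t) (7 * K + 5) v := by
    intro t ht v hv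
    exact (hΨ t ht).2 Rs (hΨR t ht) (hSR t ht) (hRR t ht) v
      (Finset.mem_biUnion.2 ⟨h t, hh1 t, hv⟩)
  have hvsDC : ∀ t, ∀ P ∈ cls t, P.vs ⊆ DC G kd (cls t) := by
    intro t P hP
    have q := hsp _ (c1 t) P hP
    refine (vs_sub_D G P q.1 (hkτ.trans (mul_le_mul_of_nonneg_left q.2.1 hr.hτ.le))).trans ?_
    exact Finset.subset_biUnion_of_mem (fun P => P.D G kd) hP
  refine e2_run G hr.hτ hr.hη hr.hp hr.hsm hτ1 Δ hΔ1 hητ hsm N p hp hΔ Bd C cu N0 ℓ M1 n hM11 hn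
    S h g' E Rs (fun t _ => ⟨(hspt t).1, (hspt t).2.1⟩) ?_ ?_ hSR ?_ ?_ ?_ ?_ ?_ hlight hcap
  · intro t ht b
    have hsub : (h t).M b \ ((h t).M b \ (Rs ∪ ((Finset.range n).erase t).biUnion
        (fun t' => (h t').vs))) ⊆ (Cs ∪ ((Finset.range n).erase t).biUnion
          (fun t' => DC G kd (cls t) ∩ DC G kd (cls t'))) ∪
          ((cls t).erase (h t)).biUnion (fun Q => (h t).vs ∩ Q.vs) := by
      intro z hz
      obtain ⟨hz1, hz2⟩ := Finset.mem_sdiff.1 hz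
      have hz3 : z ∈ Rs ∪ ((Finset.range n).erase t).biUnion (fun t' => (h t').vs) := by
        by_contra hh
        exact hz2 (Finset.mem_sdiff.2 ⟨hz1, hh⟩)
      have key : ∀ t' < n, t' ≠ t → ∀ Q ∈ cls t', z ∈ Q.vs → z ∈ ((Finset.range n).erase t).biUnion
          (fun t' => DC G kd (cls t) ∩ DC G kd (cls t')) := fun t' ht' hne Q hQ hzQ =>
        Finset.mem_biUnion.2 ⟨t', Finset.mem_erase.2 ⟨hne, Finset.mem_range.2 ht'⟩,
          Finset.mem_inter.2 ⟨hvsDC t _ (hh1 t) (M_vs _ _ hz1), hvsDC t' Q hQ hzQ⟩⟩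
      rcases Finset.mem_union.1 hz3 with hz4 | hz4
      · rcases Finset.mem_union.1 hz4 with hz5 | hz5
        · exact Finset.mem_union_left _ (Finset.mem_union_left _ hz5)
        · obtain ⟨t', ht', hz6⟩ := Finset.mem_biUnion.1 hz5
          obtain ⟨Q, hQ, hzQ⟩ := Finset.mem_biUnion.1 hz6
          have hzQ' : ∃ b', z ∈ Q.R b' := by
            rcases Finset.mem_union.1 hzQ with h | h
            · exact ⟨_, h⟩
            · exact ⟨_, h⟩
          obtain ⟨b', hb'⟩ := hzQ'
          by_cases htt : t' = t
          · subst htt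
            by_cases hQP : Q = h t'
            · subst hQP
              exact absurd hb' (Finset.disjoint_left.1 (M_disj_R (hspt t').1 b b') hz1)
            · exact Finset.mem_union_right _ (Finset.mem_biUnion.2
                ⟨Q, Finset.mem_erase.2 ⟨hQP, hQ⟩, Finset.mem_inter.2 ⟨M_vs _ _ hz1, R_vs Q _ hb'⟩⟩)
          · exact Finset.mem_union_left _ (Finset.mem_union_right _
              (key t' (Finset.mem_range.1 ht') htt Q hQ (R_vs Q _ hb')))
      · obtain ⟨t', ht', hzQ⟩ := Finset.mem_biUnion.1 hz4
        obtain ⟨q1, q2⟩ := Finset.mem_erase.1 ht'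
        exact Finset.mem_union_left _ (Finset.mem_union_right _
          (key t' (Finset.mem_range.1 q2) q1 (h t') (hh1 t') hzQ))
    have q1 : (((Finset.range n).erase t).biUnion
          (fun t' => DC G kd (cls t) ∩ DC G kd (cls t'))).card ≤ n * N3 := by
      refine (Finset.card_biUnion_le_card_mul _ _ N3 ?_).trans ?_
      · intro t' ht'
        obtain ⟨q1, q2⟩ := Finset.mem_erase.1 ht'
        apply h3 _ (c1 t) _ (c1 t')
        intro hcc
        have q3 := Finset.mem_range.1 q2
        exact q1 (c2 t (by omega) t' (by omega) hcc).symm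
      · apply Nat.mul_le_mul_right
        exact (Finset.card_le_card (Finset.erase_subset _ _)).trans (by simp)
    have q2 : ((((cls t).erase (h t)).biUnion (fun Q => (h t).vs ∩ Q.vs)).card : ℝ) ≤ K * μ := by
      have e1 : ((((cls t).erase (h t)).biUnion (fun Q => (h t).vs ∩ Q.vs)).card : ℝ) ≤
          ∑ Q ∈ (cls t).erase (h t), (((h t).vs ∩ Q.vs).card : ℝ) := by
        exact_mod_cast Finset.card_biUnion_le
      refine e1.trans ?_
      calc ∑ Q ∈ (cls t).erase (h t), (((h t).vs ∩ Q.vs).card : ℝ) ≤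
            ∑ Q ∈ (cls t).erase (h t), μ := by
            apply Finset.sum_le_sum
            intro Q hQ
            obtain ⟨h1, h2⟩ := Finset.mem_erase.1 hQ
            exact hμ _ (c1 t) _ (hh1 t) Q h2 (Ne.symm h1)
        _ = ((cls t).erase (h t)).card * μ := by simp
        _ ≤ K * μ := by
            apply mul_le_mul_of_nonneg_right _ hμ0
            exact_mod_cast (Finset.card_le_card (Finset.erase_subset _ _)).trans (hK _ (c1 t))
    have q3 := (Finset.card_le_card hsub).trans (Finset.card_union_le _ _)
    have q4 := Finset.card_union_le Cs (((Finset.range n).erase t).biUnion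
          (fun t' => DC G kd (cls t) ∩ DC G kd (cls t')))
    have q5 : (((h t).M b \ ((h t).M b \ (Rs ∪ ((Finset.range n).erase t).biUnion
        (fun t' => (h t').vs)))).card : ℝ) ≤ ((n * (K * (M0 + 2 * M0' + 2 * (M0 * N0)) + M0') + n * N0 + (nm + 1) +
      n * N3 : ℕ) : ℝ) + (((cls t).erase (h t)).biUnion (fun Q => (h t).vs ∩ Q.vs)).card := by
      have : ((h t).M b \ ((h t).M b \ (Rs ∪ ((Finset.range n).erase t).biUnion
        (fun t' => (h t').vs)))).card ≤ (n * (K * (M0 + 2 * M0' + 2 * (M0 * N0)) + M0') + n * N0 + (nm + 1) +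
      n * N3) + (((cls t).erase (h t)).biUnion (fun Q => (h t).vs ∩ Q.vs)).card := by omega
      exact_mod_cast this
    linarith
  · intro t ht z hz
    obtain ⟨t', ht', rfl⟩ := Finset.mem_image.1 hz
    exact ⟨t', (hg'p t' (hchild t ht t' ht').1).symm, (Finset.mem_Icc.1 ht').2⟩
  · intro t ht v hv
    rw [hℓ]
    rcases hv with hv | hv
    · exact (hreach1 t ht v hv).mono_n (by omega)
    · rcases Nat.eq_zero_or_pos t with h0 | h0
      · subst h0
        rw [hv, hg'0]
        exact (hreach1 0 ht r hr1).mono_n (by omega)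
      · rw [hg'p t h0] at hv
        rw [hv]
        exact Or.inr ⟨E t, hER t ht, (hE4 t h0 ht).1, fun u hu =>
          ⟨(hE4 t h0 ht).2 u hu, hreach1 t ht u (hE2 t hu)⟩⟩
  · intro t ht
    refine ⟨hER t ht, hE2 t, (hE3 t).mono_right (hSG t ht), fun hnv => ?_⟩
    rcases Nat.eq_zero_or_pos t with h0 | h0
    · subst h0
      rw [hg'0] at hnv
      exact absurd hr1 hnv
    · rw [hg'p t h0]
      exact hE4 t h0 ht
  · intro t ht hgS
    rcases Nat.eq_zero_or_pos t with h0 | h0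
    · subst h0
      rw [hg'0] at hgS
      exact hr2 (hSG 0 ht hgS)
    · rw [hg'p t h0] at hgS
      obtain ⟨t', ht', heq⟩ := Finset.mem_image.1 hgS
      obtain ⟨q1, q2, q3⟩ := hchild t ht t' ht'
      have := c4 t' q1 q2 t h0 (by omega) heq
      have q4 := (Finset.mem_Icc.1 ht').1
      have := Nat.le_mul_of_pos_left t hM11
      omega
  · rw [hg'0]; exact hGR (Finset.mem_insert_self _ _)
  · rw [hg'0]; exact hr1

end HS


namespace HS
open scoped Classical

/-- The graph of edges that are not captured by the family `𝒮`. -/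
def Lf {V : Type} [Fintype V] (G : SimpleGraph V) (kd : ℝ) (𝒮 : Finset (Spot V)) : SimpleGraph V where
  Adj u v := G.Adj u v ∧ ∀ P ∈ 𝒮, ¬ (u ∈ P.vs ∧ v ∈ P.D G kd) ∧ ¬ (v ∈ P.vs ∧ u ∈ P.D G kd)
  symm := ⟨fun _ _ h => ⟨h.1.symm, fun P hP => ⟨(h.2 P hP).2, (h.2 P hP).1⟩⟩⟩
  loopless := ⟨fun u h => G.loopless.irrefl u h.1⟩

theorem Lf_le {V : Type} [Fintype V] (G : SimpleGraph V) (kd : ℝ) (𝒮 : Finset (Spot V)) :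
    Lf G kd 𝒮 ≤ G := fun _ _ h => h.1

theorem spots_finite {V : Type} [Fintype V] (d : ℕ) : {P : Spot V | P.s ≤ d}.Finite := by
  apply Set.Finite.subset (Set.finite_range
    (fun x : Fin (d + 1) × (Bool → Finset V) × (Bool → Finset V) => (⟨x.1, x.2.1, x.2.2⟩ : Spot V)))
  rintro ⟨s, M, R⟩ hs
  exact ⟨(⟨s, Nat.lt_succ_of_le hs⟩, M, R), rfl⟩

theorem exists_family {V : Type} [Fintype V] (G : SimpleGraph V) {τ η p0 kd sm μ : ℝ} (d : ℕ)
    (hτ : 0 < τ) (hsm : 0 < sm) (hμ : 0 < μ) (hkd : kd = τ * μ / 4) (hkτ : kd ≤ τ * sm) :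
    ∃ 𝒮 : Finset (Spot V), (∀ P ∈ 𝒮, IsSpot G τ η p0 P ∧ sm ≤ P.s ∧ P.s ≤ d) ∧
      (∀ P ∈ 𝒮, ∀ Q ∈ 𝒮, P ≠ Q → ((P.vs ∩ Q.vs).card : ℝ) ≤ μ) ∧
      ∀ Q, IsSpot (Lf G kd 𝒮) τ η p0 Q → sm ≤ Q.s → Q.s ≤ d → False := by
  set 𝒰 : Finset (Spot V) := (spots_finite (V := V) d).toFinset.filter
    (fun P => IsSpot G τ η p0 P ∧ sm ≤ P.s) with h𝒰
  have hmem : ∀ P, P ∈ 𝒰 ↔ (IsSpot G τ η p0 P ∧ sm ≤ P.s) ∧ P.s ≤ d := by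
    intro P
    simp [h𝒰, and_comm]
  set Ω := 𝒰.powerset.filter (fun 𝒮 => ∀ P ∈ 𝒮, ∀ Q ∈ 𝒮, P ≠ Q →
    ((P.vs ∩ Q.vs).card : ℝ) ≤ μ) with hΩ
  have hne : Ω.Nonempty := ⟨∅, by simp [hΩ]⟩
  obtain ⟨𝒮, h𝒮, hmax⟩ := Finset.exists_max_image Ω Finset.card hne
  obtain ⟨h1, h2⟩ := Finset.mem_filter.1 h𝒮
  have h1' := Finset.mem_powerset.1 h1
  refine ⟨𝒮, fun P hP => ?_, h2, ?_⟩
  · have := (hmem P).1 (h1' hP)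
    exact ⟨this.1.1, this.1.2, this.2⟩
  intro Q hQ hQ1 hQ2
  have hQs : 0 < (Q.s : ℝ) := lt_of_lt_of_le hsm hQ1
  have hkd0 : 0 < kd := by rw [hkd]; positivity
  have hQG := hQ.mono (Lf_le G kd 𝒮)
  by_cases hQS : Q ∈ 𝒮
  · obtain ⟨v, hv⟩ := root_exists _ hτ Q hQ hQs
    have hv' := R_vs Q _ hv
    have q2 := hQ.degM true v (Finset.mem_union_right _ hv)
    have q3 : 0 < ((nbr (Lf G kd 𝒮) (Q.M (!true)) v).card : ℝ) := lt_of_lt_of_le (by positivity) q2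
    have q4 : 0 < (nbr (Lf G kd 𝒮) (Q.M (!true)) v).card := by exact_mod_cast q3
    obtain ⟨z, hz⟩ := Finset.card_pos.1 q4
    obtain ⟨hz1, hz2⟩ := mem_nbr.1 hz
    refine (hz2.2 Q hQS).2 ⟨M_vs _ _ hz1, ?_⟩
    exact vs_sub_D G Q hQG (hkτ.trans (mul_le_mul_of_nonneg_left hQ1 hτ.le)) hv'
  · have : ∃ P ∈ 𝒮, μ < ((Q.vs ∩ P.vs).card : ℝ) := by
      by_contra hcon
      push Not at hcon
      have hin : insert Q 𝒮 ∈ Ω := by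
        refine Finset.mem_filter.2 ⟨Finset.mem_powerset.2 ?_, ?_⟩
        · intro P hP
          rcases Finset.mem_insert.1 hP with rfl | hP
          · exact (hmem _).2 ⟨⟨hQG, hQ1⟩, hQ2⟩
          · exact h1' hP
        · intro P hP P' hP' hPP
          rcases Finset.mem_insert.1 hP with e | hP1 <;>
            rcases Finset.mem_insert.1 hP' with e' | hP1'
          · exact absurd (e.trans e'.symm) hPP
          · rw [e]; exact hcon P' hP1'
          · rw [e', Finset.inter_comm]; exact hcon P hP1
          · exact h2 P hP1 P' hP1' hPP
      have := hmax _ hin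
      rw [Finset.card_insert_of_notMem hQS] at this
      omega
    obtain ⟨P, hP, hPQ⟩ := this
    -- pick sides
    have : ∃ b b', μ / 4 < ((Q.side b ∩ P.side b').card : ℝ) := by
      by_contra hcon
      push Not at hcon
      have hsub : Q.vs ∩ P.vs ⊆ (Q.side true ∩ P.side true ∪ Q.side true ∩ P.side false) ∪
          (Q.side false ∩ P.side true ∪ Q.side false ∩ P.side false) := by
        intro z
        simp only [Spot.vs, Finset.mem_inter, Finset.mem_union]
        tauto
      have e1 := (Finset.card_le_card hsub).trans ((Finset.card_union_le _ _).trans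
        (Nat.add_le_add (Finset.card_union_le _ _) (Finset.card_union_le _ _)))
      have e2 : ((Q.vs ∩ P.vs).card : ℝ) ≤ (((Q.side true ∩ P.side true).card : ℝ) +
        (Q.side true ∩ P.side false).card) + ((Q.side false ∩ P.side true).card +
        (Q.side false ∩ P.side false).card) := by exact_mod_cast e1
      have := hcon true true
      have := hcon true false
      have := hcon false true
      have := hcon false false
      linarith
    obtain ⟨b, b', hbb⟩ := this
    set Y := Q.side b ∩ P.side b' with hY
    set F := Lf G kd 𝒮 with hF
    have hMs : ((Q.M (!b)).card : ℝ) ≤ Q.s := by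
      have := (Finset.card_le_card (Finset.subset_union_left (s₁ := Q.M (!b)) (s₂ := Q.R (!b)))).trans
        (hQ.card_side (!b))
      exact_mod_cast this
    have hz : ∃ z ∈ Q.M (!b), kd ≤ ((nbr F Y z).card : ℝ) := by
      by_contra hcon
      push Not at hcon
      have e1 : (Y.card : ℝ) * (τ * Q.s) ≤ ec F Y (Q.M (!b)) := by
        rw [ec_cast, ← nsmul_eq_mul]
        apply Finset.card_nsmul_le_sum
        intro y hy
        exact hQ.degM b y (Finset.mem_inter.1 hy).1
      have e2 : (ec F Y (Q.M (!b)) : ℝ) ≤ (Q.M (!b)).card * kd := by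
        rw [ec_comm, ec_cast, ← nsmul_eq_mul]
        apply Finset.sum_le_card_nsmul
        intro z hz
        exact (hcon z hz).le
      have e3 : ((Q.M (!b)).card : ℝ) * kd ≤ Q.s * kd := mul_le_mul_of_nonneg_right hMs hkd0.le
      have e4 : μ / 4 * (τ * Q.s) < Y.card * (τ * Q.s) :=
        mul_lt_mul_of_pos_right hbb (by positivity)
      rw [hkd] at e2 e3
      nlinarith
    obtain ⟨z, hz1, hz2⟩ := hz
    have hzD : z ∈ P.D G kd := by
      refine Finset.mem_filter.2 ⟨Finset.mem_univ _, b', hz2.trans ?_⟩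
      have e1 : nbr F Y z ⊆ nbr G (P.side b') z :=
        (nbr_mono_graph (Lf_le G kd 𝒮) _ _).trans (nbr_mono _ Finset.inter_subset_right _)
      exact_mod_cast Finset.card_le_card e1
    have hpos : 0 < (nbr F Y z).card := by
      have : 0 < ((nbr F Y z).card : ℝ) := lt_of_lt_of_le hkd0 hz2
      exact_mod_cast this
    obtain ⟨y, hy⟩ := Finset.card_pos.1 hpos
    obtain ⟨hy1, hy2⟩ := mem_nbr.1 hy
    exact (hy2.2 P hP).2 ⟨vs_side _ _ (Finset.mem_inter.1 hy1).2, hzD⟩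

theorem classes_aux {V : Type} [Fintype V] (G : SimpleGraph V) (kd : ℝ) (N2 : ℕ) :
    ∀ (m : ℕ) (X : Finset (Spot V)), X.card ≤ m →
    ∃ 𝒦 : Finset (Finset (Spot V)), (∀ J ∈ 𝒦, Grown G kd N2 J ∧ J ⊆ X) ∧
      (∀ P ∈ X, ∃ J ∈ 𝒦, P ∈ J) ∧
      ∀ J ∈ 𝒦, ∀ J' ∈ 𝒦, J ≠ J' → ∀ P ∈ J, ∀ Q ∈ J', (P.D G kd ∩ Q.D G kd).card < N2 := by
  intro m
  induction m with
  | zero =>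
    intro X hX
    have : X = ∅ := Finset.card_eq_zero.1 (by omega)
    subst this
    exact ⟨∅, by simp, by simp, by simp⟩
  | succ m ih =>
    intro X hX
    rcases X.eq_empty_or_nonempty with rfl | ⟨P0, hP0⟩
    · exact ⟨∅, by simp, by simp, by simp⟩
    obtain ⟨J, hJ, hmax⟩ := Finset.exists_max_image (X.powerset.filter (Grown G kd N2)) Finset.card
      ⟨{P0}, Finset.mem_filter.2 ⟨by simpa using hP0, Grown.single P0⟩⟩
    obtain ⟨hJ1, hJ2⟩ := Finset.mem_filter.1 hJ
    have hJX := Finset.mem_powerset.1 hJ1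
    have hcross : ∀ P ∈ J, ∀ Q ∈ X, Q ∉ J → (P.D G kd ∩ Q.D G kd).card < N2 := by
      intro P hP Q hQ hQJ
      by_contra hcon
      push Not at hcon
      have := hmax (insert Q J) (Finset.mem_filter.2 ⟨Finset.mem_powerset.2
        (Finset.insert_subset hQ hJX), Grown.grow J P Q hJ2 hP hQJ hcon⟩)
      rw [Finset.card_insert_of_notMem hQJ] at this
      omega
    have hJpos := (grown_nonempty hJ2).card_pos
    obtain ⟨𝒦, k1, k2, k3⟩ := ih (X \ J) (by
      rw [Finset.card_sdiff_of_subset hJX]; omega)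
    refine ⟨insert J 𝒦, ?_, ?_, ?_⟩
    · intro J' hJ'
      rcases Finset.mem_insert.1 hJ' with rfl | hJ'
      · exact ⟨hJ2, hJX⟩
      · exact ⟨(k1 J' hJ').1, (k1 J' hJ').2.trans Finset.sdiff_subset⟩
    · intro P hP
      by_cases hPJ : P ∈ J
      · exact ⟨J, Finset.mem_insert_self _ _, hPJ⟩
      · obtain ⟨J', hJ', hPJ'⟩ := k2 P (Finset.mem_sdiff.2 ⟨hP, hPJ⟩)
        exact ⟨J', Finset.mem_insert_of_mem hJ', hPJ'⟩
    · intro J1 hJ1 J2 hJ2 hne P hP Q hQ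
      rcases Finset.mem_insert.1 hJ1 with h1 | hJ1 <;>
        rcases Finset.mem_insert.1 hJ2 with h2 | hJ2
      · exact absurd (h1.trans h2.symm) hne
      · have := Finset.mem_sdiff.1 ((k1 J2 hJ2).2 hQ)
        exact hcross P (h1 ▸ hP) Q this.1 this.2
      · have := Finset.mem_sdiff.1 ((k1 J1 hJ1).2 hP)
        rw [Finset.inter_comm]
        exact hcross Q (h2 ▸ hQ) P this.1 this.2
      · exact k3 J1 hJ1 J2 hJ2 hne P hP Q hQ

theorem prune {ι V : Type} [Inhabited ι] (D : ι → Finset V) (Θ : ℝ) :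
    ∀ (m : ℕ) (𝒦 : Finset ι), 𝒦.card ≤ m →
    (∃ 𝓕 ⊆ 𝒦, 𝓕.Nonempty ∧ ∀ c ∈ 𝓕, Θ < ((D c ∩ (𝓕.erase c).biUnion D).card : ℝ)) ∨
    ∃ own : V → ι, ∀ c ∈ 𝒦, (((D c).filter (fun v => own v ≠ c)).card : ℝ) ≤ Θ := by
  intro m
  induction m with
  | zero =>
    intro 𝒦 h
    have : 𝒦 = ∅ := Finset.card_eq_zero.1 (by omega)
    subst this
    exact Or.inr ⟨fun _ => default, by simp⟩
  | succ m ih =>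
    intro 𝒦 h
    rcases 𝒦.eq_empty_or_nonempty with rfl | hne
    · exact Or.inr ⟨fun _ => default, by simp⟩
    by_cases hall : ∀ c ∈ 𝒦, Θ < ((D c ∩ (𝒦.erase c).biUnion D).card : ℝ)
    · exact Or.inl ⟨𝒦, Finset.Subset.refl _, hne, hall⟩
    push Not at hall
    obtain ⟨c, hc, hcΘ⟩ := hall
    rcases ih (𝒦.erase c) (by rw [Finset.card_erase_of_mem hc]; omega) with ⟨𝓕, f1, f2⟩ | ⟨own, hown⟩
    · exact Or.inl ⟨𝓕, f1.trans (Finset.erase_subset _ _), f2⟩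
    · refine Or.inr ⟨fun v => if v ∈ (𝒦.erase c).biUnion D then own v else c, ?_⟩
      intro c' hc'
      by_cases hcc : c' = c
      · subst hcc
        refine le_trans ?_ hcΘ
        norm_cast
        apply Finset.card_le_card
        intro v hv
        obtain ⟨h1, h2⟩ := Finset.mem_filter.1 hv
        refine Finset.mem_inter.2 ⟨h1, ?_⟩
        by_contra hcon
        exact h2 (if_neg hcon)
      · have hce : c' ∈ 𝒦.erase c := Finset.mem_erase.2 ⟨hcc, hc'⟩
        refine le_trans (le_of_eq ?_) (hown c' hce)
        congr 2
        apply Finset.filter_congr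
        intro v hv
        show (if v ∈ (𝒦.erase c).biUnion D then own v else c) ≠ c' ↔ own v ≠ c'
        rw [if_pos (Finset.mem_biUnion.2 ⟨c', hce, hv⟩)]

end HS


namespace HS
open scoped Classical

theorem ec_univ {V : Type} [Fintype V] (G : SimpleGraph V) :
    ec G Finset.univ Finset.univ = 2 * G.edgeSet.ncard := by
  have h := G.sum_degrees_eq_twice_card_edges
  rw [Set.ncard_eq_toFinset_card', ← SimpleGraph.edgeFinset.eq_def]
  rw [← h]
  unfold ec
  apply Finset.sum_congr rfl
  intro v _
  unfold SimpleGraph.degree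
  congr 1
  ext z
  rw [mem_nbr, SimpleGraph.mem_neighborFinset]
  simp

theorem final_graph {V : Type} [Fintype V] (G : SimpleGraph V) (kd : ℝ) (𝒮 : Finset (Spot V))
    (𝒦 : Finset (Finset (Spot V))) (hcov : ∀ P ∈ 𝒮, ∃ J ∈ 𝒦, P ∈ J)
    (hvs : ∀ J ∈ 𝒦, ∀ P ∈ J, P.vs ⊆ P.D G kd) (own : V → Finset (Spot V)) (Θ f : ℝ) (hΘ : 0 ≤ Θ)
    (hown : ∀ J ∈ 𝒦, (((DC G kd J).filter (fun v => own v ≠ J)).card : ℝ) ≤ Θ)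
    (hbig : ∀ J ∈ 𝒦, 2 * Θ ≤ (DC G kd J).card) (d : ℕ)
    (hZ : ∀ J ∈ 𝒦, (J.biUnion Spot.vs).card ≤ 3 * d)
    (hF : (ec (Lf G kd 𝒮) Finset.univ Finset.univ : ℝ) ≤ f) :
    ∃ H : SimpleGraph V, H ≤ G ∧
      2 * ((G.edgeSet \ H.edgeSet).ncard : ℝ) ≤ f + 4 * Θ * Fintype.card V ∧
      ∀ c : H.ConnectedComponent, ∃ C : Set V, C ⊆ c.supp ∧ C.ncard ≤ 3 * d ∧
        ∀ x y : V, x ∈ c.supp → H.Adj x y → x ∈ C ∨ y ∈ C := by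
  let H : SimpleGraph V :=
    { Adj := fun u v => G.Adj u v ∧ own u = own v ∧ own u ∈ 𝒦 ∧
        (u ∈ (own u).biUnion Spot.vs ∨ v ∈ (own u).biUnion Spot.vs)
      symm := ⟨fun u v h => ⟨h.1.symm, h.2.1.symm, h.2.1 ▸ h.2.2.1, h.2.1 ▸ h.2.2.2.symm⟩⟩
      loopless := ⟨fun u h => G.loopless.irrefl u h.1⟩ }
  refine ⟨H, fun u v h => h.1, ?_, ?_⟩
  · rw [← SimpleGraph.edgeSet_sdiff]
    have h1 : (2 : ℝ) * ((G \ H).edgeSet.ncard : ℝ) = ec (G \ H) Finset.univ Finset.univ := by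
      rw [ec_univ]; push_cast; ring
    rw [h1]
    let B : Finset (Spot V) → V → Finset V := fun J v =>
      if v ∈ DC G kd J then ((DC G kd J).filter (fun v => own v ≠ J)) ∪
        (if own v ≠ J then DC G kd J else ∅) else ∅
    have hsub : ∀ v, nbr (G \ H) Finset.univ v ⊆ nbr (Lf G kd 𝒮) Finset.univ v ∪
        𝒦.biUnion (fun J => B J v) := by
      intro v z hz
      have hz2 := (mem_nbr.1 hz).2
      rw [SimpleGraph.sdiff_adj] at hz2
      by_cases hL : (Lf G kd 𝒮).Adj v z
      · exact Finset.mem_union_left _ (mem_nbr.2 ⟨Finset.mem_univ _, hL⟩)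
      · apply Finset.mem_union_right
        have : ∃ P ∈ 𝒮, (v ∈ P.vs ∧ z ∈ P.D G kd) ∨ (z ∈ P.vs ∧ v ∈ P.D G kd) := by
          by_contra hcon
          push Not at hcon
          exact hL ⟨hz2.1, fun P hP => ⟨fun h => (hcon P hP).1 h.1 h.2, fun h => (hcon P hP).2 h.1 h.2⟩⟩
        obtain ⟨P, hP, hPvz⟩ := this
        obtain ⟨J, hJ, hPJ⟩ := hcov P hP
        have hDJ : P.D G kd ⊆ DC G kd J := Finset.subset_biUnion_of_mem (fun P => P.D G kd) hPJ
        have hvJ : P.vs ⊆ J.biUnion Spot.vs := Finset.subset_biUnion_of_mem Spot.vs hPJ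
        have hv : v ∈ DC G kd J := by
          rcases hPvz with h | h
          · exact hDJ (hvs J hJ P hPJ h.1)
          · exact hDJ h.2
        have hzD : z ∈ DC G kd J := by
          rcases hPvz with h | h
          · exact hDJ h.2
          · exact hDJ (hvs J hJ P hPJ h.1)
        refine Finset.mem_biUnion.2 ⟨J, hJ, ?_⟩
        show z ∈ if v ∈ DC G kd J then _ else _
        rw [if_pos hv]
        by_cases ho : own v = J
        · apply Finset.mem_union_left
          refine Finset.mem_filter.2 ⟨hzD, fun hoz => hz2.2 ⟨hz2.1, ho.trans hoz.symm, ho.symm ▸ hJ, ?_⟩⟩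
          rw [ho]
          rcases hPvz with h | h
          · exact Or.inl (hvJ h.1)
          · exact Or.inr (hvJ h.1)
        · apply Finset.mem_union_right
          rw [if_pos ho]
          exact hzD
    have hsum : (ec (G \ H) Finset.univ Finset.univ : ℝ) ≤ ec (Lf G kd 𝒮) Finset.univ Finset.univ +
        ∑ J ∈ 𝒦, ∑ v, ((B J v).card : ℝ) := by
      rw [Finset.sum_comm, ec_cast, ec_cast, ← Finset.sum_add_distrib]
      apply Finset.sum_le_sum
      intro v _
      have := (Finset.card_le_card (hsub v)).trans ((Finset.card_union_le _ _).trans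
        (Nat.add_le_add_left Finset.card_biUnion_le _))
      exact_mod_cast this
    have hB : ∀ J ∈ 𝒦, ∑ v, ((B J v).card : ℝ) ≤
        4 * Θ * ((Finset.univ.filter (fun v => own v = J)).card : ℝ) := by
      intro J hJ
      set Dj := DC G kd J with hDj
      have e1 : ∑ v, ((B J v).card : ℝ) ≤ ∑ v ∈ Dj, (Θ + if own v ≠ J then (Dj.card : ℝ) else 0) := by
        rw [← Finset.sum_filter_add_sum_filter_not Finset.univ (fun v => v ∈ Dj)]
        have z1 : ∑ v ∈ Finset.univ.filter (fun v => ¬ v ∈ Dj), ((B J v).card : ℝ) = 0 := by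
          apply Finset.sum_eq_zero
          intro v hv
          have : B J v = ∅ := if_neg (Finset.mem_filter.1 hv).2
          rw [this]; simp
        rw [z1, add_zero]
        have z2 : Finset.univ.filter (fun v => v ∈ Dj) = Dj := by ext; simp
        rw [z2]
        apply Finset.sum_le_sum
        intro v hv
        have z3 : B J v = (Dj.filter (fun v => own v ≠ J)) ∪ (if own v ≠ J then Dj else ∅) :=
          if_pos hv
        rw [z3]
        have z4 : (((Dj.filter (fun v => own v ≠ J)) ∪ (if own v ≠ J then Dj else ∅)).card : ℝ) ≤
            ((Dj.filter (fun v => own v ≠ J)).card : ℝ) + ((if own v ≠ J then Dj else ∅) : Finset V).card := by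
          exact_mod_cast Finset.card_union_le _ _
        refine z4.trans (add_le_add (hown J hJ) ?_)
        by_cases ho : own v = J <;> simp [ho]
      have e2 : ∑ v ∈ Dj, (Θ + if own v ≠ J then (Dj.card : ℝ) else 0) =
          Dj.card * Θ + ((Dj.filter (fun v => own v ≠ J)).card : ℝ) * Dj.card := by
        rw [Finset.sum_add_distrib, ← Finset.sum_filter, Finset.sum_const, Finset.sum_const,
          nsmul_eq_mul, nsmul_eq_mul]
      have e3 := hown J hJ
      have e4 := hbig J hJ
      have e5 : (Dj.card : ℝ) = ((Dj.filter (fun v => own v = J)).card : ℝ) +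
          ((Dj.filter (fun v => own v ≠ J)).card : ℝ) := by
        have := Finset.card_filter_add_card_filter_not (s := Dj) (fun v => own v = J)
        exact_mod_cast this.symm
      have e6 : ((Dj.filter (fun v => own v = J)).card : ℝ) ≤
          ((Finset.univ.filter (fun v => own v = J)).card : ℝ) := by
        exact_mod_cast Finset.card_le_card (Finset.filter_subset_filter _ (Finset.subset_univ _))
      have e7 : (0 : ℝ) ≤ Dj.card := by positivity
      rw [e2] at e1
      have e8 : ((Dj.filter (fun v => own v ≠ J)).card : ℝ) * Dj.card ≤ Θ * Dj.card :=
        mul_le_mul_of_nonneg_right e3 e7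
      have e9 : (Dj.card : ℝ) ≤ 2 * ((Finset.univ.filter (fun v => own v = J)).card : ℝ) := by
        linarith
      have e10 := mul_le_mul_of_nonneg_left e9 hΘ
      linarith
    have hsum2 : ∑ J ∈ 𝒦, ((Finset.univ.filter (fun v => own v = J)).card : ℝ) ≤ Fintype.card V := by
      have : ∑ J ∈ 𝒦, (Finset.univ.filter (fun v => own v = J)).card =
          (𝒦.biUnion (fun J => Finset.univ.filter (fun v => own v = J))).card := by
        rw [Finset.card_biUnion]
        intro J _ J' _ hne
        show Disjoint (Finset.univ.filter (fun v => own v = J)) (Finset.univ.filter (fun v => own v = J'))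
        rw [Finset.disjoint_left]
        intro v hv hv'
        exact hne ((Finset.mem_filter.1 hv).2.symm.trans (Finset.mem_filter.1 hv').2)
      have h2 := Finset.card_le_univ (𝒦.biUnion (fun J => Finset.univ.filter (fun v => own v = J)))
      rw [← this] at h2
      exact_mod_cast h2
    have hsum3 := Finset.sum_le_sum hB
    rw [← Finset.mul_sum] at hsum3
    have := mul_le_mul_of_nonneg_left hsum2 (show 0 ≤ 4 * Θ by linarith)
    linarith
  · intro c
    obtain ⟨x0, hx0⟩ := c.exists_rep
    change H.connectedComponentMk x0 = c at hx0
    subst hx0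
    have hreach : ∀ x y, H.Reachable x y → own x = own y := by
      rintro x y ⟨w⟩
      induction w with
      | nil => rfl
      | cons hadj _ ih => exact hadj.2.1.trans ih
    refine ⟨{x | x ∈ (H.connectedComponentMk x0).supp ∧ own x0 ∈ 𝒦 ∧ x ∈ (own x0).biUnion Spot.vs},
      fun x hx => hx.1, ?_, ?_⟩
    · by_cases h0 : own x0 ∈ 𝒦
      · refine le_trans ?_ (hZ _ h0)
        rw [← Set.ncard_coe_finset]
        apply Set.ncard_le_ncard _ (Finset.finite_toSet _)
        intro x hx
        exact hx.2.2
      · have : {x | x ∈ (H.connectedComponentMk x0).supp ∧ own x0 ∈ 𝒦 ∧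
            x ∈ (own x0).biUnion Spot.vs} = (∅ : Set V) := by
          ext x; simp [h0]
        rw [this]; simp
    · intro x y hx hxy
      have hxo : own x = own x0 := hreach _ _ (SimpleGraph.ConnectedComponent.exact hx)
      have hy : y ∈ (H.connectedComponentMk x0).supp := by
        rw [SimpleGraph.ConnectedComponent.mem_supp_iff] at hx ⊢
        rw [← hx]
        exact SimpleGraph.ConnectedComponent.sound hxy.symm.reachable
      have h3 := hxy.2.2
      rw [hxo] at h3
      rcases h3.2 with h4 | h4
      · exact Or.inl ⟨hx, h3.1, h4⟩
      · exact Or.inr ⟨hy, h3.1, h4⟩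

end HS

namespace HS
open scoped Classical

theorem Emb.mono {V : Type} {F G : SimpleGraph V} (h : F ≤ G) {N : ℕ} {p : ℕ → ℕ}
    (hF : Emb N p F) : Emb N p G := by
  obtain ⟨f, h1, h2⟩ := hF
  exact ⟨f, h1, fun k hk hkN => h (h2 k hk hkN)⟩

theorem grown_small {V : Type} [Fintype V] (G : SimpleGraph V) {τ η p0 kd : ℝ}
    {d N0 M0 M0' s' : ℕ}
    (hr : RParam τ η p0 kd d N0 M0 M0' s') (hkN : (N0 : ℝ) ≤ kd)
    (hτ1 : τ ≤ 1 / 20) (Δ : ℕ) (hΔ1 : 1 ≤ Δ) (hητ : 8 * Δ * η ≤ τ)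
    (hsm : 4 * (Δ : ℝ) ≤ τ * s')
    (p : ℕ → ℕ) (hp : ∀ k, 0 < k → p k < k)
    (hΔ : ∀ j, ((Finset.range (d + 1)).filter (fun k => 0 < k ∧ p k = j)).card ≤ Δ)
    (hfree : ¬ Emb (d + 1) p G)
    (Bd C : ℕ) (cu : Cut (d + 1) p Δ Bd C) (𝒮 : Finset (Spot V))
    (hsp : ∀ P ∈ 𝒮, IsSpot G τ η p0 P ∧ (s' : ℝ) ≤ P.s ∧ P.s ≤ d)
    (μ : ℝ) (hμ : ∀ P ∈ 𝒮, ∀ Q ∈ 𝒮, P ≠ Q → ((P.vs ∩ Q.vs).card : ℝ) ≤ μ) (hμ0 : 0 ≤ μ)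
    (K : ℕ) (hKs : 3 * d ≤ 2 * (K * s'))
    (hrem : K * μ + ((K * (M0 + 2 * M0' + 2 * (M0 * N0)) : ℕ) : ℝ) ≤ τ * s' / 2)
    (hlight : C * (7 * K + 1) * Δ ^ (7 * K) < N0)
    (hcap : 8 + 8 * (K * Bd) + 6 * K ≤ d)
    (J : Finset (Spot V)) (hJ : Grown G kd (4 * M0) J) :
    J ⊆ 𝒮 → 2 * (∑ P ∈ J, P.s) < 3 * d ∧ J.card < K := by
  have hcard : ∀ J : Finset (Spot V), J ⊆ 𝒮 → 2 * (∑ P ∈ J, P.s) < 3 * d → J.card < K := by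
    intro J hJS h
    have h1 : J.card * s' ≤ ∑ P ∈ J, P.s := by
      rw [← smul_eq_mul]
      apply Finset.card_nsmul_le_sum
      intro P hP
      exact_mod_cast (hsp P (hJS hP)).2.1
    by_contra hc
    push Not at hc
    have h2 : K * s' ≤ J.card * s' := Nat.mul_le_mul_right _ hc
    omega
  induction hJ with
  | single P =>
    intro hJS
    have h1 := (hsp P (hJS (by simp))).2.2
    have h2 := hr.hd
    have h3 : 2 * (∑ P ∈ {P}, P.s) < 3 * d := by
      rw [Finset.sum_singleton]; omega
    exact ⟨h3, hcard _ hJS h3⟩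
  | grow J P Q hJ hP hQ hN ih =>
    intro hJS
    obtain ⟨ih1, ih2⟩ := ih ((Finset.subset_insert _ _).trans hJS)
    have h3 : 2 * (∑ P ∈ insert Q J, P.s) < 3 * d := by
      by_contra hbig
      push Not at hbig
      apply hfree
      have hc : (insert Q J).card ≤ K := by
        rw [Finset.card_insert_of_notMem hQ]; omega
      refine e3 G hr hkN hτ1 Δ hΔ1 hητ hsm (d + 1) p hp hΔ Bd C cu (insert Q J)
        (Grown.grow J P Q hJ hP hQ hN) (fun P hP => hsp P (hJS hP)) μ
        (fun P hP Q hQ => hμ P (hJS hP) Q (hJS hQ)) hμ0 ?_ ?_ ?_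
      · refine le_trans (add_le_add ?_ ?_) hrem
        · exact mul_le_mul_of_nonneg_right (by exact_mod_cast hc) hμ0
        · exact_mod_cast Nat.mul_le_mul_right _ hc
      · refine lt_of_le_of_lt ?_ hlight
        refine Nat.mul_le_mul (Nat.mul_le_mul_left _ (by omega)) (Nat.pow_le_pow_right hΔ1 (by omega))
      · have h5 : (insert Q J).card * Bd ≤ K * Bd := Nat.mul_le_mul_right _ hc
        have h6 : 3 * ∑ P ∈ insert Q J, P.s ≤ ∑ P ∈ insert Q J, (4 * (3 * P.s / 4) + 3) := by
          rw [Finset.mul_sum]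
          apply Finset.sum_le_sum
          intro P _
          omega
        rw [Finset.sum_add_distrib, ← Finset.mul_sum, Finset.sum_const, smul_eq_mul] at h6
        omega
    exact ⟨h3, hcard _ hJS h3⟩

theorem core {V : Type} [Fintype V] (G : SimpleGraph V) (d : ℕ) (p : ℕ → ℕ)
    (hp : ∀ k, 0 < k → p k < k) (Δ : ℕ)
    (hΔ : ∀ j, ((Finset.range (d + 1)).filter (fun k => 0 < k ∧ p k = j)).card ≤ Δ)
    (hΔ1 : 1 ≤ Δ) (hfree : ¬ Emb (d + 1) p G) (δ : ℝ) (hδ : 0 < δ) (hδ1 : δ ≤ 1)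
    (q M s' m1 : ℕ) (hq : 640 ≤ δ * q) (hM : 1 < δ / 4 * (1 + 1 / (2 * (q : ℝ) ^ 2)) ^ M)
    (hs' : 1 ≤ s') (hsm : s' * q ^ M ≤ m1) (hm1 : 4 * Δ * (m1 : ℝ) ≤ δ * d) (hd2 : 2 ≤ δ * d)
    (kd μ : ℝ) (N0 M0 M0' : ℕ)
    (hr : RParam (δ / 160) (1 / q) (δ / 8) kd d N0 M0 M0' s')
    (hητ : 8 * Δ * (1 / (q : ℝ)) ≤ δ / 160) (hsτ : 4 * (Δ : ℝ) ≤ δ / 160 * s')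
    (Bd C : ℕ) (cu : Cut (d + 1) p Δ Bd C)
    (hμ : 0 < μ) (hkd : kd = δ / 160 * μ / 4) (hkτ : kd ≤ δ / 160 * s')
    (K : ℕ) (hKs : 3 * d ≤ 2 * (K * s'))
    (hcap : 8 + 8 * (K * Bd) + 6 * K ≤ d) (hcap2 : (Bd : ℝ) ≤ 3 / 4 * s')
    (N3 M1 n nm : ℕ) (hN3 : N3 = K * (K * (4 * M0))) (hM1 : M1 = K * (2 * M0)) (hM11 : 1 ≤ M1)
    (hn : n = heapB M1 C) (hnm : nm = heapB M1 (C + 1)) (hn1 : 1 ≤ n)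
    (hrem : K * μ + ((n * (K * (M0 + 2 * M0' + 2 * (M0 * N0)) + M0') + n * N0 + (nm + 1) +
      n * N3 : ℕ) : ℝ) ≤ δ / 160 * s' / 2)
    (hkN : (N0 : ℝ) + nm ≤ kd)
    (hlight : C * (7 * K + 6 + 2) * Δ ^ (7 * K + 6 + 1) < N0)
    (Θ : ℝ) (hΘ : ((nm * (N3 + 1) : ℕ) : ℝ) ≤ Θ) (hΘs : 2 * Θ ≤ 17 / 20 * s') :
    ∃ H : SimpleGraph V, H ≤ G ∧
      2 * ((G.edgeSet \ H.edgeSet).ncard : ℝ) ≤ 2 * (δ * d) * Fintype.card V +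
        4 * Θ * Fintype.card V ∧
      ∀ c : H.ConnectedComponent, ∃ C : Set V, C ⊆ c.supp ∧ C.ncard ≤ 3 * d ∧
        ∀ x y : V, x ∈ c.supp → H.Adj x y → x ∈ C ∨ y ∈ C := by
  have hτ1 : δ / 160 ≤ 1 / 20 := by linarith
  obtain ⟨𝒮, hS1, hS2, hS3⟩ := exists_family (η := 1 / (q : ℝ)) (p0 := δ / 8) G d hr.hτ hr.hsm hμ
    hkd hkτ
  have hF : (ec (Lf G kd 𝒮) Finset.univ Finset.univ : ℝ) ≤ 2 * (δ * d) * Fintype.card V := by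
    by_contra hcon
    push Not at hcon
    obtain ⟨P, hP, h1, h2⟩ := exists_spot (Lf G kd 𝒮) d p hp Δ hΔ hΔ1
      (fun h => hfree (h.mono (Lf_le G kd 𝒮))) δ hδ hδ1 q M s' m1 hq hM hs' hsm hm1 hd2 hcon
    exact hS3 P hP (by exact_mod_cast h1) h2
  have hrem3 : K * μ + ((K * (M0 + 2 * M0' + 2 * (M0 * N0)) : ℕ) : ℝ) ≤ δ / 160 * s' / 2 := by
    refine le_trans (add_le_add le_rfl ?_) hrem
    have h1 : 1 * (K * (M0 + 2 * M0' + 2 * (M0 * N0))) ≤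
        n * (K * (M0 + 2 * M0' + 2 * (M0 * N0)) + M0') :=
      Nat.mul_le_mul hn1 (by omega)
    have h2 : K * (M0 + 2 * M0' + 2 * (M0 * N0)) ≤
        n * (K * (M0 + 2 * M0' + 2 * (M0 * N0)) + M0') + n * N0 + (nm + 1) + n * N3 := by
      rw [one_mul] at h1
      exact h1.trans (((Nat.le_add_right _ _).trans (Nat.le_add_right _ _)).trans (Nat.le_add_right _ _))
    exact_mod_cast h2
  have hlight3 : C * (7 * K + 1) * Δ ^ (7 * K) < N0 :=
    lt_of_le_of_lt (Nat.mul_le_mul (Nat.mul_le_mul_left _ (by omega))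
      (Nat.pow_le_pow_right hΔ1 (by omega))) hlight
  have hkN3 : (N0 : ℝ) ≤ kd := le_trans (by linarith [Nat.cast_nonneg (α := ℝ) nm]) hkN
  have hgs := grown_small G hr hkN3 hτ1 Δ hΔ1 hητ hsτ p hp hΔ hfree Bd C cu 𝒮 hS1 μ hS2 hμ.le K
    hKs hrem3 hlight3 hcap
  obtain ⟨𝒦, hK1, hK2, hK3⟩ := classes_aux G kd (4 * M0) 𝒮.card 𝒮 le_rfl
  have hcross : ∀ J ∈ 𝒦, ∀ J' ∈ 𝒦, J ≠ J' → (DC G kd J ∩ DC G kd J').card ≤ N3 := by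
    intro J hJ J' hJ' hne
    have h1 : DC G kd J ∩ DC G kd J' ⊆
        J.biUnion (fun P => J'.biUnion (fun Q => P.D G kd ∩ Q.D G kd)) := by
      intro v hv
      obtain ⟨ha, hb⟩ := Finset.mem_inter.1 hv
      obtain ⟨P, hP, hPv⟩ := Finset.mem_biUnion.1 ha
      obtain ⟨Q, hQ, hQv⟩ := Finset.mem_biUnion.1 hb
      exact Finset.mem_biUnion.2 ⟨P, hP, Finset.mem_biUnion.2 ⟨Q, hQ, Finset.mem_inter.2 ⟨hPv, hQv⟩⟩⟩
    have h2 : ∀ P ∈ J, (J'.biUnion (fun Q => P.D G kd ∩ Q.D G kd)).card ≤ K * (4 * M0) := by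
      intro P hP
      refine (Finset.card_biUnion_le_card_mul _ _ (4 * M0)
        (fun Q hQ => (hK3 J hJ J' hJ' hne P hP Q hQ).le)).trans ?_
      exact Nat.mul_le_mul_right _ (hgs J' (hK1 J' hJ').1 (hK1 J' hJ').2).2.le
    refine (Finset.card_le_card h1).trans ((Finset.card_biUnion_le_card_mul _ _ _ h2).trans ?_)
    rw [hN3]
    exact Nat.mul_le_mul_right _ (hgs J (hK1 J hJ).1 (hK1 J hJ).2).2.le
  have : Inhabited (Finset (Spot V)) := ⟨∅⟩
  rcases prune (DC G kd) Θ 𝒦.card 𝒦 le_rfl with ⟨𝓕, h1, h2, h3⟩ | ⟨own, hown⟩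
  · exfalso
    apply hfree
    refine e2 G hr hτ1 Δ hΔ1 hητ hsτ (d + 1) p hp hΔ Bd C cu 𝓕 h2 (fun J hJ => (hK1 J (h1 hJ)).1)
      K (fun J hJ => (hgs J (hK1 J (h1 hJ)).1 (hK1 J (h1 hJ)).2).2.le)
      (fun J hJ P hP => hS1 P ((hK1 J (h1 hJ)).2 hP)) hkτ N3
      (fun J hJ J' hJ' => hcross J (h1 hJ) J' (h1 hJ')) μ hμ.le
      (fun J hJ P hP Q hQ => hS2 P ((hK1 J (h1 hJ)).2 hP) Q ((hK1 J (h1 hJ)).2 hQ))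
      M1 (7 * K + 6) n nm hM1 hM11 rfl hn hnm ?_ hrem hkN hlight hcap2
    intro J hJ
    have h4 := lt_of_le_of_lt hΘ (h3 J hJ)
    have h5 := Nat.cast_lt.1 h4
    convert h5
  · have hvs : ∀ P ∈ 𝒮, P.vs ⊆ P.D G kd := by
      intro P hP
      refine vs_sub_D G P (hS1 P hP).1 (hkτ.trans ?_)
      exact mul_le_mul_of_nonneg_left (hS1 P hP).2.1 hr.hτ.le
    refine final_graph G kd 𝒮 𝒦 hK2 (fun J hJ P hP => hvs P ((hK1 J hJ).2 hP)) own Θ _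
      (le_trans (by positivity) hΘ) ?_ ?_ d ?_ hF
    · intro J hJ
      convert hown J hJ
    · intro J hJ
      obtain ⟨P, hP⟩ := grown_nonempty (hK1 J hJ).1
      have hPS := (hK1 J hJ).2 hP
      have e1 : P.M true ⊆ DC G kd J := by
        intro v hv
        refine Finset.mem_biUnion.2 ⟨P, hP, hvs P hPS ?_⟩
        exact Finset.mem_union_left _ (Finset.mem_union_left _ hv)
      have e2 : ((P.M true).card : ℝ) ≤ (DC G kd J).card := by
        exact_mod_cast Finset.card_le_card e1
      have e3 := (hS1 P hPS).1.card_M true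
      have e4 := (hS1 P hPS).2.1
      linarith
    · intro J hJ
      have e1 := (hgs J (hK1 J hJ).1 (hK1 J hJ).2).1
      have e2 : (J.biUnion Spot.vs).card ≤ ∑ P ∈ J, 2 * P.s := by
        refine Finset.card_biUnion_le.trans (Finset.sum_le_sum ?_)
        intro P hP
        have e3 := (hS1 P ((hK1 J hJ).2 hP)).1.card_side
        have e4 := Finset.card_union_le (P.side true) (P.side false)
        have e5 := e3 true
        have e6 := e3 false
        unfold Spot.vs
        omega
      rw [← Finset.mul_sum] at e2
      omega

end HS

namespace HS
open scoped Classical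

theorem ev_lin (a b : ℝ) (ha : 0 < a) : ∀ᶠ d : ℕ in Filter.atTop, b ≤ a * (d : ℝ) := by
  have h1 : Filter.Tendsto (fun d : ℕ => a * (d : ℝ)) Filter.atTop Filter.atTop :=
    Filter.Tendsto.const_mul_atTop ha tendsto_natCast_atTop_atTop
  exact h1.eventually_ge_atTop b

theorem ex_nat (a b : ℝ) (ha : 0 < a) : ∃ n : ℕ, b ≤ a * (n : ℝ) ∧ 1 ≤ n := by
  obtain ⟨n, h1, h2⟩ := ((ev_lin a b ha).and (Filter.eventually_ge_atTop 1)).exists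
  exact ⟨n, h1, h2⟩

theorem heapB_pos (M1 e : ℕ) : 1 ≤ heapB M1 e := by
  cases e <;> simp [heapB]

theorem main_aux (ε : ℝ) (hε : 0 < ε) (Δ : ℕ) (hΔ1 : 1 ≤ Δ) :
    ∃ d₀ : ℕ, ∀ d : ℕ, d₀ ≤ d → ∀ p : ℕ → ℕ, (∀ k, 0 < k → p k < k) →
      (∀ j, ((Finset.range (d + 1)).filter (fun k => 0 < k ∧ p k = j)).card ≤ Δ) →
      ∀ (V : Type) [Fintype V], ∀ G : SimpleGraph V, ¬ Emb (d + 1) p G →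
      ∃ H : SimpleGraph V, H ≤ G ∧
      ((G.edgeSet \ H.edgeSet).ncard : ℝ) ≤ ε * (ε * d * Fintype.card V) ∧
      ∀ c : H.ConnectedComponent, ∃ C : Set V, C ⊆ c.supp ∧ C.ncard ≤ 3 * d ∧
        ∀ x y : V, x ∈ c.supp → H.Adj x y → x ∈ C ∨ y ∈ C := by
  have hΔR : (1 : ℝ) ≤ Δ := by exact_mod_cast hΔ1
  obtain ⟨δ, hδ, hδ1, hδε⟩ : ∃ δ : ℝ, 0 < δ ∧ δ ≤ 1 ∧ δ ≤ ε ^ 2 / 2 :=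
    ⟨min 1 (ε ^ 2 / 2), by positivity, min_le_left _ _, min_le_right _ _⟩
  obtain ⟨q, hq, hq1⟩ := ex_nat δ (1280 * Δ) hδ
  have hq0 : (0 : ℝ) < q := by exact_mod_cast hq1
  obtain ⟨M, hM⟩ : ∃ M : ℕ, 1 < δ / 4 * (1 + 1 / (2 * (q : ℝ) ^ 2)) ^ M := by
    obtain ⟨M, hM⟩ := pow_unbounded_of_one_lt (4 / δ)
      (show (1 : ℝ) < 1 + 1 / (2 * (q : ℝ) ^ 2) by
        have : 0 < 1 / (2 * (q : ℝ) ^ 2) := by positivity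
        linarith)
    refine ⟨M, ?_⟩
    rw [div_lt_iff₀ hδ] at hM
    linarith
  obtain ⟨c, hc, hc4⟩ : ∃ c : ℝ, 0 < c ∧ 4 * c * (4 * Δ * (q : ℝ) ^ M) ≤ δ := by
    refine ⟨δ / (16 * Δ * (q : ℝ) ^ M), by positivity, le_of_eq ?_⟩
    have : (q : ℝ) ^ M ≠ 0 := by positivity
    have : (Δ : ℝ) ≠ 0 := by positivity
    field_simp
    ring
  obtain ⟨K, hK, hK1⟩ := ex_nat c (3 / 2) hc
  have hKR : (1 : ℝ) ≤ K := by exact_mod_cast hK1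
  obtain ⟨b, hb, hb1, hb2⟩ : ∃ b : ℝ, 0 < b ∧ Δ * b ≤ c / 4 ∧ 16 * K * (Δ * b) ≤ 1 := by
    refine ⟨min (c / 4) (1 / (16 * K)) / Δ, by positivity, ?_, ?_⟩
    · rw [mul_div_cancel₀ _ (by positivity)]; exact min_le_left _ _
    · rw [mul_div_cancel₀ _ (by positivity)]
      calc 16 * (K : ℝ) * min (c / 4) (1 / (16 * K)) ≤ 16 * K * (1 / (16 * K)) :=
            mul_le_mul_of_nonneg_left (min_le_right _ _) (by positivity)
        _ = 1 := by field_simp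
  obtain ⟨C', hC', hC'1⟩ := ex_nat b 4 hb
  obtain ⟨N0, hN0, hN01⟩ : ∃ N0 : ℕ, (C' + 1) * (7 * K + 6 + 2) * Δ ^ (7 * K + 6 + 1) < N0 ∧ 1 ≤ N0 :=
    ⟨_, Nat.lt_succ_self _, by omega⟩
  have hN0R : (1 : ℝ) ≤ N0 := by exact_mod_cast hN01
  obtain ⟨μ0, hμ0, hμ1, hμ2⟩ : ∃ μ0 : ℝ, 0 < μ0 ∧ K * μ0 ≤ δ / 160 * c / 4 ∧ μ0 ≤ c := by
    refine ⟨min (δ / 160 * c / 4 / K) c, by positivity, ?_, min_le_right _ _⟩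
    calc (K : ℝ) * min (δ / 160 * c / 4 / K) c ≤ K * (δ / 160 * c / 4 / K) :=
          mul_le_mul_of_nonneg_left (min_le_left _ _) (by positivity)
      _ = δ / 160 * c / 4 := by field_simp
  obtain ⟨κ, hκd⟩ : ∃ κ : ℝ, κ = δ / 160 * μ0 / 4 := ⟨_, rfl⟩
  have hκ : 0 < κ := by rw [hκd]; positivity
  obtain ⟨M0, hM0, hM01⟩ := ex_nat κ (2 * N0) hκ
  obtain ⟨M0', hM0', -⟩ := ex_nat (δ / 160) (2 * N0) (by positivity)
  obtain ⟨N3, hN3⟩ : ∃ N3, N3 = K * (K * (4 * M0)) := ⟨_, rfl⟩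
  obtain ⟨M1, hM1⟩ : ∃ M1, M1 = K * (2 * M0) := ⟨_, rfl⟩
  have hM11 : 1 ≤ M1 := by
    rw [hM1]; exact Nat.mul_pos (by omega) (by omega)
  obtain ⟨n, hn⟩ : ∃ n, n = heapB M1 (C' + 1) := ⟨_, rfl⟩
  obtain ⟨nm, hnm⟩ : ∃ nm, nm = heapB M1 (C' + 1 + 1) := ⟨_, rfl⟩
  obtain ⟨θ, hθ, hθ1, hθ2⟩ : ∃ θ : ℝ, 0 < θ ∧ θ ≤ ε ^ 2 / 4 ∧ 2 * θ ≤ 17 / 20 * c :=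
    ⟨min (ε ^ 2 / 4) (17 / 40 * c), by positivity, min_le_left _ _, by
      have := min_le_right (ε ^ 2 / 4) (17 / 40 * c)
      linarith⟩
  obtain ⟨X, hX⟩ : ∃ X : ℕ, X = n * (K * (M0 + 2 * M0' + 2 * (M0 * N0)) + M0') + n * N0 + (nm + 1) +
      n * N3 := ⟨_, rfl⟩
  have hall : ∀ᶠ d : ℕ in Filter.atTop, 2 ≤ c * (d : ℝ) ∧ 2 ≤ b * (d : ℝ) ∧ 2 ≤ δ * (d : ℝ) ∧
      (16 + 28 * K : ℝ) ≤ 1 * (d : ℝ) ∧ 2 * (M0' : ℝ) ≤ κ * (d : ℝ) ∧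
      (2 * N0 + 1 : ℝ) ≤ (δ / 8 * (δ / 160 * c)) * (d : ℝ) ∧
      (4 * Δ : ℝ) ≤ (δ / 160 * c) * (d : ℝ) ∧ (X : ℝ) ≤ (δ / 160 * c / 4) * (d : ℝ) ∧
      (N0 + nm : ℝ) ≤ κ * (d : ℝ) ∧ ((nm * (N3 + 1) : ℕ) : ℝ) ≤ θ * (d : ℝ) := by
    refine (ev_lin _ _ hc).and ((ev_lin _ _ hb).and ((ev_lin _ _ hδ).and
      ((ev_lin _ _ one_pos).and ((ev_lin _ _ hκ).and ((ev_lin _ _ (by positivity)).and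
      ((ev_lin _ _ (by positivity)).and ((ev_lin _ _ (by positivity)).and
      ((ev_lin _ _ hκ).and (ev_lin _ _ hθ)))))))))
  obtain ⟨d₀, hd₀⟩ := Filter.eventually_atTop.1 hall
  refine ⟨d₀, ?_⟩
  intro d hd p hp hΔ V _ G hfree
  obtain ⟨a1, a2, a3, a4, a5, a6, a7, a8, a9, a10⟩ := hd₀ d hd
  clear hall hd₀
  have hdR : (1 : ℝ) ≤ d := by linarith
  have hd1 : 1 ≤ d := by exact_mod_cast hdR
  obtain ⟨s', hs'⟩ : ∃ s' : ℕ, s' = ⌊4 * c * (d : ℝ)⌋₊ := ⟨_, rfl⟩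
  have hsU : (s' : ℝ) ≤ 4 * c * d := by rw [hs']; exact Nat.floor_le (by positivity)
  have hsL : c * d ≤ (s' : ℝ) := by
    have := Nat.lt_floor_add_one (4 * c * (d : ℝ))
    rw [← hs'] at this
    linarith
  have hs1 : 1 ≤ s' := by
    have : (1 : ℝ) ≤ s' := by linarith
    exact_mod_cast this
  obtain ⟨t, ht⟩ : ∃ t : ℕ, t = ⌊b * (d : ℝ)⌋₊ := ⟨_, rfl⟩
  have htU : (t : ℝ) ≤ b * d := by rw [ht]; exact Nat.floor_le (by positivity)
  have htL : b * d / 2 ≤ (t : ℝ) := by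
    have := Nat.lt_floor_add_one (b * (d : ℝ))
    rw [← ht] at this
    linarith
  have ht1 : 1 ≤ t := by
    have : (1 : ℝ) ≤ t := by linarith
    exact_mod_cast this
  have hτs : δ / 160 * (c * d) ≤ δ / 160 * s' := mul_le_mul_of_nonneg_left hsL (by positivity)
  have hΔt : (Δ : ℝ) * t ≤ Δ * b * d := by
    have := mul_le_mul_of_nonneg_left htU (show (0 : ℝ) ≤ Δ by positivity)
    linarith
  obtain ⟨cu⟩ := exists_cut (d + 1) p Δ t (C' + 1) hΔ1 hp hΔ (by
    rw [Nat.add_sub_cancel]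
    have h1 : b * d / 2 * C' ≤ t * C' := mul_le_mul_of_nonneg_right htL (by positivity)
    have h2 : 4 * (d : ℝ) ≤ b * C' * d := mul_le_mul_of_nonneg_right hC' (by positivity)
    have h3 : (d : ℝ) + 1 ≤ t * C' := by linarith
    exact_mod_cast h3) (by omega) ht1
  have hητ : 1 / (q : ℝ) * (8 * Δ) ≤ δ / 160 := by
    rw [one_div_mul_eq_div, div_le_iff₀ hq0]
    linarith
  have h4τ : 4 * (1 / (q : ℝ)) ≤ δ / 160 := by
    refine le_trans ?_ hητ
    rw [mul_comm]
    exact mul_le_mul_of_nonneg_left (by linarith) (by positivity)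
  have hr : RParam (δ / 160) (1 / q) (δ / 8) (κ * d) d N0 M0 M0' s' :=
    { hτ := by positivity
      hη := by positivity
      hp := by positivity
      hp1 := by linarith
      hητ := h4τ
      hkd := by positivity
      hsm := by exact_mod_cast hs1
      hM0 := by
        have := mul_le_mul_of_nonneg_right hM0 (show (0 : ℝ) ≤ d by positivity)
        linarith
      hM0' := by linarith
      hM0τ := by linarith
      hN0s := by
        have := mul_le_mul_of_nonneg_left hτs (show 0 ≤ δ / 8 by positivity)
        linarith
      hN0 := hN01
      hd := hd1 }
  have hcs4 : 4 * Δ * ((s' * q ^ M : ℕ) : ℝ) ≤ δ * d := by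
    push_cast
    have h1 := mul_le_mul_of_nonneg_right hsU (show 0 ≤ 4 * Δ * (q : ℝ) ^ M by positivity)
    have h2 := mul_le_mul_of_nonneg_right hc4 (show (0 : ℝ) ≤ d by positivity)
    linarith
  have hkτ : κ * d ≤ δ / 160 * s' := by
    refine le_trans ?_ hτs
    rw [hκd]
    have h1 : δ / 160 * μ0 / 4 ≤ δ / 160 * c := by
      have := mul_le_mul_of_nonneg_left hμ2 (show 0 ≤ δ / 160 by positivity)
      have : 0 ≤ δ / 160 * μ0 := by positivity
      linarith
    have := mul_le_mul_of_nonneg_right h1 (show (0 : ℝ) ≤ d by positivity)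
    linarith
  have hKs : 3 * d ≤ 2 * (K * s') := by
    have h1 := mul_le_mul_of_nonneg_left hsL (show (0 : ℝ) ≤ K by positivity)
    have h2 := mul_le_mul_of_nonneg_right hK (show (0 : ℝ) ≤ d by positivity)
    have h3 : 3 * (d : ℝ) ≤ 2 * (K * s') := by linarith
    exact_mod_cast h3
  have hcap : 8 + 8 * (K * (1 + Δ * t)) + 6 * K ≤ d := by
    have h1 := mul_le_mul_of_nonneg_left hΔt (show (0 : ℝ) ≤ K by positivity)
    have h2 := mul_le_mul_of_nonneg_right hb2 (show (0 : ℝ) ≤ d by positivity)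
    have h3 : 8 + 8 * ((K : ℝ) * (1 + Δ * t)) + 6 * K ≤ d := by linarith
    exact_mod_cast h3
  have hcap2 : ((1 + Δ * t : ℕ) : ℝ) ≤ 3 / 4 * s' := by
    push_cast
    have h2 := mul_le_mul_of_nonneg_right hb1 (show (0 : ℝ) ≤ d by positivity)
    linarith
  have hrem : K * (μ0 * d) + ((n * (K * (M0 + 2 * M0' + 2 * (M0 * N0)) + M0') + n * N0 + (nm + 1) +
      n * N3 : ℕ) : ℝ) ≤ δ / 160 * s' / 2 := by
    rw [← hX]
    have h1 := mul_le_mul_of_nonneg_right hμ1 (show (0 : ℝ) ≤ d by positivity)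
    linarith
  obtain ⟨H, hH1, hH2, hH3⟩ := core G d p hp Δ hΔ hΔ1 hfree δ hδ hδ1 q M s' (s' * q ^ M) (by linarith)
    hM hs1 le_rfl hcs4 a3 (κ * d) (μ0 * d) N0 M0 M0' hr (by linarith) (by linarith)
    (1 + Δ * t) (C' + 1) cu (by positivity) (by rw [hκd]; ring) hkτ K hKs hcap hcap2 N3 M1 n nm
    hN3 hM1 hM11 hn hnm (by rw [hn]; exact heapB_pos _ _) hrem a9 hN0 (θ * d) a10
    (by
      have := mul_le_mul_of_nonneg_right hθ2 (show (0 : ℝ) ≤ d by positivity)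
      linarith)
  refine ⟨H, hH1, ?_, hH3⟩
  have h1 : δ + 2 * θ ≤ ε ^ 2 := by linarith
  have h2 := mul_le_mul_of_nonneg_right h1
    (show (0 : ℝ) ≤ d * Fintype.card V by positivity)
  linarith

end HS

/-- main hyperstability theorem: For all `ε > 0` and `Δ ∈ ℕ`, for `d`
sufficiently large: if `T` is a tree with `d` edges and `Δ(T) ≤ Δ`, and `G` is a graph
on `n` vertices with `e(G) ≥ ε·d·n` containing no copy of `T`, then one can delete at
most `ε·e(G)` edges from `G` so that every connected component of the resulting graph
has a vertex cover of size at most `3d`. -/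
theorem stmt19 (ε : ℝ) (hε : 0 < ε) (Δ : ℕ) :
    ∃ d₀ : ℕ, ∀ d : ℕ, d₀ ≤ d →
      ∀ (W : Type) [Fintype W], ∀ T : SimpleGraph W, T.IsTree →
        T.edgeSet.ncard = d → (∀ w : W, (T.neighborSet w).ncard ≤ Δ) →
      ∀ (V : Type) [Fintype V], ∀ G : SimpleGraph V,
        ε * (d : ℝ) * (Fintype.card V : ℝ) ≤ (G.edgeSet.ncard : ℝ) →
        (¬ ∃ f : T →g G, Function.Injective f) →
        ∃ H : SimpleGraph V, H ≤ G ∧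
          ((G.edgeSet \ H.edgeSet).ncard : ℝ) ≤ ε * (G.edgeSet.ncard : ℝ) ∧
          ∀ c : H.ConnectedComponent, ∃ C : Set V, C ⊆ c.supp ∧ C.ncard ≤ 3 * d ∧
            ∀ x y : V, x ∈ c.supp → H.Adj x y → x ∈ C ∨ y ∈ C := by
  obtain ⟨d₀, h⟩ := HS.main_aux ε hε (max Δ 1) (le_max_right _ _)
  refine ⟨d₀, ?_⟩
  intro d hd W _ T hT hTd hTΔ V _ G hG hfree
  obtain ⟨p, hp, hΔ, hemb⟩ := HS.tree_order T hT d (max Δ 1) hTd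
    (fun w => (hTΔ w).trans (le_max_left _ _))
  obtain ⟨H, h1, h2, h3⟩ := h d hd p hp hΔ V G (fun he => hfree (hemb V G he))
  exact ⟨H, h1, h2.trans (mul_le_mul_of_nonneg_left hG hε.le), h3⟩
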